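/- There exists an absolute constant C > 0 with the following property: for all integers n, a, m, x, y with n ≥ 0, a ≥ 1, m ≥ 1, 0 < |F_{n,a}(x, y)| ≤ m and |y| ≥ 2·m^{1/3}, one has a ≤ C·μ', where μ' = (log m + log n)·(log n)·log log n if n ≥ 3, and μ' = 1 + log m if n ∈ {0, 1, 2}. -/

import Mathlib

noncomputable section

/-- The polynomial `f_n(X) = X³ − (n−1)X² − (n+2)X − 1`. -/
def fn (n : ℤ) (X : ℝ) : ℝ := X ^ 3 - ((n : ℝ) - 1) * X ^ 2 - ((n : ℝ) + 2) * X - 1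

/-- `l0, l1, l2` are the three distinct real roots of `f_n`. -/
def IsRoots (n : ℤ) (l0 l1 l2 : ℝ) : Prop :=
  fn n l0 = 0 ∧ fn n l1 = 0 ∧ fn n l2 = 0 ∧ l0 ≠ l1 ∧ l0 ≠ l2 ∧ l1 ≠ l2

/-- The form `F_{n,a}(x,y) = ∏ (x − λᵃ y)` over the three roots `λ` of `f_n`. -/
def Fna (a : ℤ) (l0 l1 l2 x y : ℝ) : ℝ :=
  (x - l0 ^ a * y) * (x - l1 ^ a * y) * (x - l2 ^ a * y)

section

open Finset

/-- Divided difference of the values `f` at the nodes `z 0, …, z i`. -/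
def divDiff (z f : ℕ → ℝ) (i : ℕ) : ℝ :=
  ∑ j ∈ range (i + 1), f j / ∏ k ∈ (range (i + 1)).erase j, (z j - z k)

lemma divDiff_zero (z f : ℕ → ℝ) : divDiff z f 0 = f 0 := by
  simp [divDiff]

lemma divDiff_one {z : ℕ → ℝ} {i : ℕ} (hz : Set.InjOn z (range (i + 1))) :
    divDiff z (fun _ => 1) i = if i = 0 then 1 else 0 := by
  have h := Lagrange.coeff_eq_sum (F := ℝ) hz (P := 1) (by
    rw [card_range, Polynomial.degree_one]; exact_mod_cast Nat.succ_pos i)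
  simp only [card_range, Nat.add_sub_cancel, Polynomial.eval_one] at h
  rw [divDiff, ← h, Polynomial.coeff_one]

lemma divDiff_add (z f g : ℕ → ℝ) (i : ℕ) :
    divDiff z (fun j => f j + g j) i = divDiff z f i + divDiff z g i := by
  simp only [divDiff, add_div, sum_add_distrib]

lemma divDiff_smul (z f : ℕ → ℝ) (c : ℝ) (i : ℕ) :
    divDiff z (fun j => c * f j) i = c * divDiff z f i := by
  simp only [divDiff, mul_div_assoc, mul_sum]

lemma divDiff_id_mul {z : ℕ → ℝ} {i : ℕ} (hz : Set.InjOn z (range (i + 2))) (f : ℕ → ℝ) :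
    divDiff z (fun j => z j * f j) (i + 1) = z (i + 1) * divDiff z f (i + 1) + divDiff z f i := by
  have key : ∑ j ∈ range (i + 2), (z j - z (i + 1)) * f j /
      ∏ k ∈ (range (i + 2)).erase j, (z j - z k) = divDiff z f i := by
    rw [sum_range_succ, sub_self, zero_mul, zero_div, add_zero, divDiff]
    refine sum_congr rfl fun j hj => ?_
    have hj' := mem_range.1 hj
    have hne : z j - z (i + 1) ≠ 0 := by
      intro h
      have := hz (by simp; omega) (by simp) (sub_eq_zero.1 h)
      omega
    have : (range (i + 2)).erase j = insert (i + 1) ((range (i + 1)).erase j) := by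
      ext k; simp; omega
    rw [this, prod_insert (by simp), mul_div_mul_left _ _ hne]
  rw [← key, divDiff, divDiff, mul_sum, ← sum_add_distrib]
  exact sum_congr rfl fun j _ => by ring

/-- The divided differences of `f` of order `i < N` are at most `B q⁻ⁱ`. -/
def DivDiffBound (z : ℕ → ℝ) (N : ℕ) (q : ℝ) (f : ℕ → ℝ) (B : ℝ) : Prop :=
  ∀ i < N, |divDiff z f i| * q ^ i ≤ B

namespace DivDiffBound
variable {z : ℕ → ℝ} {N : ℕ} {q : ℝ} {f g : ℕ → ℝ} {B C : ℝ}

lemma mono (h : DivDiffBound z N q f B) (hBC : B ≤ C) : DivDiffBound z N q f C :=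
  fun i hi => (h i hi).trans hBC

lemma add (hq : 0 ≤ q) (hf : DivDiffBound z N q f B) (hg : DivDiffBound z N q g C) :
    DivDiffBound z N q (fun j => f j + g j) (B + C) := fun i hi => by
  rw [divDiff_add]
  nlinarith [hf i hi, hg i hi, abs_add_le (divDiff z f i) (divDiff z g i), pow_nonneg hq i]

lemma smul (c : ℝ) (hf : DivDiffBound z N q f B) :
    DivDiffBound z N q (fun j => c * f j) (|c| * B) := fun i hi => by
  rw [divDiff_smul, abs_mul, mul_assoc]
  exact mul_le_mul_of_nonneg_left (hf i hi) (abs_nonneg c)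

lemma one (hz : Set.InjOn z (range N)) : DivDiffBound z N q (fun _ => 1) 1 := fun i hi => by
  rw [divDiff_one (hz.mono (by intro k; simp; omega))]
  split_ifs with h <;> simp [h]

lemma id_mul {Z : ℝ} (hz : Set.InjOn z (range N)) (hq : 0 ≤ q) (hZ : ∀ i < N, |z i| ≤ Z)
    (hf : DivDiffBound z N q f B) :
    DivDiffBound z N q (fun j => z j * f j) ((Z + q) * B) := fun i hi => by
  have hB : 0 ≤ B := (by positivity : 0 ≤ |divDiff z f i| * q ^ i).trans (hf i hi)
  cases i with
  | zero =>
    have h0 := hf 0 hi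
    simp only [divDiff_zero, pow_zero, mul_one, abs_mul] at h0 ⊢
    have := mul_le_mul (hZ 0 hi) h0 (abs_nonneg _) ((abs_nonneg _).trans (hZ 0 hi))
    nlinarith
  | succ i =>
    rw [divDiff_id_mul (hz.mono (by intro k; simp; omega))]
    have h1 := hf (i + 1) hi
    have h2 := hf i (by omega)
    have hz1 := hZ (i + 1) hi
    have hqi := pow_nonneg hq (i + 1)
    calc |z (i + 1) * divDiff z f (i + 1) + divDiff z f i| * q ^ (i + 1)
        ≤ (|z (i + 1)| * |divDiff z f (i + 1)| + |divDiff z f i|) * q ^ (i + 1) := by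
          rw [← abs_mul]; exact mul_le_mul_of_nonneg_right (abs_add_le _ _) hqi
      _ = |z (i + 1)| * (|divDiff z f (i + 1)| * q ^ (i + 1)) + q * (|divDiff z f i| * q ^ i) := by
          ring
      _ ≤ Z * B + q * B := add_le_add
          (mul_le_mul hz1 h1 (by positivity) ((abs_nonneg _).trans hz1))
          (mul_le_mul_of_nonneg_left h2 hq)
      _ = (Z + q) * B := by ring

lemma sub_const_mul {Z : ℝ} (hz : Set.InjOn z (range N)) (hq : 0 ≤ q) (hZ : ∀ i < N, |z i| ≤ Z)
    (c : ℝ) (hf : DivDiffBound z N q f B) :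
    DivDiffBound z N q (fun j => (z j - c) * f j) ((Z + q + |c|) * B) := by
  have := (hf.id_mul hz hq hZ).add hq (hf.smul (-c))
  rw [abs_neg] at this
  intro i hi
  convert this i hi using 1
  · congr 3; ext j; ring
  · ring

lemma exp {Z : ℝ} (hz : Set.InjOn z (range N)) (hq : 0 ≤ q) (hZ : ∀ i < N, |z i| ≤ Z) (c : ℝ) :
    DivDiffBound z N q (fun j => Real.exp (c * z j)) (Real.exp (|c| * (Z + q))) := fun i hi => by
  have hpow : ∀ p : ℕ, DivDiffBound z N q (fun j => z j ^ p) ((Z + q) ^ p) := by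
    intro p
    induction p with
    | zero => simpa using one hz
    | succ p ih => simpa only [pow_succ'] using ih.id_mul hz hq hZ
  have hs : ∀ x : ℝ, HasSum (fun p : ℕ => x ^ p / (p.factorial : ℝ)) (Real.exp x) := fun x => by
    rw [Real.exp_eq_exp_ℝ]; exact NormedSpace.expSeries_div_hasSum_exp x
  have h1 : HasSum (fun p : ℕ => c ^ p / (p.factorial : ℝ) * divDiff z (fun j => z j ^ p) i)
      (divDiff z (fun j => Real.exp (c * z j)) i) := by
    simp only [divDiff, mul_sum]
    refine hasSum_sum fun j _ => ?_
    have h := (hs (c * z j)).div_const (∏ k ∈ (range (i + 1)).erase j, (z j - z k))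
    have e : ∀ p : ℕ, c ^ p / (p.factorial : ℝ) * (z j ^ p / ∏ k ∈ (range (i + 1)).erase j, (z j - z k))
        = (c * z j) ^ p / (p.factorial : ℝ) / ∏ k ∈ (range (i + 1)).erase j, (z j - z k) := fun p => by
      rw [mul_pow]; ring
    simp only [e]
    exact h
  have h2 := (hs (|c| * (Z + q)))
  have h3 := (h1.mul_right (q ^ i))
  rw [← abs_of_nonneg (pow_nonneg hq i), ← abs_mul, ← Real.norm_eq_abs]
  refine h3.norm_le_of_bounded h2 fun p => ?_
  rw [Real.norm_eq_abs, abs_mul, abs_mul, abs_div, abs_pow, Nat.abs_cast, abs_of_nonneg (pow_nonneg hq i),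
    mul_assoc, mul_pow, mul_div_right_comm]
  exact mul_le_mul_of_nonneg_left (hpow p i hi) (by positivity)

lemma choose_mul {Z : ℝ} (hz : Set.InjOn z (range N)) (hq : 0 ≤ q) {w : ℕ → ℕ}
    (hw : ∀ j, z j = w j) (hZ : ∀ i < N, |z i| ≤ Z) (hZ0 : 0 ≤ Z) {K : ℝ} (k : ℕ) (hk : (k : ℝ) ≤ K)
    (hB : 0 ≤ B) (hf : DivDiffBound z N q f B) :
    DivDiffBound z N q (fun j => ((w j).choose k : ℝ) * f j)
      ((Z + q + K) ^ k / (k.factorial : ℝ) * B) := by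
  induction k with
  | zero => simpa using hf
  | succ k ih =>
    push_cast at hk
    have h := ((ih (by linarith)).sub_const_mul hz hq hZ k).smul (1 / (k + 1 : ℝ))
    have e : ∀ j, ((w j).choose (k + 1) : ℝ) * f j =
        1 / (k + 1 : ℝ) * ((z j - k) * (((w j).choose k : ℝ) * f j)) := fun j => by
      have h1 : ((w j).choose (k + 1) : ℝ) * (k + 1) = (w j).choose k * (z j - k) := by
        rw [hw]
        rcases le_or_gt k (w j) with h | h
        · rw [← Nat.cast_sub h]; exact_mod_cast Nat.choose_succ_right_eq (w j) k
        · simp [Nat.choose_eq_zero_of_lt h, Nat.choose_eq_zero_of_lt (h.trans (Nat.lt_succ_self k))]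
      field_simp
      linear_combination f j * h1
    simp only [e]
    refine h.mono ?_
    have hc : 0 ≤ (Z + q + K) ^ k / (k.factorial : ℝ) * B := by
      have : (0:ℝ) ≤ k := Nat.cast_nonneg k
      have : 0 ≤ Z + q + K := by linarith
      positivity
    rw [abs_of_nonneg (by positivity), Nat.abs_cast, Nat.factorial_succ, pow_succ, Nat.cast_mul,
      Nat.cast_succ]
    calc 1 / ((k : ℝ) + 1) * ((Z + q + k) * ((Z + q + K) ^ k / (k.factorial : ℝ) * B))
        ≤ 1 / ((k : ℝ) + 1) * ((Z + q + K) * ((Z + q + K) ^ k / (k.factorial : ℝ) * B)) := by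
          gcongr; linarith
      _ = _ := by field_simp

end DivDiffBound

/-- Determinants of functions with small divided differences are small. -/
lemma abs_det_le_of_divDiffBound {z : ℕ → ℝ} {N : ℕ} (hz : Set.InjOn z (range N)) {Z ρ B : ℝ}
    (hZ : 0 < Z) (hρ : 0 < ρ) (hzZ : ∀ i < N, 0 ≤ z i ∧ z i ≤ Z) {f : Fin N → ℕ → ℝ}
    (hf : ∀ j, DivDiffBound z N (ρ * Z) (f j) B) :
    |(Matrix.of fun i j : Fin N => f j i).det| * ρ ^ (∑ i ∈ range N, i) ≤ N.factorial * B ^ N := by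
  set X : Matrix (Fin N) (Fin N) ℝ := Matrix.of fun i j : Fin N => f j i with hX
  let D : Matrix (Fin N) (Fin N) ℝ := Matrix.of fun i j : Fin N =>
    if (j : ℕ) ≤ i then (ρ * Z) ^ (i : ℕ) / ∏ k ∈ (range (i + 1)).erase j, (z j - z k) else 0
  have hDX : ∀ i j, (D * X) i j = divDiff z (f j) i * (ρ * Z) ^ (i : ℕ) := by
    intro i j
    rw [Matrix.mul_apply]
    simp only [D, X, Matrix.of_apply]
    rw [Fin.sum_univ_eq_sum_range (fun k : ℕ =>
      (if k ≤ i then (ρ * Z) ^ (i : ℕ) / ∏ l ∈ (range (i + 1)).erase k, (z k - z l) else 0) * f j k)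
      N, divDiff, sum_mul]
    symm
    refine sum_subset_zero_on_sdiff (fun k => by simp; omega) ?_ ?_
    · intro k hk
      simp only [mem_sdiff, mem_range, not_lt] at hk
      rw [if_neg (by omega), zero_mul]
    · intro k hk
      rw [if_pos (by simpa [Nat.lt_succ_iff] using hk)]; ring
  have h1 : |(D * X).det| ≤ N.factorial * B ^ N := by
    have := Matrix.det_le (A := D * X) (abv := AbsoluteValue.abs) (x := B) (fun i j => by
      rw [hDX, AbsoluteValue.abs_apply, abs_mul, abs_of_nonneg (a := (ρ * Z) ^ (i : ℕ)) (by positivity)]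
      exact hf j i i.2)
    simpa using this
  have h2 : D.det = ∏ i : Fin N, (ρ * Z) ^ (i : ℕ) / ∏ k ∈ range i, (z i - z k) := by
    rw [Matrix.det_of_isLowerTriangular D (fun i j hij => by
      simp only [D, Matrix.of_apply]
      rw [if_neg]; simpa using hij)]
    refine prod_congr rfl fun i _ => ?_
    simp only [D, Matrix.of_apply, le_refl, if_true]
    congr 2
    rw [range_add_one, erase_insert (by simp)]
  have h3 : ρ ^ (∑ i ∈ range N, i) ≤ |D.det| := by
    rw [h2, abs_prod, ← prod_pow_eq_pow_sum, ← Fin.prod_univ_eq_prod_range]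
    refine prod_le_prod (fun i _ => by positivity) fun i _ => ?_
    have hp : |∏ k ∈ range (i : ℕ), (z i - z k)| ≤ Z ^ (i : ℕ) := by
      rw [abs_prod]
      calc _ ≤ ∏ k ∈ range (i : ℕ), Z := prod_le_prod (fun _ _ => abs_nonneg _) fun k hk => by
            have hk' : k < N := (mem_range.1 hk).trans i.2
            rw [abs_le]
            constructor <;> linarith [(hzZ i i.2).1, (hzZ i i.2).2, (hzZ k hk').1, (hzZ k hk').2]
        _ = _ := by simp
    have hp0 : 0 < |∏ k ∈ range (i : ℕ), (z i - z k)| := by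
      rw [abs_pos, prod_ne_zero_iff]
      intro k hk h
      have hk' := mem_range.1 hk
      have := hz (by simp [i.2]) (by simp; omega) (sub_eq_zero.1 h)
      omega
    rw [abs_div, abs_of_nonneg (a := (ρ * Z) ^ (i : ℕ)) (by positivity), le_div_iff₀ hp0, mul_pow]
    gcongr
  calc _ ≤ |X.det| * |D.det| := by gcongr
    _ = |(D * X).det| := by rw [Matrix.det_mul, abs_mul, mul_comm]
    _ ≤ _ := h1

lemma factorial_card_le_prod (s : Finset ℕ) (hs : ∀ x ∈ s, 0 < x) :
    (#s).factorial ≤ ∏ x ∈ s, x := by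
  induction s using Finset.induction_on_max with
  | empty => simp
  | insert a s ha ih =>
    have hna : a ∉ s := fun h => lt_irrefl _ (ha a h)
    rw [card_insert_of_notMem hna, prod_insert hna, Nat.factorial_succ]
    refine Nat.mul_le_mul ?_ (ih fun x hx => hs x (mem_insert_of_mem hx))
    have h1 : s ⊆ Ioo 0 a := fun x hx => by
      simp [ha x hx, hs x (mem_insert_of_mem hx)]
    have h2 := card_le_card h1
    have h3 := hs a (mem_insert_self a s)
    rw [Nat.card_Ioo] at h2
    omega

/-- The distances from a natural number to `i` other ones have product at least `i! / 2ⁱ`. -/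
lemma factorial_card_le_two_pow_mul_prod_abs_sub (s : Finset ℕ) (a : ℕ) (ha : a ∉ s) :
    ((#s).factorial : ℝ) ≤ 2 ^ #s * ∏ x ∈ s, |(a : ℝ) - x| := by
  have hsplit : ∀ p : ℕ → ℕ, Set.InjOn p s → (∀ x ∈ s, 0 < p x) → ∀ t ⊆ s,
      ((#t).factorial : ℝ) ≤ ∏ x ∈ t, (p x : ℝ) := by
    intro p hp h0 t ht
    have := factorial_card_le_prod (t.image p) (by
      intro y hy; obtain ⟨x, hx, rfl⟩ := mem_image.1 hy; exact h0 x (ht hx))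
    rw [card_image_of_injOn (hp.mono ht), prod_image (hp.mono ht)] at this
    exact_mod_cast this
  have h1 : ((#(s.filter (· < a))).factorial : ℝ) ≤ ∏ x ∈ s.filter (· < a), |(a : ℝ) - x| := by
    have := factorial_card_le_prod ((s.filter (· < a)).image (a - ·)) (by
      intro y hy; obtain ⟨x, hx, rfl⟩ := mem_image.1 hy
      have := (mem_filter.1 hx).2; omega)
    have hinj : Set.InjOn (fun x => a - x) (s.filter (· < a)) := by
      intro x hx y hy h
      have := (mem_filter.1 hx).2; have := (mem_filter.1 hy).2
      simp only at h; omega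
    rw [card_image_of_injOn hinj, prod_image hinj] at this
    refine (Nat.cast_le.2 this).trans (le_of_eq ?_)
    rw [Nat.cast_prod]
    refine prod_congr rfl fun x hx => ?_
    have hxa := (mem_filter.1 hx).2
    rw [Nat.cast_sub hxa.le, abs_of_nonneg]
    simpa using hxa.le
  have h2 : ((#(s.filter (¬ · < a))).factorial : ℝ) ≤ ∏ x ∈ s.filter (¬ · < a), |(a : ℝ) - x| := by
    have hlt : ∀ x ∈ s.filter (¬ · < a), a < x := fun x hx => by
      have h3 := (mem_filter.1 hx)
      have : a ≠ x := fun h => ha (h ▸ h3.1)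
      omega
    have := factorial_card_le_prod ((s.filter (¬ · < a)).image (· - a)) (by
      intro y hy; obtain ⟨x, hx, rfl⟩ := mem_image.1 hy
      have := hlt x hx; omega)
    have hinj : Set.InjOn (fun x => x - a) (s.filter (¬ · < a)) := by
      intro x hx y hy h
      have := hlt x hx; have := hlt y hy
      simp only at h; omega
    rw [card_image_of_injOn hinj, prod_image hinj] at this
    refine (Nat.cast_le.2 this).trans (le_of_eq ?_)
    rw [Nat.cast_prod]
    refine prod_congr rfl fun x hx => ?_
    have hxa := hlt x hx
    rw [Nat.cast_sub hxa.le, abs_sub_comm, abs_of_nonneg]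
    simpa using hxa.le
  rw [← prod_filter_mul_prod_filter_not s (· < a)]
  have hc := card_filter_add_card_filter_not (s := s) (· < a)
  set u := #(s.filter (· < a))
  set v := #(s.filter (¬ · < a))
  have h3 : ((u + v).factorial : ℝ) ≤ 2 ^ (u + v) * (u.factorial * v.factorial) := by
    have h4 : (u + v).factorial ≤ 2 ^ (u + v) * (u.factorial * v.factorial) := by
      rw [← Nat.add_choose_mul_factorial_mul_factorial u v, mul_assoc]
      exact Nat.mul_le_mul_right _ (Nat.choose_le_two_pow _ _)
    exact_mod_cast h4
  rw [← hc]
  refine h3.trans ?_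
  gcongr

lemma pow_div_factorial_le {x y : ℝ} {k K : ℕ} (hk : k ≤ K) (hy : 0 < y) (hyx : y ≤ x) :
    x ^ k / (k.factorial : ℝ) ≤ (x / y) ^ K * Real.exp y := by
  have h1 : y ^ k / (k.factorial : ℝ) ≤ Real.exp y := Real.pow_div_factorial_le_exp y hy.le k
  have h2 : (x / y) ^ k ≤ (x / y) ^ K := pow_le_pow_right₀ ((one_le_div hy).2 hyx) hk
  calc x ^ k / (k.factorial : ℝ) = (x / y) ^ k * (y ^ k / (k.factorial : ℝ)) := by
        rw [div_pow]; field_simp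
    _ ≤ _ := mul_le_mul h2 h1 (by positivity) (by have := hy.trans_le hyx; positivity)

/-- Divided differences at distinct natural numbers of arbitrary values. -/
lemma DivDiffBound.of_abs_le {z : ℕ → ℝ} {N : ℕ} {q F : ℝ} {f : ℕ → ℝ} {w : ℕ → ℕ}
    (hw : ∀ j, z j = w j) (hz : Set.InjOn z (range N)) (hN : 0 < N) (hq : (N : ℝ) ≤ 2 * q)
    (hf : ∀ j < N, |f j| ≤ F) :
    DivDiffBound z N q f (F * (N * ((2 * q / N) ^ N * Real.exp N))) := fun i hi => by
  have hF : 0 ≤ F := (abs_nonneg _).trans (hf 0 hN)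
  have hq0 : 0 ≤ q := by have : (0:ℝ) ≤ N := Nat.cast_nonneg N; linarith
  have h1 : |divDiff z f i| ≤ ∑ j ∈ range (i + 1), F * (2 ^ i / (i.factorial : ℝ)) := by
    refine (abs_sum_le_sum_abs _ _).trans (sum_le_sum fun j hj => ?_)
    have hj' := mem_range.1 hj
    rw [abs_div, div_eq_mul_inv]
    refine mul_le_mul (hf j (by omega)) ?_ (by positivity) hF
    have hinj : Set.InjOn w ((range (i + 1)).erase j) := fun x hx y hy h => by
      simp at hx hy
      exact hz (by simp; omega) (by simp; omega) (by rw [hw, hw, h])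
    have h := factorial_card_le_two_pow_mul_prod_abs_sub (((range (i + 1)).erase j).image w) (w j) (by
      intro h
      obtain ⟨k, hk, hkj⟩ := mem_image.1 h
      simp at hk
      exact hk.1 (hz (by simp; omega) (by simp; omega) (by rw [hw, hw, hkj])))
    rw [card_image_of_injOn hinj, prod_image hinj, card_erase_of_mem hj, card_range,
      Nat.add_sub_cancel] at h
    rw [abs_prod]
    simp only [hw]
    have hp : (0 : ℝ) < i.factorial := by exact_mod_cast i.factorial_pos
    have hp2 : 0 < ∏ k ∈ (range (i + 1)).erase j, |(w j : ℝ) - w k| := by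
      by_contra h0
      have : (2 : ℝ) ^ i * ∏ k ∈ (range (i + 1)).erase j, |(w j : ℝ) - w k| ≤ 0 :=
        mul_nonpos_of_nonneg_of_nonpos (by positivity) (not_lt.1 h0)
      linarith
    rw [inv_le_comm₀ hp2 (by positivity), inv_div, div_le_iff₀ (by positivity)]
    linarith
  rw [sum_const, card_range, nsmul_eq_mul] at h1
  have hN' : (0:ℝ) < N := by exact_mod_cast hN
  have h2 := pow_div_factorial_le (x := 2 * q) (y := N) hi.le hN' hq
  have h3 : ((i + 1 : ℕ) : ℝ) ≤ N := by exact_mod_cast hi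
  calc |divDiff z f i| * q ^ i ≤ ((i + 1 : ℕ) * (F * (2 ^ i / (i.factorial : ℝ)))) * q ^ i := by
        gcongr
    _ = F * ((i + 1 : ℕ) * ((2 * q) ^ i / (i.factorial : ℝ))) := by rw [mul_pow]; ring
    _ ≤ _ := by gcongr

/-- A family of vectors in `ℝᴺ` on which no nonzero functional vanishes contains a basis. -/
lemma exists_det_ne_zero {ι κ : Type*} [Fintype κ] {N : ℕ} (e : Fin N ≃ κ) (Φ : ι → κ → ℝ)
    (h : ∀ p : κ → ℝ, (∀ i, ∑ j, p j * Φ i j = 0) → p = 0) :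
    ∃ f : Fin N → ι, (Matrix.of fun i j : Fin N => Φ (f i) (e j)).det ≠ 0 := by
  let Ψ : ι → Fin N → ℝ := fun i j => Φ i (e j)
  have htop : Submodule.span ℝ (Set.range Ψ) = ⊤ := by
    by_contra hne
    obtain ⟨g, hg0, hg⟩ := Submodule.exists_le_ker_of_lt_top _ (lt_top_iff_ne_top.2 hne)
    have hgv : ∀ v, g v = ∑ j, v j • g (fun i => if j = i then 1 else 0) :=
      fun v => LinearMap.pi_apply_eq_sum_univ g v
    have h1 := h (fun j => g (fun i => if e.symm j = i then 1 else 0)) fun i => by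
      have h2 : g (Ψ i) = 0 := hg (Submodule.subset_span ⟨i, rfl⟩)
      rw [hgv] at h2
      refine Eq.trans ?_ h2
      rw [← e.sum_comp]
      exact sum_congr rfl fun j _ => by simp [Ψ, mul_comm]
    refine hg0 (LinearMap.ext fun v => ?_)
    rw [hgv]
    refine sum_eq_zero fun j _ => ?_
    have h3 := congrFun h1 (e j)
    simp only [Equiv.symm_apply_apply, Pi.zero_apply] at h3
    rw [h3, smul_zero]
  have hN : Module.finrank ℝ (Submodule.span ℝ (Set.range Ψ)) = N := by
    rw [htop, finrank_top]; simp
  obtain ⟨v, hv, -, hli⟩ := Submodule.exists_fun_fin_finrank_span_eq ℝ (Set.range Ψ)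
  choose f hf using hv
  refine ⟨fun i => f (Fin.cast hN.symm i), ?_⟩
  have hli' := hli.comp (Fin.cast hN.symm) (Fin.cast_injective _)
  have := (Matrix.linearIndependent_rows_iff_isUnit
    (A := Matrix.of fun i j : Fin N => Φ (f (Fin.cast hN.symm i)) (e j))).1 (by
      have he : (Matrix.of fun i j : Fin N => Φ (f (Fin.cast hN.symm i)) (e j)).row =
          v ∘ Fin.cast hN.symm := by
        ext i j
        simp only [Function.comp, ← hf]
        rfl
      rw [he]
      exact hli')
  rw [Matrix.isUnit_iff_isUnit_det] at this
  exact this.ne_zero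

open Polynomial in
lemma det_ne_zero_of_exp_shift {m : ℕ} (Q : Fin m → ℝ[X]) (hQ : ∀ i, Q i ≠ 0) {v : Fin m → ℝ}
    (hv : Function.Injective v) (hv0 : ∀ i, v i ≠ 0) :
    (Matrix.of fun r i : Fin m => (Q i).comp (X + C (r : ℝ)) * C (v i ^ (r : ℕ))).det ≠ 0 ∧
    (Matrix.of fun r i : Fin m => (Q i).comp (X + C (r : ℝ)) * C (v i ^ (r : ℕ))).det.natDegree ≤
      ∑ i, (Q i).natDegree := by
  set A := (Matrix.of fun r i : Fin m => (Q i).comp (X + C (r : ℝ)) * C (v i ^ (r : ℕ))) with hA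
  have hnd : ∀ r i, (A r i).natDegree = (Q i).natDegree := fun r i => by
    simp only [hA, Matrix.of_apply]
    rw [natDegree_mul_C (pow_ne_zero _ (hv0 i)), natDegree_comp, natDegree_X_add_C, mul_one]
  have hlc : ∀ r i, (A r i).leadingCoeff = (Q i).leadingCoeff * v i ^ (r : ℕ) := fun r i => by
    simp only [hA, Matrix.of_apply]
    rw [leadingCoeff_mul, leadingCoeff_C, leadingCoeff_comp (by rw [natDegree_X_add_C]; exact one_ne_zero),
      leadingCoeff_X_add_C, one_pow, mul_one]
  have hne : ∀ r i, A r i ≠ 0 := fun r i => by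
    rw [← leadingCoeff_ne_zero, hlc]
    exact mul_ne_zero (leadingCoeff_ne_zero.2 (hQ i)) (pow_ne_zero _ (hv0 i))
  have hpd : ∀ σ : Equiv.Perm (Fin m), (∏ i, A (σ i) i).natDegree = ∑ i, (Q i).natDegree := fun σ => by
    rw [natDegree_prod _ _ fun i _ => hne _ i]
    exact sum_congr rfl fun i _ => hnd _ i
  constructor
  · intro h0
    have h1 : A.det.coeff (∑ i, (Q i).natDegree) =
        (Matrix.of fun r i : Fin m => (Q i).leadingCoeff * v i ^ (r : ℕ)).det := by
      rw [Matrix.det_apply, Matrix.det_apply, finsetSum_coeff]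
      refine sum_congr rfl fun σ _ => ?_
      rw [coeff_smul]
      congr 1
      rw [← hpd σ, coeff_natDegree, leadingCoeff_prod]
      exact prod_congr rfl fun i _ => hlc _ i
    rw [h0, coeff_zero] at h1
    have h2 : (Matrix.of fun r i : Fin m => (Q i).leadingCoeff * v i ^ (r : ℕ)) =
        Matrix.of fun r i : Fin m => (Q i).leadingCoeff * (Matrix.vandermonde v).transpose r i := by
      ext; simp [Matrix.vandermonde]
    rw [h2, Matrix.det_mul_row, Matrix.det_transpose] at h1
    refine mul_ne_zero ?_ (Matrix.det_vandermonde_ne_zero_iff.2 hv) h1.symm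
    exact prod_ne_zero_iff.2 fun i _ => leadingCoeff_ne_zero.2 (hQ i)
  · rw [Matrix.det_apply]
    refine natDegree_sum_le_of_forall_le _ _ fun σ _ => ?_
    refine (natDegree_smul_le _ _).trans (hpd σ).le

open Polynomial in
/-- Zero estimate: an exponential polynomial vanishing on a large grid is zero. -/
lemma eq_zero_of_forall_grid {K M R S b : ℕ} (hK : 0 < K) (hMR : M ≤ R) (hKM : K * M ≤ R * S)
    (hRb : R ≤ b) {a w : ℝ} (ha : 0 < a) (ha1 : a ≠ 1) (hw : 0 < w) (p : Fin K × Fin M → ℝ)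
    (hp : ∀ r < 2 * R, ∀ s < S, ∑ j, p j * (((r + s * b).choose j.1 : ℝ) *
      (a ^ (j.2 * r : ℕ) * w ^ (j.2 * s : ℕ))) = 0) : p = 0 := by
  let Q : Fin M → ℝ[X] := fun l => ∑ k : Fin K,
    C (p (k, l) / ((k : ℕ).factorial : ℝ)) * descPochhammer ℝ k
  have hQeval : ∀ l (u : ℕ), (Q l).eval (u : ℝ) = ∑ k : Fin K, p (k, l) * (u.choose k : ℝ) := by
    intro l u
    simp only [Q, eval_finsetSum, eval_mul, eval_C, descPochhammer_eval_eq_descFactorial]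
    refine sum_congr rfl fun k _ => ?_
    have : ((k : ℕ).factorial : ℝ) ≠ 0 := by exact_mod_cast (k : ℕ).factorial_ne_zero
    rw [Nat.descFactorial_eq_factorial_mul_choose, Nat.cast_mul]
    field_simp
  have hQdeg : ∀ l, (Q l).natDegree ≤ K - 1 := fun l => by
    refine natDegree_sum_le_of_forall_le _ _ fun k _ => (natDegree_C_mul_le _ _).trans ?_
    rw [descPochhammer_natDegree]; have := k.2; omega
  have hQ0 : ∀ l, Q l = 0 → ∀ k, p (k, l) = 0 := by
    intro l hl
    have h : ∀ u : ℕ, ∀ hu : u < K, p (⟨u, hu⟩, l) = 0 := by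
      intro u
      induction u using Nat.strong_induction_on with
      | _ u ih =>
        intro hu
        have h1 := hQeval l u
        rw [hl, eval_zero, Finset.sum_eq_single ⟨u, hu⟩] at h1
        · simpa using h1.symm
        · intro k _ hk
          rcases lt_trichotomy (k : ℕ) u with h2 | h2 | h2
          · rw [ih k h2 k.2, zero_mul]
          · exact absurd (Fin.ext h2) hk
          · rw [Nat.choose_eq_zero_of_lt h2]; simp
        · simp
    exact fun k => h k k.2
  by_contra hpne
  classical
  let 𝓛 : Finset (Fin M) := univ.filter fun l => Q l ≠ 0
  let e := 𝓛.equivFin.symm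
  have hpos : 0 < #𝓛 := by
    rw [card_pos]
    by_contra hemp
    apply hpne
    ext ⟨k, l⟩
    refine hQ0 l ?_ k
    by_contra h
    exact hemp ⟨l, by simp [𝓛, h]⟩
  have hle : #𝓛 ≤ M := by simpa using card_le_univ 𝓛
  obtain ⟨hdet, hdeg⟩ := det_ne_zero_of_exp_shift (fun i => Q (e i)) (fun i => by
      exact (mem_filter.1 (e i).2).2) (v := fun i => a ^ ((e i : Fin M) : ℕ)) (by
      intro i j hij
      apply e.injective
      have := pow_right_injective₀ ha ha1 hij
      exact Subtype.ext (Fin.ext this)) (fun i => (pow_pos ha _).ne')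
  set A := (Matrix.of fun r i : Fin #𝓛 => (Q (e i)).comp (X + C (r : ℝ)) *
    C ((a ^ ((e i : Fin M) : ℕ)) ^ (r : ℕ))) with hA
  have hroot : ∀ r < R, ∀ s < S, A.det.IsRoot ((r + s * b : ℕ) : ℝ) := by
    intro r hr s hs
    rw [IsRoot, ← coe_evalRingHom, RingHom.map_det, ← Matrix.exists_mulVec_eq_zero_iff]
    refine ⟨fun i => (a ^ r * w ^ s) ^ ((e i : Fin M) : ℕ), ?_, ?_⟩
    · intro h
      have := congrFun h ⟨0, hpos⟩
      have h2 : 0 < (a ^ r * w ^ s) ^ ((e ⟨0, hpos⟩ : Fin M) : ℕ) := by positivity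
      exact h2.ne' this
    · ext r1
      have h := hp (r + r1) (by have := r1.2; omega) s hs
      simp only [Matrix.mulVec, dotProduct, RingHom.mapMatrix_apply, Matrix.map_apply, hA,
        Matrix.of_apply, coe_evalRingHom, eval_mul, eval_comp, eval_C, eval_add, eval_X,
        Pi.zero_apply]
      rw [← h, Fintype.sum_prod_type_right, e.sum_comp (fun l : 𝓛 => eval (((r + s * b : ℕ) : ℝ) + r1) (Q l) *
        (a ^ ((l : Fin M) : ℕ)) ^ (r1 : ℕ) * (a ^ r * w ^ s) ^ ((l : Fin M) : ℕ)),
        sum_coe_sort 𝓛 (fun l : Fin M => eval (((r + s * b : ℕ) : ℝ) + r1) (Q l) *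
        (a ^ (l : ℕ)) ^ (r1 : ℕ) * (a ^ r * w ^ s) ^ (l : ℕ))]
      rw [sum_subset (subset_univ 𝓛) (fun l _ hl => by
        have : Q l = 0 := by simpa [𝓛] using hl
        rw [this]; simp)]
      refine sum_congr rfl fun l _ => ?_
      rw [← Nat.cast_add, hQeval, mul_assoc, sum_mul]
      refine sum_congr rfl fun k _ => ?_
      have : r + s * b + r1 = r + r1 + s * b := by ring
      rw [this, mul_assoc, mul_pow, ← pow_mul, ← pow_mul, ← pow_mul, ← mul_assoc (a ^ _), ← pow_add]
      ring_nf
  have hcard : R * S ≤ A.det.natDegree := by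
    have h1 : ((range R ×ˢ range S).image fun q : ℕ × ℕ => ((q.1 + q.2 * b : ℕ) : ℝ)).card = R * S := by
      rw [card_image_of_injOn, card_product, card_range, card_range]
      rintro ⟨r, s⟩ h ⟨r', s'⟩ h' heq
      simp only [coe_product, coe_range, Set.mem_prod, Set.mem_Iio, Nat.cast_inj] at h h' heq
      have hr : r < b := by omega
      have hr' : r' < b := by omega
      have h3 : (r + s * b) / b = (r' + s' * b) / b := by rw [heq]
      rw [Nat.add_mul_div_right _ _ (by omega), Nat.add_mul_div_right _ _ (by omega),
        Nat.div_eq_of_lt hr, Nat.div_eq_of_lt hr', zero_add, zero_add] at h3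
      subst h3
      simpa using heq
    rw [← h1]
    refine (card_le_card (t := A.det.roots.toFinset) fun x hx => ?_).trans
      ((Multiset.toFinset_card_le _).trans (card_roots' _))
    obtain ⟨⟨r, s⟩, hrs, rfl⟩ := mem_image.1 hx
    simp only [mem_product, mem_range] at hrs
    rw [Multiset.mem_toFinset, mem_roots hdet]
    exact hroot r hrs.1 s hrs.2
  have h2 : ∑ i : Fin #𝓛, (Q (e i)).natDegree ≤ #𝓛 * (K - 1) := by
    refine (sum_le_card_nsmul _ _ (K - 1) fun i _ => hQdeg _).trans ?_
    simp
  have h3 : #𝓛 * (K - 1) < K * M := by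
    calc #𝓛 * (K - 1) ≤ M * (K - 1) := Nat.mul_le_mul_right _ hle
      _ < M * K := Nat.mul_lt_mul_of_pos_left (by omega) (by omega)
      _ = K * M := mul_comm _ _
  omega

lemma abs_exp_sub_one_le_two_mul {x ε : ℝ} (hx : |x| ≤ ε) (hε : ε ≤ 1) :
    |Real.exp x - 1| ≤ 2 * ε := by
  have := Real.abs_exp_sub_one_le (hx.trans hε)
  linarith

lemma choose_le_pow_div_mul_exp {u k K : ℕ} {Y : ℝ} (hk : k ≤ K) (hK : 0 < K) (hu : (u : ℝ) ≤ Y)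
    (hKY : (K : ℝ) ≤ Y) : (u.choose k : ℝ) ≤ (Y / K) ^ K * Real.exp K := by
  have hK' : (0:ℝ) < K := by exact_mod_cast hK
  calc (u.choose k : ℝ) ≤ (u : ℝ) ^ k / (k.factorial : ℝ) := Nat.choose_le_pow_div k u
    _ ≤ Y ^ k / (k.factorial : ℝ) := by gcongr
    _ ≤ _ := pow_div_factorial_le hk hK' hKY

lemma DivDiffBound.choose_mul_exp {z : ℕ → ℝ} {N K M : ℕ} {ρ Z D ε Λ c : ℝ} {w s : ℕ → ℕ}
    (hw : ∀ j, z j = w j) (hz : Set.InjOn z (range N)) (hN : 0 < N) (hρ : 0 < ρ) (hK : 0 < K)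
    (hNZ : (N : ℝ) ≤ 2 * (ρ * Z)) (hzZ : ∀ i < N, z i ≤ Z) (hKZ : (K : ℝ) ≤ Z) {k l : ℕ}
    (hk : k ≤ K) (hl : l ≤ M) (hD : M * |c| * ((1 + ρ) * Z) ≤ D)
    (hs : ∀ j < N, M * s j * |Λ| ≤ ε) (hε1 : ε ≤ 1)
    (hε : 2 * ε * (N * ((2 * (ρ * Z) / N) ^ N * Real.exp N)) ≤ 1) :
    DivDiffBound z N (ρ * Z) (fun j => ((w j).choose k : ℝ) * Real.exp (l * (c * z j - s j * Λ)))
      (2 * (((2 + ρ) * Z / K) ^ K * Real.exp K * Real.exp D)) := by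
  have hK' : (0:ℝ) < K := by exact_mod_cast hK
  have hZ : 0 < Z := by linarith
  have hq : 0 ≤ ρ * Z := by positivity
  have hl' : (l : ℝ) ≤ M := by exact_mod_cast hl
  have hk' : (k : ℝ) ≤ K := by exact_mod_cast hk
  have hz0 : ∀ j, 0 ≤ z j := fun j => by rw [hw]; positivity
  have habs : ∀ i < N, |z i| ≤ Z := fun i hi => by rw [abs_of_nonneg (hz0 i)]; exact hzZ i hi
  have hmain := (DivDiffBound.exp hz hq habs (l * c)).choose_mul hz hq hw habs hZ.le k hk'
    (Real.exp_pos _).le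
  have hm : (Z + ρ * Z + K) ^ k / (k.factorial : ℝ) * Real.exp (|l * c| * (Z + ρ * Z)) ≤
      ((2 + ρ) * Z / K) ^ K * Real.exp K * Real.exp D := by
    refine mul_le_mul ?_ ?_ (Real.exp_pos _).le (by positivity)
    · refine le_trans ?_ (pow_div_factorial_le hk hK' (by nlinarith))
      gcongr
      linarith
    · apply Real.exp_le_exp.2
      refine le_trans ?_ hD
      rw [abs_mul, Nat.abs_cast]
      have : Z + ρ * Z = (1 + ρ) * Z := by ring
      rw [this]
      gcongr
  have herr := DivDiffBound.of_abs_le (q := ρ * Z) (F := ((2 + ρ) * Z / K) ^ K * Real.exp K * Real.exp D * (2 * ε))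
    (f := fun j => ((w j).choose k : ℝ) * Real.exp (l * c * z j) * (Real.exp (-(l * s j * Λ)) - 1))
    hw hz hN hNZ fun j hj => by
      rw [abs_mul, abs_mul, Nat.abs_cast, Real.abs_exp]
      gcongr
      · refine choose_le_pow_div_mul_exp hk hK ?_ ?_
        · rw [← hw]; nlinarith [hzZ j hj]
        · nlinarith
      · refine le_trans ?_ hD
        have h1 : z j ≤ (1 + ρ) * Z := by nlinarith [hzZ j hj]
        calc l * c * z j ≤ l * |c| * z j := by
              have := hz0 j; gcongr; exact le_abs_self c
          _ ≤ M * |c| * ((1 + ρ) * Z) := by have := hz0 j; gcongr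
      · refine abs_exp_sub_one_le_two_mul ?_ hε1
        rw [abs_neg, abs_mul, abs_mul, Nat.abs_cast, Nat.abs_cast]
        refine le_trans ?_ (hs j hj)
        gcongr
  have hsum := (hmain.mono hm).add hq (herr.mono (C := ((2 + ρ) * Z / K) ^ K * Real.exp K * Real.exp D) (by
    calc _ = ((2 + ρ) * Z / K) ^ K * Real.exp K * Real.exp D *
        (2 * ε * (N * ((2 * (ρ * Z) / N) ^ N * Real.exp N))) := by ring
      _ ≤ ((2 + ρ) * Z / K) ^ K * Real.exp K * Real.exp D * 1 := by gcongr
      _ = _ := mul_one _))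
  intro i hi
  convert hsum i hi using 1
  · congr 3
    ext j
    have he : Real.exp (l * (c * z j - s j * Λ)) =
        Real.exp (l * c * z j) * Real.exp (-(l * s j * Λ)) := by rw [← Real.exp_add]; ring_nf
    rw [he]
    ring
  · ring

/-- Every element of `𝒮` with nonzero first component has norm at least one. -/
def NormGeOne (𝒮 : Subring (Fin 3 → ℝ)) : Prop :=
  ∀ v ∈ 𝒮, v 0 ≠ 0 → 1 ≤ |v 0 * v 1 * v 2|

lemma abs_pow_le_exp {x h E : ℝ} {n : ℕ} (hx : |x| ≤ Real.exp h) (hE : n * h ≤ E) :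
    |x ^ n| ≤ Real.exp E := by
  rw [abs_pow]
  calc |x| ^ n ≤ Real.exp h ^ n := by gcongr
    _ = Real.exp (n * h) := by rw [← Real.exp_nat_mul]
    _ ≤ _ := Real.exp_le_exp.2 hE

/-- Arithmetic lower bound for the interpolation determinant. -/
lemma NormGeOne.one_le_det_mul {𝒮 : Subring (Fin 3 → ℝ)} (hP : NormGeOne 𝒮) {A G H : Fin 3 → ℝ}
    (hA : A ∈ 𝒮) (hG : G ∈ 𝒮) (hH : H ∈ 𝒮) {h1 h2 V : ℝ} (h1p : 0 ≤ h1) (h2p : 0 ≤ h2) (hV : 0 ≤ V)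
    (hAb : ∀ i, |A i| ≤ Real.exp h1) (hGb : ∀ i, |G i| ≤ Real.exp h2)
    (hHb : ∀ i, |H i| ≤ Real.exp h2) (hH0 : H 0 ≠ 0) {N M R S : ℕ} {w r s k l : Fin N → ℕ}
    (hr : ∀ i, r i ≤ R) (hs : ∀ i, s i ≤ S) (hl : ∀ j, l j ≤ M)
    (hVb : ∀ i j, ((w i).choose (k j) : ℝ) ≤ V)
    (hdet : (Matrix.of fun i j : Fin N => ((w i).choose (k j) : ℝ) *
      (A 0 ^ (l j * r i) * (G 0 / H 0) ^ (l j * s i))).det ≠ 0) :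
    1 ≤ |(Matrix.of fun i j : Fin N => ((w i).choose (k j) : ℝ) *
      (A 0 ^ (l j * r i) * (G 0 / H 0) ^ (l j * s i))).det| * Real.exp (M * S * h2) ^ N *
      (N.factorial * (V * Real.exp (M * R * h1 + M * S * h2)) ^ N) ^ 2 := by
  set X := (Matrix.of fun i j : Fin N => ((w i).choose (k j) : ℝ) *
      (A 0 ^ (l j * r i) * (G 0 / H 0) ^ (l j * s i)))
  let W : Matrix (Fin N) (Fin N) 𝒮 := Matrix.of fun i j => ((w i).choose (k j) : 𝒮) *
    ((⟨A, hA⟩ : 𝒮) ^ (l j * r i) * ((⟨G, hG⟩ : 𝒮) ^ (l j * s i) * (⟨H, hH⟩ : 𝒮) ^ ((M - l j) * s i)))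
  have hWt : ∀ t, (W.det : Fin 3 → ℝ) t = (Matrix.of fun i j : Fin N => ((w i).choose (k j) : ℝ) *
      (A t ^ (l j * r i) * (G t ^ (l j * s i) * H t ^ ((M - l j) * s i)))).det := fun t => by
    have h := RingHom.map_det ((Pi.evalRingHom (fun _ : Fin 3 => ℝ) t).comp 𝒮.subtype) W
    simp only [RingHom.comp_apply, Subring.coe_subtype, Pi.evalRingHom_apply] at h
    rw [h]
    congr 1
  have hexp : ∀ i j, (l j : ℝ) * s i ≤ M * S ∧ (l j * r i : ℝ) ≤ M * R := fun i j => by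
    have h1 : (l j : ℝ) ≤ M := by exact_mod_cast hl j
    have hsS : (s i : ℝ) ≤ S := by exact_mod_cast hs i
    have h3 : (r i : ℝ) ≤ R := by exact_mod_cast hr i
    exact ⟨by gcongr, by gcongr⟩
  have hWle : ∀ t, |(W.det : Fin 3 → ℝ) t| ≤
      N.factorial * (V * Real.exp (M * R * h1 + M * S * h2)) ^ N := fun t => by
    rw [hWt]
    have := Matrix.det_le (A := (Matrix.of fun i j : Fin N => ((w i).choose (k j) : ℝ) *
      (A t ^ (l j * r i) * (G t ^ (l j * s i) * H t ^ ((M - l j) * s i)))))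
      (abv := AbsoluteValue.abs) (x := V * Real.exp (M * R * h1 + M * S * h2)) (fun i j => by
        rw [AbsoluteValue.abs_apply, Matrix.of_apply, abs_mul, Nat.abs_cast]
        refine mul_le_mul (hVb i j) ?_ (abs_nonneg _) hV
        rw [abs_mul, abs_mul, Real.exp_add]
        refine mul_le_mul (abs_pow_le_exp (hAb t) ?_) ?_ (by positivity) (Real.exp_pos _).le
        · push_cast
          have := (hexp i j).2
          gcongr
        · have e : (M * S * h2 : ℝ) ≥ l j * s i * h2 + (M - l j : ℕ) * s i * h2 := by
            rw [Nat.cast_sub (hl j)]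
            have hsS : (s i : ℝ) ≤ S := by exact_mod_cast hs i
            calc (M * S * h2 : ℝ) ≥ M * s i * h2 := by gcongr
              _ = _ := by ring
          refine le_trans ?_ (Real.exp_le_exp.2 e)
          rw [Real.exp_add]
          refine mul_le_mul (abs_pow_le_exp (hGb t) ?_) (abs_pow_le_exp (hHb t) ?_) (abs_nonneg _)
            (Real.exp_pos _).le <;> push_cast <;> exact le_rfl)
    simpa using this
  have h0 : (W.det : Fin 3 → ℝ) 0 = (∏ i, H 0 ^ (M * s i)) * X.det := by
    rw [hWt, ← Matrix.det_mul_column]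
    congr 1
    ext i j
    simp only [X, Matrix.of_apply]
    have : M * s i = (M - l j) * s i + l j * s i := by
      rw [← add_mul, Nat.sub_add_cancel (hl j)]
    rw [this, pow_add, div_pow]
    field_simp
  have h0le : |∏ i, H 0 ^ (M * s i)| ≤ Real.exp (M * S * h2) ^ N := by
    rw [abs_prod]
    calc _ ≤ ∏ i : Fin N, Real.exp (M * S * h2) := by
          refine prod_le_prod (fun _ _ => abs_nonneg _) fun i _ => abs_pow_le_exp (hHb 0) ?_
          push_cast
          have hsS : (s i : ℝ) ≤ S := by exact_mod_cast hs i
          gcongr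
      _ = _ := by simp
  have hne : (W.det : Fin 3 → ℝ) 0 ≠ 0 := by
    rw [h0]
    exact mul_ne_zero (prod_ne_zero_iff.2 fun i _ => pow_ne_zero _ hH0) hdet
  refine (hP _ W.det.2 hne).trans ?_
  rw [abs_mul, abs_mul, h0, abs_mul, mul_assoc _ |_| |_|, sq, mul_comm |X.det|]
  have := hWle 1
  have := hWle 2
  gcongr

lemma le_exp_div {N : ℝ} (hN : 1000000 ≤ N) : 2 * N ^ 2 ≤ Real.exp N ∧ N ≤ Real.exp (N / 30) := by
  have h1 : N / 60 ≤ Real.exp (N / 60) := by linarith [Real.add_one_le_exp (N / 60)]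
  have h2 : (N / 60) ^ 2 ≤ Real.exp (N / 30) := by
    calc (N / 60) ^ 2 ≤ Real.exp (N / 60) ^ 2 := by gcongr
      _ = Real.exp (N / 30) := by rw [← Real.exp_nat_mul]; push_cast; ring_nf
  have h3 : N ≤ Real.exp (N / 30) := by nlinarith
  refine ⟨?_, h3⟩
  calc 2 * N ^ 2 ≤ N * N ^ 2 := by gcongr; linarith
    _ = N ^ 3 := by ring
    _ ≤ Real.exp (N / 30) ^ 3 := by gcongr
    _ = Real.exp (N / 10) := by rw [← Real.exp_nat_mul]; push_cast; ring_nf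
    _ ≤ Real.exp N := Real.exp_le_exp.2 (by linarith)

/-- The analytic and the arithmetic bounds for the interpolation determinant are incompatible. -/
lemma det_bounds_incompatible {N : ℕ} (hN : 1000000 ≤ N) {Y U V E1 E2 : ℝ}
    (hU0 : 0 ≤ U) (hV0 : 0 ≤ V)
    (hU : U ≤ Real.exp (N / 10)) (hV : V ≤ Real.exp (N / 20)) (hE1 : E1 ≤ N / 1000)
    (hE2 : E2 ≤ 3 * N / 1000)
    (hup : Y * Real.exp 2 ^ (∑ i ∈ range N, i) ≤ N.factorial * (2 * U) ^ N)
    (hlow : 1 ≤ Y * Real.exp E1 ^ N * (N.factorial * (V * Real.exp E2) ^ N) ^ 2) : False := by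
  have hN' : (1000000 : ℝ) ≤ N := by exact_mod_cast hN
  have hsum : Real.exp 2 ^ (∑ i ∈ range N, i) = Real.exp (N * (N - 1)) := by
    rw [← Real.exp_nat_mul]
    congr 1
    have h := Finset.sum_range_id_mul_two N
    have h2 : ((∑ i ∈ range N, i : ℕ) : ℝ) * 2 = N * (N - 1) := by
      rw [← Nat.cast_pred (by omega)]; exact_mod_cast h
    rw [h2]
  have hfac : (N.factorial : ℝ) ≤ Real.exp (N / 30) ^ N := by
    calc (N.factorial : ℝ) ≤ (N : ℝ) ^ N := by exact_mod_cast N.factorial_le_pow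
      _ ≤ _ := by gcongr; exact (le_exp_div hN').2
  have h2 : (2:ℝ) ≤ Real.exp 1 := by linarith [Real.add_one_le_exp 1]
  rw [hsum] at hup
  have hA : N.factorial * (2 * U) ^ N ≤ Real.exp (N * (N / 30 + (1 + N / 10))) := by
    calc _ ≤ Real.exp (N / 30) ^ N * (Real.exp 1 * Real.exp (N / 10)) ^ N := by gcongr
      _ = _ := by rw [← mul_pow, ← Real.exp_add, ← Real.exp_add, ← Real.exp_nat_mul]
  have hB : N.factorial * (V * Real.exp E2) ^ N ≤ Real.exp (N * (N / 30 + (N / 20 + 3 * N / 1000))) := by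
    calc _ ≤ Real.exp (N / 30) ^ N * (Real.exp (N / 20) * Real.exp (3 * N / 1000)) ^ N := by gcongr
      _ = _ := by rw [← mul_pow, ← Real.exp_add, ← Real.exp_add, ← Real.exp_nat_mul]
  have hC : Real.exp E1 ^ N ≤ Real.exp (N * (N / 1000)) := by
    rw [← Real.exp_nat_mul]; gcongr
  have hfin : Real.exp (N * (N - 1)) ≤ Real.exp (N * (N / 30 + (1 + N / 10)) + N * (N / 1000) +
      2 * (N * (N / 30 + (N / 20 + 3 * N / 1000)))) := by
    calc Real.exp (N * (N - 1)) ≤ Real.exp (N * (N - 1)) *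
          (Y * Real.exp E1 ^ N * (N.factorial * (V * Real.exp E2) ^ N) ^ 2) :=
          le_mul_of_one_le_right (Real.exp_pos _).le hlow
      _ = (Y * Real.exp (N * (N - 1))) * Real.exp E1 ^ N * (N.factorial * (V * Real.exp E2) ^ N) ^ 2 := by
          ring
      _ ≤ Real.exp (N * (N / 30 + (1 + N / 10))) * Real.exp (N * (N / 1000)) *
          Real.exp (N * (N / 30 + (N / 20 + 3 * N / 1000))) ^ 2 := by
          gcongr
          exact hup.trans hA
      _ = _ := by rw [← Real.exp_nat_mul, ← Real.exp_add, ← Real.exp_add]; push_cast; rfl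
  have := Real.exp_le_exp.1 hfin
  nlinarith

lemma NormGeOne.exp_neg_le {𝒮 : Subring (Fin 3 → ℝ)} (hP : NormGeOne 𝒮) {G : Fin 3 → ℝ}
    (hG : G ∈ 𝒮) {h : ℝ} (hGb : ∀ i, |G i| ≤ Real.exp h) (hG0 : G 0 ≠ 0) :
    Real.exp (-(2 * h)) ≤ |G 0| := by
  have h1 := hP G hG hG0
  rw [abs_mul, abs_mul, mul_assoc] at h1
  have h2 : |G 1| * |G 2| ≤ Real.exp (2 * h) := by
    rw [two_mul, Real.exp_add]; exact mul_le_mul (hGb 1) (hGb 2) (abs_nonneg _) (Real.exp_pos _).le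
  have h3 : 1 ≤ |G 0| * Real.exp (2 * h) := h1.trans (by gcongr)
  rw [Real.exp_neg]
  exact (inv_le_iff_one_le_mul₀ (Real.exp_pos _)).2 h3

lemma NormGeOne.abs_log_div_le {𝒮 : Subring (Fin 3 → ℝ)} (hP : NormGeOne 𝒮) {G H : Fin 3 → ℝ}
    (hG : G ∈ 𝒮) (hH : H ∈ 𝒮) {h : ℝ} (hGb : ∀ i, |G i| ≤ Real.exp h)
    (hHb : ∀ i, |H i| ≤ Real.exp h) (hG0 : G 0 ≠ 0) (hH0 : H 0 ≠ 0) :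
    |Real.log (G 0 / H 0)| ≤ 3 * h := by
  have key : ∀ F ∈ 𝒮, (∀ i, |F i| ≤ Real.exp h) → F 0 ≠ 0 →
      -(2 * h) ≤ Real.log (F 0) ∧ Real.log (F 0) ≤ h := fun F hF hFb hF0 => by
    rw [← Real.log_abs, ← Real.log_exp (-(2 * h))]
    constructor
    · exact Real.log_le_log (Real.exp_pos _) (hP.exp_neg_le hF hFb hF0)
    · exact (Real.log_le_iff_le_exp (abs_pos.2 hF0)).2 (hFb 0)
  rw [Real.log_div hG0 hH0, abs_le]
  have h1 := key G hG hGb hG0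
  have h2 := key H hH hHb hH0
  constructor <;> linarith

set_option maxHeartbeats 1000000 in
/-- A lower bound for linear forms in two logarithms. -/
theorem NormGeOne.two_log {𝒮 : Subring (Fin 3 → ℝ)} (hP : NormGeOne 𝒮) {A G H : Fin 3 → ℝ}
    (hA : A ∈ 𝒮) (hG : G ∈ 𝒮) (hH : H ∈ 𝒮) {h1 h2 M b : ℕ} (h1p : 0 < h1) (h2p : 0 < h2) (hMp : 0 < M)
    (hAb : ∀ i, |A i| ≤ Real.exp h1) (hGb : ∀ i, |G i| ≤ Real.exp h2)
    (hHb : ∀ i, |H i| ≤ Real.exp h2) (hA0 : 0 < A 0) (hA1 : A 0 ≠ 1) (hG0 : 0 < G 0) (hH0 : 0 < H 0)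
    (hb : 2 * (1000 * M * h2) ≤ b) (hM : 20 * (4 + Real.log (b / h2)) ≤ M) {T : ℝ}
    (hT : |b * Real.log (A 0) - Real.log (G 0 / H 0)| ≤ Real.exp (-T)) :
    T ≤ 1000000 * M ^ 3 * h1 * h2 := by
  by_contra! hTN
  obtain ⟨K, hK⟩ : ∃ K, K = 1000000 * M * h1 * h2 := ⟨_, rfl⟩
  obtain ⟨N, hN⟩ : ∃ N, N = K * M := ⟨_, rfl⟩
  obtain ⟨R, hR⟩ : ∃ R, R = 1000 * M * h2 := ⟨_, rfl⟩
  obtain ⟨S, hS⟩ : ∃ S, S = 1000 * M * h1 := ⟨_, rfl⟩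
  set c := Real.log (A 0) with hc
  set γ := Real.log (G 0 / H 0) with hγ
  set Λ := b * c - γ with hΛ
  set ρ := Real.exp 2 with hρ
  set β := Real.log (b / h2 : ℝ) with hβ
  have m1 : (1:ℝ) ≤ M := by exact_mod_cast hMp
  have u1 : (1:ℝ) ≤ h1 := by exact_mod_cast h1p
  have v1 : (1:ℝ) ≤ h2 := by exact_mod_cast h2p
  have hbr : 2 * (1000 * M * h2 : ℝ) ≤ b := by exact_mod_cast hb
  have hKr : (K : ℝ) = 1000000 * M * h1 * h2 := by simp [hK]
  have hNr : (N : ℝ) = K * M := by simp [hN]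
  have hRr : (R : ℝ) = 1000 * M * h2 := by simp [hR]
  have hSr : (S : ℝ) = 1000 * M * h1 := by simp [hS]
  have hKp : 0 < K := by rw [hK]; positivity
  have hNp : 0 < N := by rw [hN]; positivity
  have mv : (1:ℝ) ≤ M * h2 := one_le_mul_of_one_le_of_one_le m1 v1
  have mu : (1:ℝ) ≤ M * h1 := one_le_mul_of_one_le_of_one_le m1 u1
  have muv : (1:ℝ) ≤ (M * h1) * (M * h2) := one_le_mul_of_one_le_of_one_le mu mv
  have hNbig : 1000000 ≤ N := by
    have : (1000000 : ℝ) ≤ N := by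
      rw [hNr, hKr]
      calc (1000000 : ℝ) ≤ 1000000 * ((M * h1) * (M * h2)) := by linarith
        _ = _ := by ring
    exact_mod_cast this
  have hNbig' : (1000000:ℝ) ≤ N := by exact_mod_cast hNbig
  have hρ7 : ρ ≤ 7.4 := by
    have h := Real.exp_one_lt_d9
    have h0 := Real.exp_pos 1
    have : ρ = Real.exp 1 ^ 2 := by rw [hρ, ← Real.exp_nat_mul]; norm_num
    rw [this]; nlinarith only [h, h0]
  have hρ1 : 1 ≤ ρ := Real.one_le_exp (by norm_num)
  set Z : ℝ := S * b with hZ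
  have hbp : (0:ℝ) < b := by linarith
  have hβe : Real.exp β = b / h2 := Real.exp_log (by positivity)
  have hKZ : (K : ℝ) ≤ Z := by
    rw [hKr, hZ, hSr]
    have : (1000 * h2 : ℝ) ≤ b := by
      refine le_trans ?_ hbr
      calc (1000 * h2 : ℝ) ≤ 2 * 1000 * 1 * h2 := by linarith
        _ ≤ 2 * 1000 * M * h2 := by gcongr
        _ = _ := by ring
    calc (1000000 * M * h1 * h2 : ℝ) = 1000 * M * h1 * (1000 * h2) := by ring
      _ ≤ _ := by gcongr
  have hZp : 0 < Z := by
    have : (0:ℝ) < K := by exact_mod_cast hKp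
    linarith
  have hNM : (N : ℝ) ≤ N * M := le_mul_of_one_le_right (Nat.cast_nonneg _) m1
  have hNZ : (N : ℝ) ≤ 2 * (ρ * Z) := by
    have : (N : ℝ) ≤ Z := by
      rw [hNr, hKr, hZ, hSr]
      calc (1000000 * M * h1 * h2 * M : ℝ) = 1000 * M * h1 * (1000 * M * h2) := by ring
        _ ≤ 1000 * M * h1 * b := by gcongr; linarith [mv]
    refine this.trans ?_
    have hZ0 : 0 ≤ Z := by positivity
    calc Z = 1 * Z := (one_mul Z).symm
      _ ≤ 2 * ρ * Z := by gcongr; linarith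
      _ = _ := by ring
  -- nonvanishing minor
  have hgrid : ∀ p : Fin K × Fin M → ℝ, (∀ i : Fin (2 * R) × Fin S, ∑ j, p j *
      ((((i.1 : ℕ) + i.2 * b).choose j.1 : ℝ) *
      (A 0 ^ (j.2 * i.1 : ℕ) * (G 0 / H 0) ^ (j.2 * i.2 : ℕ))) = 0) → p = 0 := fun p hp =>
    eq_zero_of_forall_grid (R := R) (S := S) (b := b) hKp (by
      rw [hR]; nlinarith [Nat.mul_le_mul_left M h2p]) (by
      rw [hR, hS, hK]; exact (by ring_nf : 1000000 * M * h1 * h2 * M = 1000 * M * h2 * (1000 * M * h1)).le)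
      (by omega) hA0 hA1 (div_pos hG0 hH0) p fun r hr s hs => hp (⟨r, hr⟩, ⟨s, hs⟩)
  obtain ⟨f, hf⟩ := exists_det_ne_zero ((finCongr hN).trans finProdFinEquiv.symm)
    (fun (i : Fin (2 * R) × Fin S) (j : Fin K × Fin M) => ((((i.1 : ℕ) + i.2 * b).choose j.1 : ℝ) *
      (A 0 ^ (j.2 * i.1 : ℕ) * (G 0 / H 0) ^ (j.2 * i.2 : ℕ)))) hgrid
  set κ : Fin N ≃ Fin K × Fin M := (finCongr hN).trans finProdFinEquiv.symm with hκ
  let s : ℕ → ℕ := fun j => if h : j < N then (f ⟨j, h⟩).2 else 0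
  let w : ℕ → ℕ := fun j => if h : j < N then ((f ⟨j, h⟩).1 : ℕ) + (f ⟨j, h⟩).2 * b else 0
  have hsf : ∀ i : Fin N, s i = (f i).2 := fun i => by simp [s]
  have hwf : ∀ i : Fin N, w i = (f i).1 + (f i).2 * b := fun i => by simp [w]
  have hfinj : Function.Injective f := by
    intro i j hij
    by_contra hne
    exact hf (Matrix.det_zero_of_row_eq hne (by ext k; simp only [Matrix.of_apply, hij]))
  have hRb : 2 * R ≤ b := by omega
  have hwinj : Set.InjOn (fun j => (w j : ℝ)) (range N) := by
    intro i hi j hj hij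
    simp only [coe_range, Set.mem_Iio] at hi hj
    have hij' : w i = w j := by simpa using hij
    have e1 := hwf ⟨i, hi⟩
    have e2 := hwf ⟨j, hj⟩
    simp only at e1 e2
    rw [e1, e2] at hij'
    have hr1 : ((f ⟨i, hi⟩).1 : ℕ) < b := (f ⟨i, hi⟩).1.2.trans_le hRb
    have hr2 : ((f ⟨j, hj⟩).1 : ℕ) < b := (f ⟨j, hj⟩).1.2.trans_le hRb
    have h3 := congrArg (· / b) hij'
    rw [Nat.add_mul_div_right _ _ (by omega), Nat.add_mul_div_right _ _ (by omega),
      Nat.div_eq_of_lt hr1, Nat.div_eq_of_lt hr2, zero_add, zero_add] at h3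
    rw [h3] at hij'
    have := hfinj (Prod.ext (Fin.ext (by omega)) (Fin.ext h3) : f ⟨i, hi⟩ = f ⟨j, hj⟩)
    simpa using this
  have hwZ : ∀ i < N, (w i : ℝ) ≤ Z := by
    intro i hi
    have e1 := hwf ⟨i, hi⟩
    simp only at e1
    have hr1 : ((f ⟨i, hi⟩).1 : ℕ) < b := (f ⟨i, hi⟩).1.2.trans_le hRb
    have hs1 := (f ⟨i, hi⟩).2.2
    have : w i ≤ S * b := by
      rw [e1]
      calc ((f ⟨i, hi⟩).1 : ℕ) + (f ⟨i, hi⟩).2 * b ≤ ((f ⟨i, hi⟩).2 + 1) * b := by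
            rw [add_mul]; omega
        _ ≤ S * b := Nat.mul_le_mul_right _ hs1
    rw [hZ]; exact_mod_cast this
  -- numerical estimates
  have hT1 : Real.exp (-T) ≤ 1 := Real.exp_le_one_iff.2 (by
    have : (0:ℝ) ≤ 1000000 * M ^ 3 * h1 * h2 := by positivity
    linarith)
  have hcb : |c| * b ≤ 4 * h2 := by
    have hg : |γ| ≤ 3 * h2 := hP.abs_log_div_le hG hH hGb hHb hG0.ne' hH0.ne'
    have e : |c| * b = |b * c| := by rw [abs_mul, Nat.abs_cast]; ring
    have e2 : (b * c : ℝ) = Λ + γ := by rw [hΛ]; ring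
    rw [e, e2]
    refine (abs_add_le _ _).trans ?_
    linarith [hT]
  have hD : M * |c| * ((1 + ρ) * Z) ≤ (N / 25 : ℝ) := by
    rw [hZ, hSr, hNr, hKr]
    have e : M * |c| * ((1 + ρ) * (1000 * M * h1 * b)) = 1000 * M * (M * h1) * (1 + ρ) * (|c| * b) := by ring
    rw [e]
    calc _ ≤ 1000 * M * (M * h1) * (1 + 7.4) * (4 * h2 : ℝ) := by gcongr
      _ ≤ _ := by nlinarith only [muv]
  have hbase : (2 + ρ) * Z / K ≤ Real.exp β := by
    rw [hβe, hZ, hSr, hKr, div_le_div_iff₀ (by positivity) (by positivity)]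
    have : (2 + ρ) ≤ 1000 := by linarith
    calc (2 + ρ) * (1000 * M * h1 * b) * h2 ≤ 1000 * (1000 * M * h1 * b) * h2 := by gcongr
      _ = _ := by ring
  have hV : ((2 + ρ) * Z / K) ^ K * Real.exp K ≤ Real.exp (N / 20) := by
    calc _ ≤ Real.exp β ^ K * Real.exp K := by gcongr
      _ = Real.exp (K * (β + 1)) := by rw [← Real.exp_nat_mul, ← Real.exp_add]; ring_nf
      _ ≤ _ := by
        apply Real.exp_le_exp.2
        rw [hNr, mul_div_assoc]
        gcongr
        linarith
  set ε : ℝ := M * S * Real.exp (-T) with hε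
  have hMS : (M * S : ℝ) ≤ N := by
    rw [hNr, hKr, hSr]
    calc (M * (1000 * M * h1) : ℝ) = 1000 * M * h1 * M * 1 := by ring
      _ ≤ 1000 * M * h1 * M * (1000 * h2) := by gcongr; linarith
      _ = _ := by ring
  obtain ⟨hN2, -⟩ := le_exp_div hNbig'
  have hTN' : (N * M : ℝ) < T := by
    rw [hNr, hKr]; calc (1000000 * M * h1 * h2 * M * M : ℝ) = 1000000 * M ^ 3 * h1 * h2 := by ring
      _ < T := hTN
  have hεbound : 2 * ε * (N * ((2 * (ρ * Z) / N) ^ N * Real.exp N)) ≤ 1 := by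
    have hb1 : 2 * (ρ * Z) / N ≤ Real.exp β := by
      rw [hβe, hZ, hSr, hNr, hKr, div_le_div_iff₀ (by positivity) (by positivity)]
      have : 2 * ρ ≤ 1000 * M := by linarith
      calc 2 * (ρ * (1000 * M * h1 * b)) * h2 = 2 * ρ * ((1000 * M * h1 * b) * h2) := by ring
        _ ≤ 1000 * M * ((1000 * M * h1 * b) * h2) := by gcongr
        _ = _ := by ring
    calc 2 * ε * (N * ((2 * (ρ * Z) / N) ^ N * Real.exp N))
        ≤ 2 * (N * Real.exp (-T)) * (N * (Real.exp β ^ N * Real.exp N)) := by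
          rw [hε]; gcongr
      _ = (2 * N ^ 2) * (Real.exp (-T) * (Real.exp β ^ N * Real.exp N)) := by ring
      _ ≤ Real.exp N * (Real.exp (-T) * (Real.exp β ^ N * Real.exp N)) := by gcongr
      _ = Real.exp (N * (β + 2) - T) := by
        rw [← Real.exp_nat_mul, ← Real.exp_add, ← Real.exp_add, ← Real.exp_add]; ring_nf
      _ ≤ 1 := by
        apply Real.exp_le_one_iff.2
        have : (N * (β + 2) : ℝ) ≤ N * M := by gcongr; linarith
        linarith
  have hε1 : ε ≤ 1 := by
    calc ε ≤ (2 * N ^ 2) * Real.exp (-T) := by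
          rw [hε]
          gcongr ?_ * _
          nlinarith only [hMS, hNbig']
      _ ≤ Real.exp N * Real.exp (-T) := by gcongr
      _ = Real.exp (N - T) := by rw [← Real.exp_add]; ring_nf
      _ ≤ 1 := by apply Real.exp_le_one_iff.2; linarith
  -- the determinant
  have hXeq : (Matrix.of fun i j : Fin N => ((w i).choose (κ j).1 : ℝ) *
      Real.exp (((κ j).2 : ℕ) * (c * w i - s i * Λ))) =
      Matrix.of fun i j : Fin N => ((w i).choose (κ j).1 : ℝ) *
      (A 0 ^ ((κ j).2 * (f i).1 : ℕ) * (G 0 / H 0) ^ ((κ j).2 * s i : ℕ)) := by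
    ext i j
    simp only [Matrix.of_apply]
    congr 1
    rw [← Real.rpow_natCast, ← Real.rpow_natCast, Real.rpow_def_of_pos hA0,
      Real.rpow_def_of_pos (div_pos hG0 hH0), ← Real.exp_add, hwf, hsf]
    congr 1
    push_cast
    rw [← hc, ← hγ, hΛ]
    ring
  have hup := abs_det_le_of_divDiffBound (ρ := ρ) hwinj hZp (by positivity)
    (fun i hi => ⟨Nat.cast_nonneg _, hwZ i hi⟩) (f := fun (j : Fin N) i => ((w i).choose (κ j).1 : ℝ) *
      Real.exp (((κ j).2 : ℕ) * (c * w i - s i * Λ))) (fun j =>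
      DivDiffBound.choose_mul_exp (ε := ε) (M := M) (fun _ => rfl) hwinj hNp (by positivity) hKp hNZ hwZ hKZ
        (κ j).1.2.le (κ j).2.2.le hD (fun i hi => by
          have h3 : (s i : ℝ) ≤ S := by
            have := hsf ⟨i, hi⟩
            simp only at this
            rw [this]; exact_mod_cast (f ⟨i, hi⟩).2.2.le
          rw [hε]; gcongr) hε1 hεbound)
  rw [hXeq] at hup
  have hlow := hP.one_le_det_mul hA hG hH (h1 := h1) (h2 := h2) (V := ((2 + ρ) * Z / K) ^ K * Real.exp K)
    (by positivity) (by positivity) (by positivity) hAb hGb hHb hH0.ne' (N := N) (M := M) (R := 2 * R) (S := S)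
    (w := fun i => w i) (r := fun i => (f i).1) (s := fun i => s i) (k := fun j => (κ j).1)
    (l := fun j => (κ j).2) (fun i => (f i).1.2.le) (fun i => by rw [hsf]; exact (f i).2.2.le)
    (fun j => (κ j).2.2.le) (fun i j => by
      refine choose_le_pow_div_mul_exp (κ j).1.2.le hKp ?_ ?_
      · exact (hwZ i i.2).trans (le_mul_of_one_le_left hZp.le (by linarith))
      · exact hKZ.trans (le_mul_of_one_le_left hZp.le (by linarith))) (by
      convert hf using 3
      ext i j
      simp only [hwf, hsf])
  refine det_bounds_incompatible hNbig ?_ ?_ ?_ hV ?_ ?_ hup hlow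
  · positivity
  · positivity
  · calc _ ≤ Real.exp (N / 20) * Real.exp (N / 25) := by gcongr
      _ = Real.exp (N / 20 + N / 25) := by rw [Real.exp_add]
      _ ≤ _ := by apply Real.exp_le_exp.2; linarith
  · rw [hNr, hKr, hSr]; apply le_of_eq; ring
  · rw [hNr, hKr, hSr]; push_cast; rw [hRr]; apply le_of_eq; ring

/-- A real cubic field with a positive root `t` of `fn n`. -/
structure SimplestCubic where
  n : ℤ
  n_nonneg : 0 ≤ n
  t : ℝ
  root : fn n t = 0
  t_gt : 1.2 < t

/-- The norm of `u + vθ + wθ²`, where `θ` is a root of `fn n`. -/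
def normForm (n u v w : ℤ) : ℤ :=
  u ^ 3 + u ^ 2 * v * (n - 1) + u ^ 2 * w * ((n - 1) ^ 2 + 2 * (n + 2)) - u * v ^ 2 * (n + 2) -
    u * v * w * ((n - 1) * (n + 2) + 3) + u * w ^ 2 * ((n + 2) ^ 2 - 2 * (n - 1)) + v ^ 3 +
    v ^ 2 * w * (n - 1) - v * w ^ 2 * (n + 2) + w ^ 3

lemma even_of_normForm_eq_zero {n u v w : ℤ} (h : normForm n u v w = 0) :
    (2 ∣ u) ∧ (2 ∣ v) ∧ (2 ∣ w) := by
  have key : ∀ n u v w : ZMod 2, u ^ 3 + u ^ 2 * v * (n - 1) + u ^ 2 * w * ((n - 1) ^ 2 + 2 * (n + 2)) -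
    u * v ^ 2 * (n + 2) - u * v * w * ((n - 1) * (n + 2) + 3) +
    u * w ^ 2 * ((n + 2) ^ 2 - 2 * (n - 1)) + v ^ 3 +
    v ^ 2 * w * (n - 1) - v * w ^ 2 * (n + 2) + w ^ 3 = 0 → u = 0 ∧ v = 0 ∧ w = 0 := by decide
  have h2 := key n u v w (by
    have := congrArg (Int.cast : ℤ → ZMod 2) h
    simpa [normForm] using this)
  simpa only [ZMod.intCast_zmod_eq_zero_iff_dvd, ← Int.cast_zero (R := ZMod 2), ZMod.intCast_eq_intCast_iff_dvd_sub, zero_sub, dvd_neg, Nat.cast_ofNat, Int.cast_zero] using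
    (⟨(ZMod.intCast_zmod_eq_zero_iff_dvd u 2).1 h2.1, (ZMod.intCast_zmod_eq_zero_iff_dvd v 2).1 h2.2.1,
      (ZMod.intCast_zmod_eq_zero_iff_dvd w 2).1 h2.2.2⟩ : ((2 : ℕ) : ℤ) ∣ u ∧ ((2 : ℕ) : ℤ) ∣ v ∧ ((2 : ℕ) : ℤ) ∣ w)

lemma eq_zero_of_normForm_eq_zero {n u v w : ℤ} (h : normForm n u v w = 0) :
    u = 0 ∧ v = 0 ∧ w = 0 := by
  induction hk : u.natAbs + v.natAbs + w.natAbs using Nat.strong_induction_on generalizing u v w with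
  | _ k ih =>
    obtain ⟨⟨u', rfl⟩, ⟨v', rfl⟩, ⟨w', rfl⟩⟩ := even_of_normForm_eq_zero h
    have h' : normForm n u' v' w' = 0 := by
      have : normForm n (2 * u') (2 * v') (2 * w') = 8 * normForm n u' v' w' := by
        simp only [normForm]; ring
      omega
    by_cases hz : u' = 0 ∧ v' = 0 ∧ w' = 0
    · simp [hz]
    · have := ih (u'.natAbs + v'.natAbs + w'.natAbs) (by omega) h' rfl
      exact absurd this hz

namespace SimplestCubic
variable (c : SimplestCubic)

lemma t_pos : 0 < c.t := by have := c.t_gt; linarith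

/-- The conjugates of the unit `t`, permuted cyclically by the Galois group. -/
def lam : Fin 3 → ℝ := ![c.t, -(1 + c.t) / c.t, -1 / (1 + c.t)]

lemma lam_ne_zero (i : Fin 3) : c.lam i ≠ 0 := by
  have := c.t_pos
  have h1 : 1 + c.t ≠ 0 := by positivity
  have h2 : -c.t + -1 ≠ 0 := by linarith
  have h3 := this.ne'
  fin_cases i <;> simp [lam, h1, h2, h3]

lemma n_eq : (c.n : ℝ) * (c.t ^ 2 + c.t) = c.t ^ 3 + c.t ^ 2 - 2 * c.t - 1 := by
  have := c.root
  simp only [fn] at this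
  linear_combination -this

lemma n_eq_div : (c.n : ℝ) = (c.t ^ 3 + c.t ^ 2 - 2 * c.t - 1) / (c.t ^ 2 + c.t) := by
  have := c.t_pos
  rw [eq_div_iff (by positivity), c.n_eq]

lemma lam_root (i : Fin 3) : c.lam i ^ 3 = (c.n - 1) * c.lam i ^ 2 + (c.n + 2) * c.lam i + 1 := by
  have := c.t_pos
  have h1 : 1 + c.t ≠ 0 := by positivity
  rw [c.n_eq_div]
  fin_cases i <;> simp [lam] <;> field_simp <;> ring

lemma lam_add_one (i : Fin 3) : c.lam (i + 1) = -1 - 1 / c.lam i := by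
  have := c.t_pos
  have h1 : 1 + c.t ≠ 0 := by positivity
  fin_cases i
  · simp [lam]; field_simp; ring
  · have h2 : c.lam 1 = -((1 + c.t) / c.t) := by simp [lam]; ring
    change c.lam 2 = -1 - 1 / c.lam 1
    rw [h2]; simp [lam]; field_simp; ring
  · have h2 : c.lam 2 = -(1 / (1 + c.t)) := by simp [lam]; ring
    change c.lam 0 = -1 - 1 / c.lam 2
    rw [h2]; simp [lam]

lemma inv_lam (i : Fin 3) : 1 / c.lam i = c.lam i ^ 2 - (c.n - 1) * c.lam i - (c.n + 2) := by
  have h := c.lam_ne_zero i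
  rw [div_eq_iff h]
  linear_combination -c.lam_root i

lemma prod_lam : c.lam 0 * c.lam 1 * c.lam 2 = 1 := by
  have := c.t_pos
  have h1 : 1 + c.t ≠ 0 := by positivity
  simp [lam]; field_simp; ring

lemma sum_lam : c.lam 0 + c.lam 1 + c.lam 2 = c.n - 1 := by
  have := c.t_pos
  have h1 : 1 + c.t ≠ 0 := by positivity
  rw [c.n_eq_div]; simp [lam]; field_simp; ring

lemma sum_lam_mul : c.lam 0 * c.lam 1 + c.lam 1 * c.lam 2 + c.lam 2 * c.lam 0 = -(c.n + 2) := by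
  have := c.t_pos
  have h1 : 1 + c.t ≠ 0 := by positivity
  rw [c.n_eq_div]; simp [lam]; field_simp; ring

/-- The order `ℤ[t]`, embedded by its three real embeddings. -/
def order : Subring (Fin 3 → ℝ) where
  carrier := {v | ∃ p q r : ℤ, ∀ i, v i = p + q * c.lam i + r * c.lam i ^ 2}
  zero_mem' := ⟨0, 0, 0, fun i => by simp⟩
  one_mem' := ⟨1, 0, 0, fun i => by simp⟩
  add_mem' := by
    rintro v w ⟨p, q, r, hv⟩ ⟨p', q', r', hw⟩
    exact ⟨p + p', q + q', r + r', fun i => by rw [Pi.add_apply, hv, hw]; push_cast; ring⟩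
  neg_mem' := by
    rintro v ⟨p, q, r, hv⟩
    exact ⟨-p, -q, -r, fun i => by rw [Pi.neg_apply, hv]; push_cast; ring⟩
  mul_mem' := by
    rintro v w ⟨p, q, r, hv⟩ ⟨p', q', r', hw⟩
    refine ⟨p * p' + (q * r' + r * q') + (c.n - 1) * (r * r'),
      p * q' + q * p' + (c.n + 2) * (q * r' + r * q') + ((c.n - 1) * (c.n + 2) + 1) * (r * r'),
      p * r' + q * q' + r * p' + (c.n - 1) * (q * r' + r * q') +
        ((c.n - 1) ^ 2 + (c.n + 2)) * (r * r'), fun i => ?_⟩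
    rw [Pi.mul_apply, hv, hw]
    push_cast
    linear_combination (q * r' + r * q' + r * r' * (c.lam i + c.n - 1)) * c.lam_root i

lemma prod_eq_normForm {v : Fin 3 → ℝ} {p q r : ℤ}
    (hv : ∀ i, v i = p + q * c.lam i + r * c.lam i ^ 2) :
    v 0 * v 1 * v 2 = normForm c.n p q r := by
  simp only [normForm, hv]
  push_cast
  have h1 : (c.n : ℝ) - 1 = c.lam 0 + c.lam 1 + c.lam 2 := c.sum_lam.symm
  have h2 : (c.n : ℝ) + 2 = -(c.lam 0 * c.lam 1 + c.lam 1 * c.lam 2 + c.lam 2 * c.lam 0) := by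
    rw [c.sum_lam_mul]; ring
  have h3 := c.prod_lam
  rw [h1, h2]
  linear_combination (-3 * p * q * r - 2 * (c.lam 0 + c.lam 1 + c.lam 2) * p * r ^ 2 + q ^ 3 +
    q ^ 2 * r * (c.lam 0 + c.lam 1 + c.lam 2) +
    q * r ^ 2 * (c.lam 0 * c.lam 1 + c.lam 1 * c.lam 2 + c.lam 2 * c.lam 0) +
    r ^ 3 * (c.lam 0 * c.lam 1 * c.lam 2 + 1)) * h3

lemma eq_zero_of_apply_eq_zero {v : Fin 3 → ℝ} (hv : v ∈ c.order) {i : Fin 3} (hi : v i = 0) :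
    v = 0 := by
  obtain ⟨p, q, r, h⟩ := hv
  have h1 := c.prod_eq_normForm h
  have h2 : v 0 * v 1 * v 2 = 0 := by
    fin_cases i <;> simp at hi <;> simp [hi]
  rw [h2] at h1
  obtain ⟨rfl, rfl, rfl⟩ := eq_zero_of_normForm_eq_zero (by exact_mod_cast h1.symm)
  ext i; simp [h]

lemma one_le_abs_norm {v : Fin 3 → ℝ} (hv : v ∈ c.order) {i : Fin 3} (hi : v i ≠ 0) :
    1 ≤ |v 0 * v 1 * v 2| := by
  have hne : ∀ j, v j ≠ 0 := fun j hj => hi (by rw [c.eq_zero_of_apply_eq_zero hv hj]; rfl)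
  obtain ⟨p, q, r, h⟩ := hv
  have h0 : v 0 * v 1 * v 2 ≠ 0 := mul_ne_zero (mul_ne_zero (hne 0) (hne 1)) (hne 2)
  rw [c.prod_eq_normForm h] at h0 ⊢
  have : normForm c.n p q r ≠ 0 := by exact_mod_cast h0
  exact_mod_cast Int.one_le_abs this

lemma normGeOne_order : NormGeOne c.order := fun _ hv h => c.one_le_abs_norm hv h

lemma lam_mem : c.lam ∈ c.order := ⟨0, 1, 0, fun i => by simp⟩

lemma inv_lam_mem : (fun i => (c.lam i)⁻¹) ∈ c.order :=
  ⟨-(c.n + 2), -(c.n - 1), 1, fun i => by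
    show (c.lam i)⁻¹ = _
    rw [← one_div, c.inv_lam]; push_cast; ring⟩

lemma zpow_mem {v : Fin 3 → ℝ} (hv : v ∈ c.order) (hv' : (fun i => (v i)⁻¹) ∈ c.order) (p : ℤ) :
    (fun i => v i ^ p) ∈ c.order := by
  cases p with
  | ofNat k =>
    convert c.order.pow_mem hv k using 1
    ext i; simp
  | negSucc k =>
    have := c.order.pow_mem hv' (k + 1)
    convert this using 1
    ext i; simp [zpow_negSucc]

lemma shift_mem {v : Fin 3 → ℝ} (hv : v ∈ c.order) (s : Fin 3) : (fun i => v (i + s)) ∈ c.order := by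
  have h1 : ∀ w ∈ c.order, (fun i => w (i + 1)) ∈ c.order := by
    rintro w ⟨p, q, r, h⟩
    have h2 : (fun i => c.lam (i + 1)) ∈ c.order := by
      have h3 := c.order.sub_mem (c.order.neg_mem c.order.one_mem) c.inv_lam_mem
      convert h3 using 1
      ext i
      simp [c.lam_add_one]
    have h4 := c.order.add_mem (c.order.add_mem (intCast_mem c.order p)
      (c.order.mul_mem (intCast_mem c.order q) h2))
      (c.order.mul_mem (intCast_mem c.order r) (c.order.pow_mem h2 2))
    convert h4 using 1
    ext i
    simp [h]
  fin_cases s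
  · simpa using hv
  · simpa using h1 v hv
  · have := h1 _ (h1 v hv)
    simpa [add_assoc] using! this

lemma unit_mem (s : Fin 3) (p : ℤ) : (fun i => c.lam (i + s) ^ p) ∈ c.order :=
  c.zpow_mem (c.shift_mem c.lam_mem s) (c.shift_mem c.inv_lam_mem s) p

/-- The logarithm of the fundamental unit `t`. -/
def logT : ℝ := Real.log c.t

/-- The logarithm of the conjugate unit `(1 + t) / t`. -/
def eta : ℝ := Real.log ((1 + c.t) / c.t)

/-- A height bound for the units `lam i`. -/
def ht : ℝ := 1 + c.logT

/-- The logarithms of the absolute values of the conjugates of `t`. -/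
def e : Fin 3 → ℝ := ![c.logT, c.eta, -c.logT - c.eta]

lemma log_abs_lam (i : Fin 3) : Real.log |c.lam i| = c.e i := by
  have h := c.t_pos
  have h1 : 0 < 1 + c.t := by positivity
  fin_cases i
  · simp [lam, e, logT]
  · simp only [lam, e, eta, Fin.mk_one, Matrix.cons_val_one, Matrix.cons_val_zero]
    rw [neg_div, abs_neg, abs_of_pos (by positivity)]
  · simp [lam, e, eta, logT]
    rw [Real.log_div h1.ne' h.ne', neg_div, Real.log_neg_eq_log, one_div, Real.log_inv]; ring

lemma abs_lam (i : Fin 3) : |c.lam i| = Real.exp (c.e i) := by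
  rw [← c.log_abs_lam, Real.exp_log (abs_pos.2 (c.lam_ne_zero i))]

lemma abs_lam_zpow (i : Fin 3) (p : ℤ) : |c.lam i ^ p| = Real.exp (p * c.e i) := by
  rw [abs_zpow, c.abs_lam, ← Real.rpow_intCast, ← Real.exp_mul, mul_comm]

lemma sum_e : c.e 0 + c.e 1 + c.e 2 = 0 := by simp [e]

lemma logT_ge : 1 / 6 ≤ c.logT := by
  have h := c.t_gt
  have h1 := Real.one_sub_inv_le_log_of_pos c.t_pos
  have h2 : c.t⁻¹ ≤ (1.2 : ℝ)⁻¹ := inv_anti₀ (by norm_num) h.le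
  norm_num at h2
  unfold logT
  linarith

lemma ht_le : c.ht ≤ 7 * c.logT := by have := c.logT_ge; unfold ht; linarith

lemma one_le_ht : 1 ≤ c.ht := by have := c.logT_ge; unfold ht; linarith

lemma eta_pos : 0 < c.eta := by
  have h := c.t_pos
  apply Real.log_pos
  rw [lt_div_iff₀ h]; linarith

lemma eta_le : c.eta ≤ 1 / c.t := by
  have h := c.t_pos
  have h1 := Real.log_le_sub_one_of_pos (show 0 < (1 + c.t) / c.t by positivity)
  have : (1 + c.t) / c.t - 1 = 1 / c.t := by field_simp; ring
  rw [this] at h1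
  exact h1

lemma eta_le_exp : c.eta ≤ Real.exp (-c.logT) := by
  have := c.eta_le
  rwa [Real.exp_neg, logT, Real.exp_log c.t_pos, ← one_div]

lemma eta_lt_one : c.eta < 1 := by
  have h1 := c.eta_le
  have h2 : 1 / c.t < 1 := by
    rw [div_lt_one c.t_pos]; linarith [c.t_gt]
  linarith

lemma abs_e_le (i : Fin 3) : |c.e i| ≤ c.ht := by
  have h1 := c.logT_ge
  have h2 := c.eta_pos
  have h3 := c.eta_lt_one
  rw [abs_le]
  unfold ht
  fin_cases i <;> simp only [e, Fin.zero_eta, Fin.mk_one, Fin.reduceFinMk, Matrix.cons_val] <;>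
    constructor <;> linarith

lemma t_lt : c.t < c.n + 2 := by
  have h := c.n_eq
  have h1 := c.t_gt
  by_contra! h2
  nlinarith only [h, h1, mul_le_mul_of_nonneg_right h2 (show 0 ≤ c.t ^ 2 + c.t by positivity)]

lemma ht_le_log : c.ht ≤ 1 + Real.log (c.n + 2) := by
  have := Real.log_le_log c.t_pos c.t_lt.le
  unfold ht logT; linarith

lemma abs_eta_sub_logT_ge : c.ht / 20 ≤ |c.eta - c.logT| := by
  have hpos := c.t_pos
  have h := c.n_eq
  have h1 := c.t_gt
  have hlog : ∀ x : ℝ, 0 < x → Real.log x ≤ x - 1 := fun x hx => Real.log_le_sub_one_of_pos hx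
  have hlog' : ∀ x : ℝ, 0 < x → 1 - x⁻¹ ≤ Real.log x := fun x hx => Real.one_sub_inv_le_log_of_pos hx
  rcases c.n_nonneg.eq_or_lt with h0 | h0
  · rw [← h0] at h
    have h_t : c.t < 1.26 := by
      by_contra! h2
      have := mul_le_mul h2 h2 (by norm_num) hpos.le
      norm_num at h
      nlinarith only [h, h2, this]
    have h2 : c.eta - c.logT = Real.log ((1 + c.t) / c.t ^ 2) := by
      rw [eta, logT, ← Real.log_div (by positivity) (by positivity)]; congr 1; field_simp
    have h3 := hlog' ((1 + c.t) / c.t ^ 2) (by positivity)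
    have h4 : c.t ^ 2 / (1 + c.t) ≤ 0.75 := by
      rw [div_le_iff₀ (by positivity)]; nlinarith only [h_t, h1]
    rw [inv_div, ← h2] at h3
    have h5 := hlog c.t hpos
    refine le_trans ?_ (le_abs_self _)
    unfold ht
    have : c.logT ≤ c.t - 1 := h5
    linarith
  · have h0' : (1 : ℝ) ≤ c.n := by exact_mod_cast h0
    have h_t : 1.8 ≤ c.t := by
      by_contra! h2
      have h3 : c.t ^ 2 + c.t ≤ c.n * (c.t ^ 2 + c.t) := by
        have : 0 ≤ c.t ^ 2 + c.t := by positivity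
        nlinarith only [this, h0']
      have h4 : c.t ^ 2 ≤ 3.24 := by nlinarith only [h2, h1]
      nlinarith only [h, h3, h4, h2, h1]
    have h2 : c.eta ≤ Real.log (14 / 9) := by
      refine Real.log_le_log (by positivity) ?_
      rw [div_le_div_iff₀ hpos (by norm_num)]; linarith
    have h3 : Real.log 1.8 ≤ c.logT := Real.log_le_log (by norm_num) h_t
    have h4 := hlog 1.8 (by norm_num)
    have h5 := hlog' (81 / 70) (by norm_num)
    have h6 : Real.log (81 / 70) = Real.log 1.8 - Real.log (14 / 9) := by
      rw [← Real.log_div (by norm_num) (by norm_num)]; norm_num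
    rw [abs_sub_comm]
    refine le_trans ?_ (le_abs_self _)
    unfold ht
    norm_num at h4 h5
    norm_num at *
    linarith

lemma abs_e_sub_ge {i j : Fin 3} (hij : i ≠ j) : c.ht / 20 ≤ |c.e i - c.e j| := by
  have h1 := c.abs_eta_sub_logT_ge
  have h2 := c.eta_pos
  have h3 := c.ht_le
  have h4 := c.logT_ge
  have h01 : c.ht / 20 ≤ |c.e 0 - c.e 1| := by
    rw [abs_sub_comm]; simpa [e] using h1
  have h02 : c.ht / 20 ≤ |c.e 0 - c.e 2| := by
    refine le_trans ?_ (le_abs_self _)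
    simp [e]; linarith
  have h12 : c.ht / 20 ≤ |c.e 1 - c.e 2| := by
    refine le_trans ?_ (le_abs_self _)
    simp [e]; linarith
  fin_cases i <;> fin_cases j <;> first | exact absurd rfl hij | assumption | (rw [abs_sub_comm]; assumption)

lemma abs_lam_zpow_mul (i j : Fin 3) (p q : ℤ) :
    |c.lam i ^ p * c.lam j ^ q| = Real.exp (p * c.e i + q * c.e j) := by
  rw [abs_mul, c.abs_lam_zpow, c.abs_lam_zpow, Real.exp_add]

lemma e_rel_of_e_rel {p q : ℤ} (h : p * c.e 0 + q * c.e 1 = 0) (i : Fin 3) :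
    p * c.e i + q * c.e (i + 1) = 0 := by
  have hm : (fun i => c.lam i ^ (2 * p)) * (fun i => c.lam (i + 1) ^ (2 * q)) - 1 ∈ c.order :=
    c.order.sub_mem (c.order.mul_mem (by simpa using c.unit_mem 0 (2 * p)) (c.unit_mem 1 (2 * q)))
      c.order.one_mem
  have hval : ∀ i, c.lam i ^ (2 * p) * c.lam (i + 1) ^ (2 * q) =
      Real.exp (2 * (p * c.e i + q * c.e (i + 1))) := by
    intro i
    have h1 := c.abs_lam_zpow_mul i (i + 1) (2 * p) (2 * q)
    rw [abs_of_nonneg] at h1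
    · rw [h1]; congr 1; push_cast; ring
    · rw [zpow_mul', zpow_mul']
      exact mul_nonneg (even_two.zpow_nonneg _) (even_two.zpow_nonneg _)
  have h0 : ((fun i => c.lam i ^ (2 * p)) * (fun i => c.lam (i + 1) ^ (2 * q)) - 1 : Fin 3 → ℝ) 0 = 0 := by
    simp only [Pi.sub_apply, Pi.mul_apply, Pi.one_apply, hval]
    simp only [zero_add, h]; simp
  have hz := congrFun (c.eq_zero_of_apply_eq_zero hm h0) i
  simp only [Pi.sub_apply, Pi.mul_apply, Pi.one_apply, hval, Pi.zero_apply] at hz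
  have := Real.exp_eq_one_iff _ |>.1 (sub_eq_zero.1 hz)
  linarith

lemma eq_zero_of_logT_eta {p q : ℤ} (h : p * c.logT + q * c.eta = 0) : p = 0 ∧ q = 0 := by
  have h1 := c.e_rel_of_e_rel (p := p) (q := q) (by simpa [e] using h) 1
  have h2 : p * c.eta + q * (-c.logT - c.eta) = 0 := by simpa [e] using h1
  have hL := c.logT_ge
  have hE := c.eta_pos
  have h3 : (q : ℝ) * (c.logT ^ 2 + c.logT * c.eta + c.eta ^ 2) = 0 := by
    linear_combination c.eta * h - c.logT * h2
  have hq : (q : ℝ) = 0 := by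
    rcases mul_eq_zero.1 h3 with h3 | h3
    · exact h3
    · have : 0 < c.logT ^ 2 + c.logT * c.eta + c.eta ^ 2 := by positivity
      linarith
  rw [hq] at h
  have hp : (p : ℝ) = 0 := by
    rcases mul_eq_zero.1 (show (p : ℝ) * c.logT = 0 by linarith) with h | h
    · exact h
    · linarith
  exact ⟨by exact_mod_cast hp, by exact_mod_cast hq⟩

end SimplestCubic

lemma IsRoots.sum_eq {n : ℤ} {l0 l1 l2 : ℝ} (h : IsRoots n l0 l1 l2) : l0 + l1 + l2 = n - 1 := by
  obtain ⟨h0, h1, h2, h01, h02, h12⟩ := h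
  simp only [fn] at h0 h1 h2
  have a1 : l0 ^ 2 + l0 * l1 + l1 ^ 2 - (n - 1) * (l0 + l1) - (n + 2) = 0 :=
    mul_left_cancel₀ (sub_ne_zero.2 h01) (by linear_combination h0 - h1)
  have a2 : l0 ^ 2 + l0 * l2 + l2 ^ 2 - (n - 1) * (l0 + l2) - (n + 2) = 0 :=
    mul_left_cancel₀ (sub_ne_zero.2 h02) (by linear_combination h0 - h2)
  exact mul_left_cancel₀ (sub_ne_zero.2 h12) (by linear_combination a1 - a2)

lemma IsRoots.prod_eq {n : ℤ} {l0 l1 l2 : ℝ} (h : IsRoots n l0 l1 l2) : l0 * l1 * l2 = 1 := by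
  have hs := h.sum_eq
  obtain ⟨h0, h1, h2, h01, h02, h12⟩ := h
  simp only [fn] at h0 h1 h2
  have a1 : l0 ^ 2 + l0 * l1 + l1 ^ 2 - (n - 1) * (l0 + l1) - (n + 2) = 0 :=
    mul_left_cancel₀ (sub_ne_zero.2 h01) (by linear_combination h0 - h1)
  linear_combination h0 - l0 * a1 + l0 * l1 * hs

lemma IsRoots.exists_of_pos {n : ℤ} {l0 l1 l2 : ℝ} (h : IsRoots n l0 l1 l2) (hn : 0 ≤ n)
    (hpos : 0 < l0) : ∃ c : SimplestCubic, c.n = n ∧ ∀ (a : ℤ) (x y : ℝ),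
      Fna a l0 l1 l2 x y = Fna a (c.lam 0) (c.lam 1) (c.lam 2) x y := by
  have hs := h.sum_eq
  have hp := h.prod_eq
  have hn' : (0 : ℝ) ≤ n := by exact_mod_cast hn
  have hgt : 1.2 < l0 := by
    have h0 := h.1
    simp only [fn] at h0
    by_contra! h2
    nlinarith only [h0, h2, hpos, mul_nonneg hn' (show 0 ≤ l0 ^ 2 + l0 by positivity),
      mul_nonneg hpos.le (sub_nonneg.2 h2), mul_nonneg (mul_nonneg hpos.le hpos.le) (sub_nonneg.2 h2)]
  let c : SimplestCubic := ⟨n, hn, l0, h.1, hgt⟩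
  refine ⟨c, rfl, fun a x y => ?_⟩
  have e0 : c.lam 0 = l0 := rfl
  have hs' : c.lam 0 + c.lam 1 + c.lam 2 = n - 1 := c.sum_lam
  have hp' := c.prod_lam
  rw [e0] at hs' hp' ⊢
  have hmul : l1 * l2 = c.lam 1 * c.lam 2 :=
    mul_left_cancel₀ hpos.ne' (by linear_combination hp - hp')
  have hfac : (l1 - c.lam 1) * (l1 - c.lam 2) = 0 := by
    linear_combination l1 * (hs - hs') - hmul
  rcases mul_eq_zero.1 hfac with h1 | h1
  · have h1 := sub_eq_zero.1 h1
    have h2 : l2 = c.lam 2 := by linarith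
    rw [h1, h2]
  · have h1 := sub_eq_zero.1 h1
    have h2 : l2 = c.lam 1 := by linarith
    rw [h1, h2]; simp only [Fna]; ring

lemma IsRoots.exists_simplestCubic {n : ℤ} {l0 l1 l2 : ℝ} (h : IsRoots n l0 l1 l2) (hn : 0 ≤ n) :
    ∃ c : SimplestCubic, c.n = n ∧ ∀ (a : ℤ) (x y : ℝ),
      Fna a l0 l1 l2 x y = Fna a (c.lam 0) (c.lam 1) (c.lam 2) x y := by
  have hp := h.prod_eq
  by_cases p0 : 0 < l0
  · exact h.exists_of_pos hn p0
  obtain ⟨h0, h1, h2, h01, h02, h12⟩ := h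
  by_cases p1 : 0 < l1
  · obtain ⟨c, hc, hF⟩ := IsRoots.exists_of_pos ⟨h1, h0, h2, h01.symm, h12, h02⟩ hn p1
    exact ⟨c, hc, fun a x y => by rw [← hF]; simp only [Fna]; ring⟩
  by_cases p2 : 0 < l2
  · obtain ⟨c, hc, hF⟩ := IsRoots.exists_of_pos ⟨h2, h0, h1, h02.symm, h12.symm, h01⟩ hn p2
    exact ⟨c, hc, fun a x y => by rw [← hF]; simp only [Fna]; ring⟩
  push Not at p0 p1 p2
  have := mul_nonneg_of_nonpos_of_nonpos p0 p1
  nlinarith only [mul_nonpos_of_nonneg_of_nonpos this p2, hp]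

namespace SimplestCubic
variable (c : SimplestCubic)

/-- The square of the unit with exponents `p`, `q`, in its three real embeddings. -/
def unitSq (p q : ℤ) : Fin 3 → ℝ := fun i => (c.lam i ^ p * c.lam (i + 1) ^ q) ^ 2

lemma unitSq_mem (p q : ℤ) : c.unitSq p q ∈ c.order :=
  c.order.pow_mem (c.order.mul_mem (by simpa using c.unit_mem 0 p) (c.unit_mem 1 q)) 2

lemma unitSq_eq (p q : ℤ) (i : Fin 3) :
    c.unitSq p q i = Real.exp (2 * (p * c.e i + q * c.e (i + 1))) := by
  rw [unitSq, ← sq_abs, c.abs_lam_zpow_mul, sq, ← Real.exp_add]; congr 1; ring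

lemma unitSq_zero (p q : ℤ) : c.unitSq p q 0 = Real.exp (2 * (p * c.logT + q * c.eta)) := by
  rw [c.unitSq_eq]; simp [e]

lemma unitSq_le (p q : ℤ) (i : Fin 3) :
    c.unitSq p q i ≤ Real.exp (2 * (|(p : ℝ)| + |(q : ℝ)|) * c.ht) := by
  rw [c.unitSq_eq, Real.exp_le_exp]
  have h1 : (p : ℝ) * c.e i ≤ |(p : ℝ)| * c.ht :=
    (le_abs_self _).trans (by rw [abs_mul]; gcongr; exact c.abs_e_le i)
  have h2 : (q : ℝ) * c.e (i + 1) ≤ |(q : ℝ)| * c.ht :=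
    (le_abs_self _).trans (by rw [abs_mul]; gcongr; exact c.abs_e_le _)
  linarith

lemma unitSq_pos (p q : ℤ) (i : Fin 3) : 0 < c.unitSq p q i := by
  rw [c.unitSq_eq]; exact Real.exp_pos _

lemma exp_log_form {G H : Fin 3 → ℝ} (hG0 : G 0 ≠ 0) (hH0 : H 0 ≠ 0) (D E : ℤ) :
    G 0 ^ 2 * c.unitSq D E 0 =
      H 0 ^ 2 * Real.exp (2 * (Real.log (G 0 / H 0) + D * c.logT + E * c.eta)) := by
  have : Real.exp (2 * Real.log (G 0 / H 0)) = (G 0 / H 0) ^ 2 := by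
    rw [← Real.log_abs, mul_comm, Real.exp_mul, Real.exp_log (by positivity), ← sq_abs (G 0 / H 0)]
    norm_cast
  rw [c.unitSq_zero, add_assoc, mul_add 2 (Real.log _), Real.exp_add, this]
  field_simp

lemma abs_exponent_mul_ht_le {G H : Fin 3 → ℝ} (hG : G ∈ c.order) (hH : H ∈ c.order) {h : ℝ}
    (hGb : ∀ i, |G i| ≤ Real.exp h) (hHb : ∀ i, |H i| ≤ Real.exp h)
    (hG0 : G 0 ≠ 0) (hH0 : H 0 ≠ 0) (D : ℤ) (Z : ℝ) :
    |(D : ℝ)| * c.ht ≤ 7 * (3 * h + |Z| + |Real.log (G 0 / H 0) + D * c.logT + Z|) := by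
  have h1 := c.normGeOne_order.abs_log_div_le hG hH hGb hHb hG0 hH0
  have h2 : |(D : ℝ)| * c.logT ≤ |Real.log (G 0 / H 0) + D * c.logT + Z| +
      |Real.log (G 0 / H 0)| + |Z| := by
    rw [← abs_of_pos (show 0 < c.logT by linarith [c.logT_ge]), ← abs_mul,
      abs_of_pos (show 0 < c.logT by linarith [c.logT_ge])]
    have h3 : (D : ℝ) * c.logT = (Real.log (G 0 / H 0) + D * c.logT + Z) - Real.log (G 0 / H 0) - Z := by
      ring
    calc _ = |(Real.log (G 0 / H 0) + D * c.logT + Z) - Real.log (G 0 / H 0) - Z| := by rw [← h3]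
      _ ≤ _ := (abs_sub _ _).trans (by gcongr; exact abs_sub _ _)
  have h3 : |(D : ℝ)| * c.ht ≤ |(D : ℝ)| * (7 * c.logT) := by gcongr; exact c.ht_le
  linarith

lemma liouville {G H : Fin 3 → ℝ} (hG : G ∈ c.order) (hH : H ∈ c.order) {h : ℝ} (h1 : 1 ≤ h)
    (hGb : ∀ i, |G i| ≤ Real.exp h) (hHb : ∀ i, |H i| ≤ Real.exp h)
    (hG0 : G 0 ≠ 0) (hH0 : H 0 ≠ 0) {D E : ℤ} {T : ℝ}
    (hX0 : Real.log (G 0 / H 0) + D * c.logT + E * c.eta ≠ 0)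
    (hT : |Real.log (G 0 / H 0) + D * c.logT + E * c.eta| ≤ Real.exp (-T)) :
    T ≤ 130 * h + 32 * (|(E : ℝ)| * c.ht) := by
  set X := Real.log (G 0 / H 0) + D * c.logT + E * c.eta with hX
  have hht := c.one_le_ht
  have hEa : |(E : ℝ)| ≤ |(E : ℝ)| * c.ht := le_mul_of_one_le_right (abs_nonneg _) hht
  by_cases hT1 : T < 1
  · have : 0 ≤ |(E : ℝ)| * c.ht := by positivity
    linarith
  push Not at hT1
  have hX1 : |X| ≤ 1 / 2 := by
    have h2 : Real.exp (-T) ≤ Real.exp (-1) := Real.exp_le_exp.2 (by linarith)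
    have h3 := Real.exp_neg_one_lt_half
    linarith
  have hD : |(D : ℝ)| * c.ht ≤ 7 * (3 * h + |(E : ℝ)| + 1) := by
    refine (c.abs_exponent_mul_ht_le hG hH hGb hHb hG0 hH0 D (E * c.eta)).trans ?_
    have h2 : |(E : ℝ) * c.eta| ≤ |(E : ℝ)| := by
      rw [abs_mul, abs_of_pos c.eta_pos]
      exact mul_le_of_le_one_right (abs_nonneg _) c.eta_lt_one.le
    linarith
  have hform := c.exp_log_form hG0 hH0 D E
  rw [← hX] at hform
  set V : Fin 3 → ℝ := G ^ 2 * c.unitSq D E - H ^ 2 with hV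
  have hVm : V ∈ c.order := c.order.sub_mem (c.order.mul_mem (c.order.pow_mem hG 2)
    (c.unitSq_mem D E)) (c.order.pow_mem hH 2)
  have hV0 : V 0 = H 0 ^ 2 * (Real.exp (2 * X) - 1) := by
    simp only [hV, Pi.sub_apply, Pi.mul_apply, Pi.pow_apply, hform]; ring
  have hVne : V 0 ≠ 0 := by
    rw [hV0]
    refine mul_ne_zero (pow_ne_zero 2 hH0) (sub_ne_zero.2 fun h2 => hX0 ?_)
    have := (Real.exp_eq_one_iff _).1 h2
    linarith
  set W := 2 * h + 2 * (|(D : ℝ)| + |(E : ℝ)|) * c.ht with hW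
  have hsq : ∀ {z : ℝ}, |z| ≤ Real.exp h → z ^ 2 ≤ Real.exp (2 * h) := by
    intro z hz
    rw [two_mul, Real.exp_add, ← sq_abs, sq]
    exact mul_le_mul hz hz (abs_nonneg _) (Real.exp_pos _).le
  have hVb : ∀ i, |V i| ≤ Real.exp (W + 1) := by
    intro i
    have a1 : G i ^ 2 * c.unitSq D E i ≤ Real.exp W := by
      rw [hW, Real.exp_add]
      exact mul_le_mul (hsq (hGb i)) (c.unitSq_le D E i) (c.unitSq_pos D E i).le (Real.exp_pos _).le
    have a2 : H i ^ 2 ≤ Real.exp W :=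
      (hsq (hHb i)).trans (Real.exp_le_exp.2 (by
        have : 0 ≤ 2 * (|(D : ℝ)| + |(E : ℝ)|) * c.ht := by positivity
        linarith))
    have a3 : 0 ≤ G i ^ 2 * c.unitSq D E i := mul_nonneg (sq_nonneg _) (c.unitSq_pos D E i).le
    have a4 : V i = G i ^ 2 * c.unitSq D E i - H i ^ 2 := rfl
    have a5 : Real.exp W ≤ Real.exp (W + 1) := Real.exp_le_exp.2 (by linarith)
    rw [a4, abs_le]
    constructor <;> nlinarith only [a1, a2, a3, a5, sq_nonneg (H i)]
  have hlow := c.normGeOne_order.exp_neg_le hVm hVb hVne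
  have hup : |V 0| ≤ Real.exp (2 * h + 2 - T) := by
    rw [hV0, abs_mul, abs_of_nonneg (sq_nonneg _)]
    have b1 : |Real.exp (2 * X) - 1| ≤ 2 * |2 * X| :=
      abs_exp_sub_one_le_two_mul le_rfl (by rw [abs_mul]; norm_num; linarith)
    have b2 : |Real.exp (2 * X) - 1| ≤ 4 * Real.exp (-T) := by
      rw [abs_mul, abs_two] at b1; linarith
    have b3 : (4 : ℝ) ≤ Real.exp 2 := by
      have := Real.add_one_le_exp (1 : ℝ)
      have h2 : Real.exp 2 = Real.exp 1 * Real.exp 1 := by rw [← Real.exp_add]; norm_num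
      nlinarith only [this, h2]
    calc _ ≤ Real.exp (2 * h) * (Real.exp 2 * Real.exp (-T)) := by
            refine mul_le_mul (hsq (hHb 0)) (b2.trans ?_) (abs_nonneg _) (Real.exp_pos _).le
            gcongr
      _ = _ := by rw [← Real.exp_add, ← Real.exp_add]; congr 1; ring
  have := Real.exp_le_exp.1 (hlow.trans hup)
  rw [hW] at this
  linarith

end SimplestCubic

lemma exists_pow_fifteen_mul_exp_le (K : ℝ) :
    ∃ M0 : ℕ, 80 ≤ M0 ∧ ∀ M : ℕ, M0 ≤ M → K * (M : ℝ) ^ 15 * Real.exp (4 - M / 20) ≤ 1 / 2 := by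
  have h1 : Filter.Tendsto (fun x : ℝ => K * x ^ 15 * Real.exp (4 - x / 20)) Filter.atTop (nhds 0) := by
    have h2 := (Real.tendsto_pow_mul_exp_neg_atTop_nhds_zero 15).comp
      (Filter.tendsto_id.atTop_div_const (show (0 : ℝ) < 20 by norm_num))
    have h3 := h2.const_mul (K * 20 ^ 15 * Real.exp 4)
    rw [mul_zero] at h3
    refine h3.congr fun x => ?_
    simp only [Function.comp, id, sub_eq_add_neg, Real.exp_add]
    ring
  have h4 := h1.comp tendsto_natCast_atTop_atTop
  have h5 := (h4.eventually_le_const (show (0 : ℝ) < 1 / 2 by norm_num))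
  obtain ⟨N, hN⟩ := Filter.eventually_atTop.1 h5
  exact ⟨max 80 N, le_max_left _ _, fun M hM => hN M ((le_max_right _ _).trans hM)⟩

lemma exists_nat_cube_le {x : ℝ} (hx : 1 ≤ x) :
    ∃ k : ℕ, 0 < k ∧ (k : ℝ) ^ 3 ≤ x ∧ x ≤ 8 * (k : ℝ) ^ 3 := by
  set y := x ^ (1 / 3 : ℝ) with hy
  have hy1 : 1 ≤ y := Real.one_le_rpow hx (by norm_num)
  have hy3 : y ^ 3 = x := by
    rw [hy, ← Real.rpow_natCast, ← Real.rpow_mul (by linarith)]; norm_num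
  have hk : 0 < ⌊y⌋₊ := Nat.floor_pos.2 hy1
  have hk1 : (1 : ℝ) ≤ ⌊y⌋₊ := by exact_mod_cast hk
  refine ⟨⌊y⌋₊, hk, ?_, ?_⟩
  · rw [← hy3]; gcongr; exact Nat.floor_le (by linarith)
  · have h2 : y ≤ 2 * ⌊y⌋₊ := by linarith [Nat.lt_floor_add_one y]
    calc x = y ^ 3 := hy3.symm
      _ ≤ (2 * (⌊y⌋₊ : ℝ)) ^ 3 := by gcongr
      _ = _ := by ring

lemma SimplestCubic.exists_small_combination {M0 : ℕ} (hM0 : 80 ≤ M0) :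
    ∃ Q : ℕ, 0 < Q ∧ ∀ (c : SimplestCubic) (k : ℕ), 0 < k → (k : ℝ) ^ 3 ≤ c.ht →
      c.ht ≤ 8 * (k : ℝ) ^ 3 → ∃ p q : ℤ, 1 ≤ q ∧ q ≤ Q ∧
        |p * c.logT + q * c.eta| ≤ Real.exp (4 - (M0 * k : ℕ) / 20) := by
  set δ := Real.exp (4 - (M0 * M0 : ℕ) / 20) with hδ
  set N := ⌈8 * (M0 : ℝ) ^ 3 / δ⌉₊ + 1 with hN
  refine ⟨N, by omega, fun c k hk hk1 hk2 => ?_⟩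
  have hkr : (1 : ℝ) ≤ k := by exact_mod_cast hk
  by_cases hkM : M0 ≤ k
  · refine ⟨0, 1, le_rfl, by omega, ?_⟩
    have h1 := c.eta_le_exp
    have hkM' : (M0 : ℝ) ≤ k := by exact_mod_cast hkM
    have h2 : c.ht = 1 + c.logT := rfl
    simp only [Int.cast_zero, zero_mul, Int.cast_one, one_mul, zero_add]
    rw [abs_of_pos c.eta_pos]
    refine h1.trans (Real.exp_le_exp.2 ?_)
    push_cast
    have h3 : (M0 : ℝ) * k ≤ (k : ℝ) ^ 3 := by
      calc (M0 : ℝ) * k ≤ k * k := by gcongr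
        _ ≤ k * k * k := le_mul_of_one_le_right (by positivity) hkr
        _ = _ := by ring
    have h4 : 0 ≤ (M0 : ℝ) * k := by positivity
    linarith
  · push Not at hkM
    have hkM' : (k : ℝ) ≤ M0 := by exact_mod_cast hkM.le
    have hL := c.logT_ge
    obtain ⟨j, q, hq0, hqN, hjq⟩ := Real.exists_int_int_abs_mul_sub_le (c.eta / c.logT)
      (n := N) (by omega)
    refine ⟨-j, q, by omega, hqN, ?_⟩
    have hLpos : 0 < c.logT := by linarith
    have hδpos : 0 < δ := Real.exp_pos _
    have h1 : ((-j : ℤ) : ℝ) * c.logT + q * c.eta = c.logT * (q * (c.eta / c.logT) - j) := by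
      push_cast; field_simp; ring
    have hN1 : 8 * (M0 : ℝ) ^ 3 / δ ≤ N := by
      rw [hN]; push_cast; linarith [Nat.le_ceil (8 * (M0 : ℝ) ^ 3 / δ)]
    have hLM : c.logT ≤ 8 * (M0 : ℝ) ^ 3 := by
      have : c.ht = 1 + c.logT := rfl
      have : (k : ℝ) ^ 3 ≤ (M0 : ℝ) ^ 3 := by gcongr
      linarith
    rw [h1, abs_mul, abs_of_pos hLpos]
    calc _ ≤ 8 * (M0 : ℝ) ^ 3 * (1 / (N + 1)) := by gcongr
      _ ≤ δ := by
        rw [mul_one_div, div_le_iff₀ (by positivity)]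
        rw [div_le_iff₀ hδpos] at hN1
        linarith
      _ ≤ _ := by
        rw [hδ]; refine Real.exp_le_exp.2 ?_
        gcongr

namespace SimplestCubic
variable (c : SimplestCubic)

lemma two_log_step {G H : Fin 3 → ℝ} (hG : G ∈ c.order) (hH : H ∈ c.order) {h : ℝ} (hh : c.ht ≤ h)
    (hGb : ∀ i, |G i| ≤ Real.exp h) (hHb : ∀ i, |H i| ≤ Real.exp h)
    (hG0 : G 0 ≠ 0) (hH0 : H 0 ≠ 0) {D E p q : ℤ} {T δ : ℝ} {M : ℕ} (hM : 80 ≤ M)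
    (hδ : δ = Real.exp (4 - M / 20)) (hMδ : 60000 * M * δ ≤ 1 / 2) (hq : 1 ≤ q)
    (hθ : |p * c.logT + q * c.eta| ≤ δ) (hT0 : 0 ≤ T)
    (hT : |Real.log (G 0 / H 0) + D * c.logT + E * c.eta| ≤ Real.exp (-T)) :
    |(E : ℝ)| ≤ q * (500000 * M * q * h) ∨
    ∃ b : ℝ, 0 ≤ b ∧ q * b ≤ |(E : ℝ)| + q ∧
      T - 1 ≤ 1000000 * M ^ 3 * (28 * q * c.ht) * (100 * q * h + 14 * b * δ) := by
  have hht := c.one_le_ht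
  have hqr : (1 : ℝ) ≤ q := by exact_mod_cast hq
  have hMr : (80 : ℝ) ≤ M := by exact_mod_cast hM
  have hδpos : 0 < δ := by rw [hδ]; exact Real.exp_pos _
  have hδ1 : δ ≤ 1 := by rw [hδ]; exact Real.exp_le_one_iff.2 (by linarith)
  set θ := p * c.logT + q * c.eta with hθdef
  have hθ0 : θ ≠ 0 := fun h0 => by have := (c.eq_zero_of_logT_eta h0).2; omega
  set E' := E / q with hE'
  set r := E % q with hr
  have hEr : q * E' + r = E := Int.mul_ediv_add_emod E q
  have hr0 : 0 ≤ r := Int.emod_nonneg _ (by omega)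
  have hrq : r < q := Int.emod_lt_of_pos _ (by omega)
  have hErr : (q : ℝ) * E' + r = E := by exact_mod_cast hEr
  have hr0r : (0 : ℝ) ≤ r := by exact_mod_cast hr0
  have hrqr : (r : ℝ) ≤ q := by exact_mod_cast hrq.le
  set b := E'.natAbs with hb
  have hbr : (b : ℝ) = |(E' : ℝ)| := by rw [hb, Nat.cast_natAbs]; push_cast; rfl
  obtain ⟨s, hs, hsb⟩ : ∃ s : ℤ, |s| = 1 ∧ s * (b : ℤ) = E' := by
    rcases le_total 0 E' with h0 | h0
    · exact ⟨1, rfl, by omega⟩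
    · exact ⟨-1, rfl, by omega⟩
  have hsr : |(s : ℝ)| = 1 := by exact_mod_cast hs
  have hsbr : (s : ℝ) * b = E' := by exact_mod_cast hsb
  have hqb : q * (b : ℝ) ≤ |(E : ℝ)| + q := by
    rw [hbr]
    have h1 : q * |(E' : ℝ)| = |(E : ℝ) - r| := by
      rw [← hErr, add_sub_cancel_right, abs_mul, abs_of_pos (by linarith : (0 : ℝ) < q)]
    rw [h1]
    exact (abs_sub _ _).trans (by rw [abs_of_nonneg hr0r]; gcongr)
  -- the exponents
  have hp : |(p : ℝ)| ≤ 12 * q := by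
    have h1 : |(p : ℝ)| * c.logT ≤ 2 * q := by
      have hL : 0 < c.logT := by linarith [c.logT_ge]
      rw [← abs_of_pos hL, ← abs_mul]
      have h2 : p * c.logT = θ - q * c.eta := by rw [hθdef]; ring
      rw [h2]
      refine (abs_sub _ _).trans ?_
      rw [abs_of_nonneg (mul_nonneg (by linarith) c.eta_pos.le)]
      have := mul_le_mul_of_nonneg_left c.eta_lt_one.le (show (0 : ℝ) ≤ q by linarith)
      linarith
    nlinarith only [h1, c.logT_ge, abs_nonneg (p : ℝ)]
  set D' := D - E' * p with hD'
  have hX : Real.log (G 0 / H 0) + D' * c.logT + (E' * θ + r * c.eta) =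
      Real.log (G 0 / H 0) + D * c.logT + E * c.eta := by
    rw [hD', ← hErr, hθdef]; push_cast; ring
  have hX' : Real.log (G 0 / H 0) + D' * c.logT + r * c.eta =
      (Real.log (G 0 / H 0) + D * c.logT + E * c.eta) - E' * θ := by
    rw [← hX]; ring
  have hD'b : |(D' : ℝ)| * c.ht ≤ 7 * (3 * h + (b * δ + q) + 1) := by
    refine (c.abs_exponent_mul_ht_le hG hH hGb hHb hG0 hH0 D' (E' * θ + r * c.eta)).trans ?_
    rw [hX]
    have h1 : |Real.log (G 0 / H 0) + D * c.logT + E * c.eta| ≤ 1 :=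
      hT.trans (Real.exp_le_one_iff.2 (by linarith))
    have h2 : |E' * θ + r * c.eta| ≤ b * δ + q := by
      refine (abs_add_le _ _).trans ?_
      rw [abs_mul, abs_mul, ← hbr, abs_of_nonneg hr0r, abs_of_pos c.eta_pos]
      have : (r : ℝ) * c.eta ≤ q * 1 := by
        gcongr
        · exact c.eta_pos.le
        · exact c.eta_lt_one.le
      have h3 : (b : ℝ) * |θ| ≤ b * δ := by gcongr
      linarith
    linarith
  -- the heights
  set h1 := ⌈26 * q * c.ht⌉₊ with hh1
  set h2 := ⌈75 * q * h + 14 * (b * δ)⌉₊ with hh2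
  have hh1le : 26 * q * c.ht ≤ h1 := Nat.le_ceil _
  have hh2le : 75 * q * h + 14 * (b * δ) ≤ h2 := Nat.le_ceil _
  have hqh : (1 : ℝ) ≤ q * c.ht := one_le_mul_of_one_le_of_one_le hqr hht
  have hqh' : (1 : ℝ) ≤ q * h := one_le_mul_of_one_le_of_one_le hqr (hht.trans hh)
  have hbδ : 0 ≤ b * δ := by positivity
  have hh1up : h1 ≤ 28 * q * c.ht := by
    have := Nat.ceil_lt_add_one (show 0 ≤ 26 * q * c.ht by nlinarith only [hqh])
    linarith
  have hh2up : h2 ≤ 100 * q * h + 14 * b * δ := by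
    have := Nat.ceil_lt_add_one (show 0 ≤ 75 * q * h + 14 * (b * δ) by nlinarith only [hqh', hbδ])
    linarith
  have hh1pos : 0 < h1 := Nat.ceil_pos.2 (by nlinarith only [hqh])
  have hh2pos : 0 < h2 := Nat.ceil_pos.2 (by nlinarith only [hqh', hbδ])
  by_cases hbig : 2 * (1000 * M * h2) ≤ b
  swap
  · left
    push Not at hbig
    have h3 : (b : ℝ) < 2 * (1000 * M * h2) := by exact_mod_cast hbig
    have h4 : (b : ℝ) ≤ 2000 * M * (100 * q * h) + 28000 * M * δ * b := by
      have := mul_le_mul_of_nonneg_left hh2up (show (0 : ℝ) ≤ 2000 * M by positivity)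
      linarith
    have h5 : 28000 * M * δ * b ≤ 1 / 2 * b := by
      refine mul_le_mul_of_nonneg_right ?_ (Nat.cast_nonneg b)
      have : 0 ≤ M * δ := by positivity
      linarith
    have h6 : (b : ℝ) ≤ 500000 * M * (q * h) - 1 := by
      have : (80 : ℝ) * 1 ≤ M * (q * h) := mul_le_mul hMr hqh' (by norm_num) (by positivity)
      linarith
    have h7 : |(E : ℝ)| ≤ q * b + q := by
      rw [← hErr, hbr]
      refine (abs_add_le _ _).trans ?_
      rw [abs_mul, abs_of_pos (by linarith : (0 : ℝ) < q), abs_of_nonneg hr0r]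
      linarith
    have := mul_le_mul_of_nonneg_left h6 (show (0 : ℝ) ≤ q by linarith)
    linarith
  right
  refine ⟨b, Nat.cast_nonneg b, hqb, ?_⟩
  have hAb : ∀ i, |c.unitSq (s * p) (s * q) i| ≤ Real.exp h1 := by
    intro i
    rw [abs_of_pos (c.unitSq_pos _ _ _)]
    refine (c.unitSq_le _ _ i).trans (Real.exp_le_exp.2 ?_)
    push_cast
    rw [abs_mul, abs_mul, hsr, one_mul, one_mul, abs_of_pos (by linarith : (0 : ℝ) < q)]
    refine le_trans ?_ hh1le
    have := mul_le_mul_of_nonneg_right hp (show 0 ≤ c.ht by linarith)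
    linarith
  have hsq : ∀ {z : ℝ}, |z| ≤ Real.exp h → z ^ 2 ≤ Real.exp (2 * h) := by
    intro z hz
    rw [two_mul, Real.exp_add, ← sq_abs, sq]
    exact mul_le_mul hz hz (abs_nonneg _) (Real.exp_pos _).le
  have hHb2 : ∀ i, |(H ^ 2 : Fin 3 → ℝ) i| ≤ Real.exp h2 := by
    intro i
    rw [Pi.pow_apply, abs_of_nonneg (sq_nonneg _)]
    refine (hsq (hHb i)).trans (Real.exp_le_exp.2 (le_trans ?_ hh2le))
    nlinarith only [hqr, hht, hh, hbδ]
  have hGb2 : ∀ i, |(G ^ 2 * c.unitSq D' r : Fin 3 → ℝ) i| ≤ Real.exp h2 := by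
    intro i
    rw [Pi.mul_apply, Pi.pow_apply, abs_of_nonneg (mul_nonneg (sq_nonneg _) (c.unitSq_pos _ _ _).le)]
    refine (mul_le_mul (hsq (hGb i)) (c.unitSq_le _ _ i) (c.unitSq_pos _ _ i).le
      (Real.exp_pos _).le).trans ?_
    rw [← Real.exp_add, abs_of_nonneg hr0r]
    refine Real.exp_le_exp.2 (le_trans ?_ hh2le)
    have e1 : (r : ℝ) * c.ht ≤ q * h := mul_le_mul hrqr hh (by linarith) (by linarith)
    have e2 : (q : ℝ) ≤ q * h := le_mul_of_one_le_right (by linarith) (hht.trans hh)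
    have e3 : h ≤ q * h := le_mul_of_one_le_left (by linarith) hqr
    nlinarith only [e1, e2, e3, hD'b, hqh']
  have hlogA : Real.log (c.unitSq (s * p) (s * q) 0) = 2 * (s * θ) := by
    rw [c.unitSq_zero, Real.log_exp, hθdef]; push_cast; ring
  have hlog := c.normGeOne_order.two_log (c.unitSq_mem (s * p) (s * q)) (c.order.pow_mem hH 2)
    (c.order.mul_mem (c.order.pow_mem hG 2) (c.unitSq_mem D' r)) hh1pos hh2pos (by omega : 0 < M)
    hAb hHb2 hGb2 (c.unitSq_pos _ _ _) (fun h0 => by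
      rw [h0, Real.log_one] at hlogA
      have hs0 : (s : ℝ) ≠ 0 := fun h0 => by rw [h0] at hsr; simp at hsr
      have := mul_ne_zero two_ne_zero (mul_ne_zero hs0 hθ0)
      exact this hlogA.symm) (by simpa using by positivity)
    (mul_pos (by simpa using by positivity) (c.unitSq_pos _ _ _)) hbig (by
      have h3 : (0 : ℝ) < h2 := by exact_mod_cast hh2pos
      have h4 : 0 < (b : ℝ) := by
        have : (0 : ℝ) < 2 * (1000 * M * h2) := by positivity
        have h5 : 2 * (1000 * (M : ℝ) * h2) ≤ b := by exact_mod_cast hbig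
        linarith
      have h5 : Real.log (b / h2) ≤ M / 20 - 4 := by
        rw [Real.log_le_iff_le_exp (by positivity), div_le_iff₀ h3]
        have h6 : b * δ ≤ h2 := by nlinarith only [hh2le, hqh', hbδ]
        have h7 : Real.exp (M / 20 - 4) * δ = 1 := by
          rw [hδ, ← Real.exp_add]; simp
        calc (b : ℝ) = Real.exp (M / 20 - 4) * (b * δ) := by
              linear_combination -(b : ℝ) * h7
          _ ≤ _ := by gcongr
      linarith) (T := T - 1) (by
      have h3 : Real.log ((H ^ 2 : Fin 3 → ℝ) 0 / (G ^ 2 * c.unitSq D' r : Fin 3 → ℝ) 0) =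
          -(2 * (Real.log (G 0 / H 0) + D' * c.logT + r * c.eta)) := by
        rw [Pi.mul_apply, Pi.pow_apply, Pi.pow_apply, c.exp_log_form hG0 hH0,
          div_mul_cancel_left₀ (pow_ne_zero 2 hH0), Real.log_inv, Real.log_exp]
      rw [h3, hX', hlogA]
      have h4 : b * (2 * (s * θ)) - -(2 * (Real.log (G 0 / H 0) + D * c.logT + E * c.eta - E' * θ)) =
          2 * (Real.log (G 0 / H 0) + D * c.logT + E * c.eta) := by
        rw [← hsbr]; ring
      rw [h4, abs_mul, abs_two]
      have h5 : Real.exp (-(T - 1)) = Real.exp 1 * Real.exp (-T) := by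
        rw [← Real.exp_add]; congr 1; ring
      rw [h5]
      have := Real.add_one_le_exp (1 : ℝ)
      exact mul_le_mul (by linarith) hT (abs_nonneg _) (Real.exp_pos _).le)
  refine hlog.trans ?_
  gcongr

end SimplestCubic

/-- A lower bound for linear forms in three logarithms, two of which belong to units of a simplest
cubic field. -/
theorem SimplestCubic.exists_linear_form_bound {ε : ℝ} (hε : 0 < ε) :
    ∃ C : ℝ, 0 < C ∧ ∀ (c : SimplestCubic) (G H : Fin 3 → ℝ) (h : ℝ) (D E : ℤ) (T : ℝ),
      G ∈ c.order → H ∈ c.order → c.ht ≤ h → (∀ i, |G i| ≤ Real.exp h) →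
      (∀ i, |H i| ≤ Real.exp h) → G 0 ≠ 0 → H 0 ≠ 0 →
      Real.log (G 0 / H 0) + D * c.logT + E * c.eta ≠ 0 → 0 ≤ T →
      |Real.log (G 0 / H 0) + D * c.logT + E * c.eta| ≤ Real.exp (-T) →
      ε * |(E : ℝ)| ≤ T * c.ht ^ 3 → T ≤ C * c.ht ^ 2 * h := by
  obtain ⟨M0, hM0, hM0'⟩ := exists_pow_fifteen_mul_exp_le (60000 + 392000000 * 4096 / ε)
  obtain ⟨Q, hQ, hQ'⟩ := SimplestCubic.exists_small_combination hM0
  have hM0r : (80 : ℝ) ≤ M0 := by exact_mod_cast hM0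
  have hQr : (1 : ℝ) ≤ Q := by exact_mod_cast hQ
  refine ⟨130 + 16000000 * M0 * Q ^ 2 + 28000000 * 228 * M0 ^ 3 * Q ^ 2, by positivity,
    fun c G H h D E T hG hH hh hGb hHb hG0 hH0 hX0 hT0 hT hE => ?_⟩
  have hht := c.one_le_ht
  have hh1 : 1 ≤ h := hht.trans hh
  obtain ⟨k, hk0, hk1, hk2⟩ := exists_nat_cube_le hht
  have hkr : (1 : ℝ) ≤ k := by exact_mod_cast hk0
  obtain ⟨p, q, hq1, hqQ, hθ⟩ := hQ' c k hk0 hk1 hk2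
  set M := M0 * k with hM
  have hMM0 : M0 ≤ M := Nat.le_mul_of_pos_right _ hk0
  set δ := Real.exp (4 - M / 20) with hδ
  have hδpos : 0 < δ := Real.exp_pos _
  have hsmall := hM0' M hMM0
  rw [← hδ] at hsmall
  have hMr : (1 : ℝ) ≤ M := by
    have : (M0 : ℝ) ≤ M := by exact_mod_cast hMM0
    linarith
  have hM15 : (M : ℝ) ≤ M ^ 15 := le_self_pow₀ hMr (by norm_num)
  have hs1 : 60000 * M * δ ≤ 1 / 2 := by
    refine le_trans ?_ hsmall
    gcongr
    have : 0 ≤ 392000000 * 4096 / ε := by positivity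
    linarith
  have hs2 : 392000000 * 4096 / ε * M ^ 15 * δ ≤ 1 / 2 := by
    refine le_trans ?_ hsmall
    gcongr
    linarith
  have hqr : (1 : ℝ) ≤ q := by exact_mod_cast hq1
  have hqQr : (q : ℝ) ≤ Q := by exact_mod_cast hqQ
  have hk3 : (k : ℝ) ≤ k ^ 3 := le_self_pow₀ hkr (by norm_num)
  have hMle : (M : ℝ) ≤ M0 * c.ht := by
    rw [hM]; push_cast; gcongr; linarith
  have hM3le : (M : ℝ) ^ 3 ≤ M0 ^ 3 * c.ht := by
    rw [hM]; push_cast; rw [mul_pow]; gcongr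
  have hz : (0 : ℝ) ≤ c.ht ^ 2 * h := by positivity
  have hz1 : h ≤ c.ht ^ 2 * h := le_mul_of_one_le_left (by linarith) (one_le_pow₀ hht)
  rcases c.two_log_step hG hH hh hGb hHb hG0 hH0 (hM0.trans hMM0) hδ hs1 hq1 hθ hT0 hT with
    hEb | ⟨b, hb0, hqb, hTb⟩
  · have h1 := c.liouville hG hH hh1 hGb hHb hG0 hH0 hX0 hT
    have h2 : |(E : ℝ)| * c.ht ≤ 500000 * M0 * Q ^ 2 * (c.ht ^ 2 * h) := by
      calc |(E : ℝ)| * c.ht ≤ Q * (500000 * (M0 * c.ht) * Q * h) * c.ht := by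
            gcongr
            refine hEb.trans ?_
            gcongr
        _ = _ := by ring
    have h3 : 0 ≤ 28000000 * 228 * M0 ^ 3 * Q ^ 2 * (c.ht ^ 2 * h) := by positivity
    nlinarith only [h1, h2, h3, hz1]
  · have hEε : |(E : ℝ)| ≤ T * c.ht ^ 3 / ε := by rw [le_div_iff₀ hε]; linarith
    have hδ1 : δ ≤ 1 := by nlinarith only [hs1, hMr, hδpos]
    have h1 : 1000000 * (M : ℝ) ^ 3 * (28 * q * c.ht) * (100 * q * h + 14 * b * δ) ≤
        28000000 * M ^ 3 * c.ht * (114 * Q ^ 2 * h) +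
          392000000 * M ^ 3 * c.ht ^ 4 * δ * T / ε := by
      have e1 : q * (100 * q * h + 14 * b * δ) ≤ 114 * Q ^ 2 * h + 14 * (T * c.ht ^ 3 / ε) * δ := by
        have e2 : (q : ℝ) * b * δ ≤ (T * c.ht ^ 3 / ε + q) * δ := by gcongr; linarith
        have e3 : (q : ℝ) * δ ≤ Q ^ 2 * h := by
          calc (q : ℝ) * δ ≤ Q * 1 := by gcongr
            _ ≤ Q * (Q * h) := by
              gcongr; exact one_le_mul_of_one_le_of_one_le hQr hh1
            _ = _ := by ring
        have e4 : (q : ℝ) * q * h ≤ Q ^ 2 * h := by rw [sq]; gcongr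
        linarith
      calc _ = 28000000 * (M : ℝ) ^ 3 * c.ht * (q * (100 * q * h + 14 * b * δ)) := by ring
        _ ≤ 28000000 * (M : ℝ) ^ 3 * c.ht * (114 * Q ^ 2 * h + 14 * (T * c.ht ^ 3 / ε) * δ) := by
          gcongr
        _ = _ := by ring
    have h2 : 392000000 * (M : ℝ) ^ 3 * c.ht ^ 4 * δ * T / ε ≤ 1 / 2 * T := by
      have e1 : c.ht ≤ 8 * (M : ℝ) ^ 3 := by
        refine hk2.trans ?_
        have : k ≤ M := Nat.le_mul_of_pos_left _ (by omega)
        have : (k : ℝ) ≤ M := by exact_mod_cast this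
        gcongr
      have e2 : c.ht ^ 4 ≤ (8 * (M : ℝ) ^ 3) ^ 4 := by gcongr
      calc 392000000 * (M : ℝ) ^ 3 * c.ht ^ 4 * δ * T / ε
          ≤ 392000000 * (M : ℝ) ^ 3 * (8 * (M : ℝ) ^ 3) ^ 4 * δ * T / ε := by gcongr
        _ = 392000000 * 4096 / ε * M ^ 15 * δ * T := by ring
        _ ≤ _ := by gcongr
    have h3 : 28000000 * (M : ℝ) ^ 3 * c.ht * (114 * Q ^ 2 * h) ≤
        28000000 * (M0 ^ 3 * c.ht) * c.ht * (114 * Q ^ 2 * h) := by gcongr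
    have h4 : 0 ≤ 16000000 * M0 * Q ^ 2 * (c.ht ^ 2 * h) := by positivity
    have h5 : T ≤ 2 + 28000000 * 228 * M0 ^ 3 * Q ^ 2 * (c.ht ^ 2 * h) := by
      nlinarith only [hTb, h1, h2, h3]
    nlinarith only [h5, h4, hz1, hh1]

lemma abs_log_one_add_le {ε : ℝ} (hε : |ε| ≤ 1 / 2) : |Real.log (1 + ε)| ≤ 2 * |ε| := by
  have h1 := abs_le.1 hε
  have hpos : 0 < 1 + ε := by linarith
  have h2 := Real.log_le_sub_one_of_pos hpos
  have h3 := Real.one_sub_inv_le_log_of_pos hpos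
  have h4 : -(2 * |ε|) ≤ 1 - (1 + ε)⁻¹ := by
    have h5 : 1 - (1 + ε)⁻¹ = ε / (1 + ε) := by field_simp; ring
    rw [h5, le_div_iff₀ hpos]
    rcases abs_cases ε with ⟨h, _⟩ | ⟨h, _⟩ <;> rw [h] <;> nlinarith
  rw [abs_le]
  constructor
  · linarith
  · have := le_abs_self ε
    have := abs_nonneg ε
    linarith

lemma exp_neg_ten_lt : Real.exp (-10) < 1 / 1024 := by
  have h1 := Real.exp_neg_one_lt_half
  have h2 : Real.exp (-10) = Real.exp (-1) ^ 10 := by rw [← Real.exp_nat_mul]; norm_num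
  rw [h2]
  calc _ < (1 / 2 : ℝ) ^ 10 := by gcongr
    _ = _ := by norm_num

lemma mul_mul_shift (v : Fin 3 → ℝ) (i : Fin 3) : v i * v (i + 1) * v (i + 2) = v 0 * v 1 * v 2 := by
  fin_cases i
  · rfl
  · change v 1 * v 2 * v 0 = _; ring
  · change v 2 * v 0 * v 1 = _; ring

namespace SimplestCubic
variable (c : SimplestCubic)

/-- `w` is the index among `u` and `v` of the dominant conjugate. -/
def Dominant (u v w : Fin 3) : Prop := (w = u ∧ c.e v < c.e u) ∨ (w = v ∧ c.e u < c.e v)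

lemma e_zero : c.e 0 = c.logT := rfl
lemma e_one : c.e 1 = c.eta := rfl
lemma e_two : c.e 2 = -c.logT - c.eta := rfl

lemma e_ne {u v : Fin 3} (h : u ≠ v) : c.e u ≠ c.e v := fun h0 => by
  have := c.abs_e_sub_ge h
  rw [h0, sub_self, abs_zero] at this
  linarith [c.one_le_ht]

lemma exists_dominant {u v : Fin 3} (h : u ≠ v) : ∃ w, c.Dominant u v w := by
  rcases lt_or_gt_of_ne (c.e_ne h) with h1 | h1
  · exact ⟨v, Or.inr ⟨rfl, h1⟩⟩
  · exact ⟨u, Or.inl ⟨rfl, h1⟩⟩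

lemma Dominant.nonneg {c : SimplestCubic} {u v w : Fin 3} (h : c.Dominant u v w) : 0 ≤ c.e w := by
  have h1 := c.logT_ge
  have h2 := c.eta_pos
  have h0 := c.e_zero
  have h1' := c.e_one
  have h2' := c.e_two
  rcases h with ⟨hw, h⟩ | ⟨hw, h⟩ <;> rw [hw] <;> clear hw <;> revert h <;>
    fin_cases u <;> fin_cases v <;> simp only [Fin.zero_eta, Fin.mk_one, Fin.reduceFinMk] <;>
    intro h <;> linarith

lemma Dominant.add_ge {c : SimplestCubic} {i w₁ w₂ : Fin 3} (h₁ : c.Dominant i (i + 1) w₁)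
    (h₂ : c.Dominant i (i + 2) w₂) : c.ht / 7 ≤ c.e w₁ + c.e w₂ := by
  have h1 := c.logT_ge
  have h2 := c.eta_pos
  have h3 := c.ht_le
  have h0 := c.e_zero
  have h1' := c.e_one
  have h2' := c.e_two
  have a1 : (2 : Fin 3) + 1 = 0 := rfl
  have a2 : (2 : Fin 3) + 2 = 1 := rfl
  have a3 : (1 : Fin 3) + 1 = 2 := rfl
  have a4 : (1 : Fin 3) + 2 = 0 := rfl
  rcases h₁ with ⟨hw₁, g⟩ | ⟨hw₁, g⟩ <;> rcases h₂ with ⟨hw₂, g'⟩ | ⟨hw₂, g'⟩ <;>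
    rw [hw₁, hw₂] <;> clear hw₁ hw₂ <;> revert g g' <;>
    fin_cases i <;>
    simp only [Fin.zero_eta, Fin.mk_one, Fin.reduceFinMk, zero_add, a1, a2, a3, a4] <;>
    intro g g' <;> linarith

lemma abs_lam_pow (i : Fin 3) (a : ℕ) : |c.lam i ^ a| = Real.exp (a * c.e i) := by
  rw [abs_pow, c.abs_lam, ← Real.exp_nat_mul]

lemma lam_pow_ne_zero (i : Fin 3) (a : ℕ) : c.lam i ^ a ≠ 0 := pow_ne_zero _ (c.lam_ne_zero i)

lemma Dominant.abs_log_sub_le {c : SimplestCubic} {u v w : Fin 3} (h : c.Dominant u v w) {a : ℕ}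
    (hU : 200 ≤ a * c.ht) :
    c.lam u ^ a - c.lam v ^ a ≠ 0 ∧
    |Real.log (c.lam u ^ a - c.lam v ^ a) - a * c.e w| ≤ 2 * Real.exp (-(a * c.ht / 20)) ∧
    0.99 * Real.exp (a * c.e w) ≤ |c.lam u ^ a - c.lam v ^ a| := by
  have key : ∀ u v : Fin 3, c.e v < c.e u → c.lam u ^ a - c.lam v ^ a ≠ 0 ∧
    |Real.log (c.lam u ^ a - c.lam v ^ a) - a * c.e u| ≤ 2 * Real.exp (-(a * c.ht / 20)) ∧
    0.99 * Real.exp (a * c.e u) ≤ |c.lam u ^ a - c.lam v ^ a| := by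
    intro u v huv
    have hne : u ≠ v := fun h0 => by rw [h0] at huv; exact lt_irrefl _ huv
    have hgap := c.abs_e_sub_ge hne
    rw [abs_of_pos (by linarith)] at hgap
    set ρ := c.lam v ^ a / c.lam u ^ a with hρ
    have hfac : c.lam u ^ a - c.lam v ^ a = c.lam u ^ a * (1 + -ρ) := by
      rw [hρ]; have := c.lam_pow_ne_zero u a; field_simp; ring
    have hρb : |ρ| ≤ Real.exp (-(a * c.ht / 20)) := by
      rw [hρ, abs_div, c.abs_lam_pow, c.abs_lam_pow, ← Real.exp_sub, Real.exp_le_exp]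
      have := mul_le_mul_of_nonneg_left hgap (Nat.cast_nonneg (α := ℝ) a)
      linarith
    have hr : Real.exp (-(a * c.ht / 20)) ≤ Real.exp (-10) := Real.exp_le_exp.2 (by linarith)
    have h10 := exp_neg_ten_lt
    have hρ' : |-ρ| ≤ 1 / 1024 := by rw [abs_neg]; linarith
    have hpos : 0.99 ≤ 1 + -ρ := by have := (abs_le.1 hρ').1; norm_num at this ⊢; linarith
    have hpos' : 0 < 1 + -ρ := by norm_num at hpos; linarith
    have h1 := abs_log_one_add_le (hρ'.trans (by norm_num))
    rw [hfac]
    refine ⟨mul_ne_zero (c.lam_pow_ne_zero u a) hpos'.ne', ?_, ?_⟩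
    · rw [Real.log_mul (c.lam_pow_ne_zero u a) hpos'.ne', ← Real.log_abs (_ ^ a), c.abs_lam_pow,
        Real.log_exp, add_sub_cancel_left]
      rw [abs_neg] at h1
      linarith
    · rw [abs_mul, c.abs_lam_pow, abs_of_pos hpos', mul_comm]
      gcongr
  rcases h with ⟨rfl, h⟩ | ⟨rfl, h⟩
  · exact key _ _ h
  · rw [← neg_sub, Real.log_neg_eq_log, neg_ne_zero, abs_neg]
    exact key _ _ h

end SimplestCubic

lemma exists_abs_le_half {γ : Fin 3 → ℝ} {m y : ℝ} (hprod : |γ 0 * γ 1 * γ 2| ≤ m)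
    (hy : 8 * m ≤ |y| ^ 3) : ∃ i, |γ i| ≤ |y| / 2 := by
  by_contra! h
  have h0 : 0 ≤ |y| / 2 := by positivity
  have h1 : |y| / 2 * (|y| / 2) * (|y| / 2) < |γ 0 * γ 1 * γ 2| := by
    rw [abs_mul, abs_mul]
    exact mul_lt_mul'' (mul_lt_mul'' (h 0) (h 1) h0 h0) (h 2) (by positivity) h0
  nlinarith only [h1, hprod, hy]

namespace SimplestCubic
variable {c : SimplestCubic}

lemma Dominant.exists_eq_mul {i j w : Fin 3} (h : c.Dominant i j w) {a : ℕ} {x y : ℝ}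
    {γ : Fin 3 → ℝ} (hγ : ∀ t, γ t = x - c.lam t ^ a * y) (hU : 200 ≤ a * c.ht) (hy : 0 < |y|) :
    ∃ ε : ℝ, γ j = (c.lam i ^ a - c.lam j ^ a) * y * (1 + ε) ∧
      ε = γ i / ((c.lam i ^ a - c.lam j ^ a) * y) ∧
      0.99 * Real.exp (a * c.e w) * |y| * |ε| ≤ |γ i| := by
  obtain ⟨hne, -, hge⟩ := h.abs_log_sub_le hU
  have hy0 : y ≠ 0 := abs_pos.1 hy
  refine ⟨γ i / ((c.lam i ^ a - c.lam j ^ a) * y), ?_, rfl, ?_⟩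
  · rw [mul_add, mul_one, mul_div_cancel₀ _ (mul_ne_zero hne hy0), hγ, hγ]; ring
  · rw [abs_div, abs_mul]
    calc _ ≤ |c.lam i ^ a - c.lam j ^ a| * |y| * (|γ i| / (|c.lam i ^ a - c.lam j ^ a| * |y|)) := by
          gcongr
      _ = _ := by
          have : 0 < |c.lam i ^ a - c.lam j ^ a| := abs_pos.2 hne
          field_simp

/-- The size of the three factors of `Fna`, and of the two linear forms in logarithms that they
give rise to, when the factor with index `i` is small. -/
structure SmallFactor (c : SimplestCubic) (a : ℕ) (y m : ℝ) (γ : Fin 3 → ℝ) (i w₁ w₂ : Fin 3) :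
    Prop where
  dom₁ : c.Dominant i (i + 1) w₁
  dom₂ : c.Dominant i (i + 2) w₂
  le_half : |γ i| ≤ |y| / 2
  ge₁ : 0.9 * Real.exp (a * c.e w₁) * |y| ≤ |γ (i + 1)|
  ge₂ : 0.9 * Real.exp (a * c.e w₂) * |y| ≤ |γ (i + 2)|
  form_ne_zero : Real.log (γ (i + 1) / γ (i + 2)) + (Real.log (c.lam i ^ a - c.lam (i + 2) ^ a) -
    Real.log (c.lam i ^ a - c.lam (i + 1) ^ a)) ≠ 0
  form_le : |Real.log (γ (i + 1) / γ (i + 2)) + (Real.log (c.lam i ^ a - c.lam (i + 2) ^ a) -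
    Real.log (c.lam i ^ a - c.lam (i + 1) ^ a))| ≤ 40 * m * Real.exp (-(a * c.ht / 7)) / |y| ^ 3
  form_le' : |Real.log (γ (i + 1) / γ (i + 2)) + (a * c.e w₂ - a * c.e w₁)| ≤
    9 * Real.exp (-(a * c.ht / 20))

lemma exists_smallFactor {a : ℕ} {x y m : ℝ} {γ : Fin 3 → ℝ}
    (hγ : ∀ t, γ t = x - c.lam t ^ a * y) (hU : 200 ≤ a * c.ht)
    (hprod : |γ 0 * γ 1 * γ 2| ≤ m) (hne : ∀ t, γ t ≠ 0) (hm : 1 ≤ m) (hy : 8 * m ≤ |y| ^ 3) :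
    ∃ i w₁ w₂, c.SmallFactor a y m γ i w₁ w₂ := by
  obtain ⟨i, hi⟩ := exists_abs_le_half hprod hy
  have hij : i ≠ i + 1 := by fin_cases i <;> decide
  have hik : i ≠ i + 2 := by fin_cases i <;> decide
  have hjk : i + 1 ≠ i + 2 := by fin_cases i <;> decide
  obtain ⟨w₁, hw₁⟩ := c.exists_dominant hij
  obtain ⟨w₂, hw₂⟩ := c.exists_dominant hik
  have hy0 : 0 < |y| := by
    by_contra! h0
    have : |y| = 0 := le_antisymm h0 (abs_nonneg y)
    rw [this] at hy; norm_num at hy; linarith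
  obtain ⟨ε₁, hε₁, hε₁', hε₁b⟩ := hw₁.exists_eq_mul hγ hU hy0
  obtain ⟨ε₂, hε₂, hε₂', hε₂b⟩ := hw₂.exists_eq_mul hγ hU hy0
  obtain ⟨hne₁, hlog₁, hge₁⟩ := hw₁.abs_log_sub_le hU
  obtain ⟨hne₂, hlog₂, hge₂⟩ := hw₂.abs_log_sub_le hU
  have ha0 : (0 : ℝ) ≤ a := Nat.cast_nonneg a
  set W₁ := Real.exp (a * c.e w₁) with hW₁
  set W₂ := Real.exp (a * c.e w₂) with hW₂
  have hW₁1 : 1 ≤ W₁ := Real.one_le_exp (mul_nonneg ha0 hw₁.nonneg)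
  have hW₂1 : 1 ≤ W₂ := Real.one_le_exp (mul_nonneg ha0 hw₂.nonneg)
  have hWW : Real.exp (a * c.ht / 7) ≤ W₁ * W₂ := by
    rw [hW₁, hW₂, ← Real.exp_add]
    have := mul_le_mul_of_nonneg_left (hw₁.add_ge hw₂) ha0
    exact Real.exp_le_exp.2 (by linarith)
  have hcrude : ∀ W ε : ℝ, 1 ≤ W → 0.99 * W * |y| * |ε| ≤ |γ i| → |ε| ≤ 0.51 := by
    intro W ε hW h
    have h1 : 0.99 * 1 * |y| * |ε| ≤ 0.99 * W * |y| * |ε| := by gcongr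
    have h2 : |y| * (0.99 * |ε|) ≤ |y| * (1 / 2) := by linarith
    have h3 := le_of_mul_le_mul_left h2 hy0
    norm_num at h3 ⊢; linarith
  have hone : ∀ ε δ : ℝ, |ε| ≤ δ → 1 - δ ≤ |1 + ε| := by
    intro ε δ h
    have := (abs_le.1 h).1
    exact (by linarith : 1 - δ ≤ 1 + ε).trans (le_abs_self _)
  have hlow : ∀ (j : Fin 3) (W ε δ : ℝ), 0 ≤ W → δ ≤ 1 → |ε| ≤ δ →
      0.99 * W ≤ |c.lam i ^ a - c.lam j ^ a| →
      γ j = (c.lam i ^ a - c.lam j ^ a) * y * (1 + ε) → 0.99 * W * |y| * (1 - δ) ≤ |γ j| := by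
    intro j W ε δ hW hδ hε hge h
    rw [h, abs_mul, abs_mul]
    have := hone ε δ hε
    gcongr
  have hγ₁ := hlow _ W₁ ε₁ 0.51 (by linarith) (by norm_num) (hcrude W₁ ε₁ hW₁1 hε₁b) hge₁ hε₁
  have hγ₂ := hlow _ W₂ ε₂ 0.51 (by linarith) (by norm_num) (hcrude W₂ ε₂ hW₂1 hε₂b) hge₂ hε₂
  have hγi : |γ i| * (W₁ * W₂ * |y| ^ 2) ≤ 5 * m := by
    have h1 : |γ i| * |γ (i + 1)| * |γ (i + 2)| ≤ m := by
      rw [← abs_mul, ← abs_mul, mul_mul_shift]; exact hprod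
    have h2 : |γ i| * (0.99 * W₁ * |y| * (1 - 0.51)) * (0.99 * W₂ * |y| * (1 - 0.51)) ≤ m := by
      refine le_trans ?_ h1
      gcongr
    have h3 : 0 ≤ |γ i| * (W₁ * W₂ * |y| ^ 2) := by positivity
    have h4 : |γ i| * (0.99 * W₁ * |y| * (1 - 0.51)) * (0.99 * W₂ * |y| * (1 - 0.51)) =
      (0.99 * (1 - 0.51)) ^ 2 * (|γ i| * (W₁ * W₂ * |y| ^ 2)) := by ring
    rw [h4] at h2
    nlinarith only [h2, h3]
  have hε : ∀ W ε : ℝ, 1 ≤ W → 0.99 * W * |y| * |ε| ≤ |γ i| →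
      |ε| ≤ 6 * m * Real.exp (-(a * c.ht / 7)) / |y| ^ 3 := by
    intro W ε hW h
    rw [le_div_iff₀ (by positivity), Real.exp_neg, ← div_eq_mul_inv, le_div_iff₀ (Real.exp_pos _)]
    have h1 : 0.99 * 1 * |y| * |ε| * (Real.exp (a * c.ht / 7) * |y| ^ 2) ≤
        |γ i| * (W₁ * W₂ * |y| ^ 2) := by
      refine mul_le_mul (le_trans ?_ h) ?_ (by positivity) (by positivity)
      · gcongr
      · gcongr
    have h2 : 0.99 * (|ε| * |y| ^ 3 * Real.exp (a * c.ht / 7)) ≤ 5 * m := by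
      refine le_trans (le_of_eq ?_) (h1.trans hγi); ring
    norm_num at h2; linarith
  have hε₁2 := hε W₁ ε₁ hW₁1 hε₁b
  have hε₂2 := hε W₂ ε₂ hW₂1 hε₂b
  set F := m * Real.exp (-(a * c.ht / 7)) / |y| ^ 3 with hF
  have hF6 : 6 * m * Real.exp (-(a * c.ht / 7)) / |y| ^ 3 = 6 * F := by rw [hF]; ring
  have hF40 : 40 * m * Real.exp (-(a * c.ht / 7)) / |y| ^ 3 = 40 * F := by rw [hF]; ring
  rw [hF6] at hε₁2 hε₂2
  have hFle : 8 * F ≤ Real.exp (-(a * c.ht / 20)) := by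
    have h1 : 8 * F ≤ Real.exp (-(a * c.ht / 7)) := by
      rw [hF, ← mul_div_assoc, div_le_iff₀ (by positivity)]
      have := mul_le_mul_of_nonneg_right hy (Real.exp_pos (-(a * c.ht / 7))).le
      linarith
    refine h1.trans (Real.exp_le_exp.2 ?_)
    linarith
  have hr : Real.exp (-(a * c.ht / 20)) < 1 / 1024 :=
    (Real.exp_le_exp.2 (by linarith)).trans_lt exp_neg_ten_lt
  have hε₁3 : |ε₁| ≤ 0.01 := by norm_num; linarith
  have hε₂3 : |ε₂| ≤ 0.01 := by norm_num; linarith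
  have hp₁ : 0 < 1 + ε₁ := by have := (abs_le.1 hε₁3).1; norm_num at this; linarith
  have hp₂ : 0 < 1 + ε₂ := by have := (abs_le.1 hε₂3).1; norm_num at this; linarith
  have hy' : y ≠ 0 := abs_pos.1 hy0
  have hform : Real.log (γ (i + 1) / γ (i + 2)) + (Real.log (c.lam i ^ a - c.lam (i + 2) ^ a) -
      Real.log (c.lam i ^ a - c.lam (i + 1) ^ a)) = Real.log (1 + ε₁) - Real.log (1 + ε₂) := by
    rw [Real.log_div (hne _) (hne _), hε₁, hε₂, Real.log_mul (mul_ne_zero hne₁ hy') hp₁.ne',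
      Real.log_mul (mul_ne_zero hne₂ hy') hp₂.ne', Real.log_mul hne₁ hy', Real.log_mul hne₂ hy']
    ring
  have hl₁ := abs_log_one_add_le (hε₁3.trans (by norm_num))
  have hl₂ := abs_log_one_add_le (hε₂3.trans (by norm_num))
  have hF0 : 0 ≤ F := by positivity
  have hle : |Real.log (γ (i + 1) / γ (i + 2)) + (Real.log (c.lam i ^ a - c.lam (i + 2) ^ a) -
      Real.log (c.lam i ^ a - c.lam (i + 1) ^ a))| ≤ 40 * F := by
    rw [hform]
    refine (abs_sub _ _).trans ?_
    linarith
  refine ⟨i, w₁, w₂, hw₁, hw₂, hi, ?_, ?_, ?_, ?_, ?_⟩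
  · refine le_trans ?_ (hlow _ W₁ ε₁ 0.01 (by linarith) (by norm_num) hε₁3 hge₁ hε₁)
    have : 0 ≤ W₁ * |y| := by positivity
    norm_num; linarith
  · refine le_trans ?_ (hlow _ W₂ ε₂ 0.01 (by linarith) (by norm_num) hε₂3 hge₂ hε₂)
    have : 0 ≤ W₂ * |y| := by positivity
    norm_num; linarith
  · rw [hform]
    intro h0
    have h1 : 1 + ε₁ = 1 + ε₂ := Real.log_injOn_pos hp₁ hp₂ (sub_eq_zero.1 h0)
    have h2 : ε₁ = ε₂ := by linarith
    rw [hε₁', hε₂', div_eq_div_iff (mul_ne_zero hne₁ hy') (mul_ne_zero hne₂ hy')] at h2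
    have h3 : c.lam (i + 1) ^ a = c.lam (i + 2) ^ a := by
      have := mul_right_cancel₀ hy' (mul_left_cancel₀ (hne i) h2); linarith
    obtain ⟨w₃, hw₃⟩ := c.exists_dominant hjk
    exact (hw₃.abs_log_sub_le hU).1 (sub_eq_zero.2 h3)
  · rw [hF40]; exact hle
  · have h1 := abs_le.1 hle
    have h2 := abs_le.1 hlog₁
    have h3 := abs_le.1 hlog₂
    rw [abs_le]
    constructor <;> linarith

lemma SmallFactor.form_ne_zero' {a : ℕ} {y m : ℝ} {γ : Fin 3 → ℝ} {i w₁ w₂ : Fin 3}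
    (hS : c.SmallFactor a y m γ i w₁ w₂) (hmem : γ ∈ c.order)
    (hprod : |γ 0 * γ 1 * γ 2| ≤ m) (hne : ∀ t, γ t ≠ 0) (hm : 1 ≤ m) (hy : 8 * m ≤ |y| ^ 3) :
    Real.log (γ (i + 1) / γ (i + 2)) + (a * c.e w₂ - a * c.e w₁) ≠ 0 := by
  intro h0
  have hy0 : 0 < |y| := by
    by_contra! h0
    have : |y| = 0 := le_antisymm h0 (abs_nonneg y)
    rw [this] at hy; norm_num at hy; linarith
  have ha0 : (0 : ℝ) ≤ a := Nat.cast_nonneg a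
  have hbase : |γ (i + 1)| * Real.exp (a * c.e w₂) = |γ (i + 2)| * Real.exp (a * c.e w₁) := by
    rw [Real.log_div (hne _) (hne _)] at h0
    rw [← Real.exp_log (abs_pos.2 (hne (i + 1))), ← Real.exp_log (abs_pos.2 (hne (i + 2))),
      Real.log_abs, Real.log_abs, ← Real.exp_add, ← Real.exp_add]
    congr 1; linarith
  have hrel : ∀ t, |γ (t + (i + 1))| * Real.exp (a * c.e (t + w₂)) =
      |γ (t + (i + 2))| * Real.exp (a * c.e (t + w₁)) := by
    have hunit : ∀ s : Fin 3, (fun t => c.lam (t + s) ^ a) ∈ c.order := fun s => by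
      simpa using c.unit_mem s a
    set V : Fin 3 → ℝ := ((fun t => γ (t + (i + 1))) * fun t => c.lam (t + w₂) ^ a) ^ 2 -
      ((fun t => γ (t + (i + 2))) * fun t => c.lam (t + w₁) ^ a) ^ 2 with hV
    have hVm : V ∈ c.order := c.order.sub_mem
      (c.order.pow_mem (c.order.mul_mem (c.shift_mem hmem _) (hunit w₂)) 2)
      (c.order.pow_mem (c.order.mul_mem (c.shift_mem hmem _) (hunit w₁)) 2)
    have hVt : ∀ t, V t = (|γ (t + (i + 1))| * Real.exp (a * c.e (t + w₂))) ^ 2 -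
        (|γ (t + (i + 2))| * Real.exp (a * c.e (t + w₁))) ^ 2 := by
      intro t
      rw [← c.abs_lam_pow, ← c.abs_lam_pow, ← abs_mul, ← abs_mul, sq_abs, sq_abs]
      rfl
    have hV0 : V 0 = 0 := by
      rw [hVt]; simp only [zero_add]; rw [hbase, sub_self]
    intro t
    have h1 := hVt t
    rw [c.eq_zero_of_apply_eq_zero hVm hV0, Pi.zero_apply] at h1
    exact (pow_left_inj₀ (by positivity) (by positivity) two_ne_zero).1 (sub_eq_zero.1 h1.symm)
  have hone : ∀ {w}, 0 ≤ c.e w → 0.9 * |y| ≤ 0.9 * Real.exp (a * c.e w) * |y| := by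
    intro w hw
    have := Real.one_le_exp (mul_nonneg ha0 hw)
    gcongr
    linarith
  have hγ₁ := (hone hS.dom₁.nonneg).trans hS.ge₁
  have hγ₂ := (hone hS.dom₂.nonneg).trans hS.ge₂
  have hi := hS.le_half
  have i3 : 1 + (i + 2) = i := by fin_cases i <;> rfl
  have i4 : 2 + (i + 2) = i + 1 := by fin_cases i <;> rfl
  have i3' : 2 + (i + 1) = i := by fin_cases i <;> rfl
  have i2' : 1 + (i + 1) = i + 2 := by fin_cases i <;> rfl
  have absurd_of_le : ∀ {j s : Fin 3}, 0.9 * |y| ≤ |γ j| → c.e s < c.e i →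
      |γ j| * Real.exp (a * c.e i) = |γ i| * Real.exp (a * c.e s) → False := by
    intro j s hj hs h1
    have h2 : Real.exp (a * c.e s) ≤ Real.exp (a * c.e i) := by
      apply Real.exp_le_exp.2; gcongr
    have h3 : |γ j| * Real.exp (a * c.e i) ≤ |γ i| * Real.exp (a * c.e i) := by
      rw [h1]; gcongr
    have h4 := le_of_mul_le_mul_right h3 (Real.exp_pos _)
    norm_num at hj
    linarith
  have r1 := hrel 1
  have r2 := hrel 2
  rw [i2', i3] at r1
  rw [i3', i4] at r2
  rcases hS.dom₁ with ⟨hw₁, g₁⟩ | ⟨hw₁, g₁⟩ <;> rcases hS.dom₂ with ⟨hw₂, g₂⟩ | ⟨hw₂, g₂⟩ <;>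
    rw [hw₁, hw₂] at r1 r2 hbase
  · have := mul_right_cancel₀ (Real.exp_ne_zero _) r2
    norm_num at hγ₁
    linarith
  · rw [add_comm 2 i] at r2
    exact absurd_of_le hγ₂ g₁ (by rw [← hbase, ← r2, i4])
  · rw [i2', add_comm 1 i] at r1
    exact absurd_of_le hγ₁ g₂ (by rw [hbase, r1])
  · rw [i4, i3'] at r2
    have k1 := hS.ge₁
    have k2 := hS.ge₂
    rw [hw₁] at k1
    rw [hw₂] at k2
    have k0 : 0.9 * Real.exp (a * c.e i) * |y| ≤ |γ i| := by
      refine le_of_mul_le_mul_right ?_ (Real.exp_pos (a * c.e (i + 1)))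
      rw [r2]
      have := mul_le_mul_of_nonneg_right k1 (Real.exp_pos (a * c.e i)).le
      linarith
    have hsum : Real.exp (a * c.e i) * Real.exp (a * c.e (i + 1)) * Real.exp (a * c.e (i + 2)) = 1 := by
      rw [mul_mul_shift (fun i => Real.exp (a * c.e i)), ← Real.exp_add, ← Real.exp_add,
        ← mul_add, ← mul_add, c.sum_e]
      simp
    have h1 : |γ i| * |γ (i + 1)| * |γ (i + 2)| ≤ m := by
      rw [← abs_mul, ← abs_mul, mul_mul_shift]; exact hprod
    have h2 : 0.9 * Real.exp (a * c.e i) * |y| * (0.9 * Real.exp (a * c.e (i + 1)) * |y|) *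
        (0.9 * Real.exp (a * c.e (i + 2)) * |y|) ≤ m := by
      refine le_trans ?_ h1
      gcongr
    have h3 : 0.9 * Real.exp (a * c.e i) * |y| * (0.9 * Real.exp (a * c.e (i + 1)) * |y|) *
        (0.9 * Real.exp (a * c.e (i + 2)) * |y|) = 0.729 * |y| ^ 3 := by
      linear_combination 0.729 * |y| ^ 3 * hsum
    rw [h3] at h2
    linarith

variable (c)
lemma exists_e_coords (s : Fin 3 → ℝ) (hs : s 0 + s 1 + s 2 = 0) {σ : ℝ} (hσ : ∀ t, |s t| ≤ σ) :
    ∃ α β : ℝ, (∀ t, s t = α * c.e t + β * c.e (t + 1)) ∧ |α| * c.ht ≤ 14 * σ ∧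
      |β| * c.ht ≤ 14 * σ := by
  have hL : 0 < c.logT := by linarith [c.logT_ge]
  have hη := c.eta_pos
  have hht := c.ht_le
  have hht0 : 0 ≤ c.ht := by linarith [c.one_le_ht]
  set L := c.logT with hLdef
  set η := c.eta with hηdef
  have hΔ : 0 < L ^ 2 + L * η + η ^ 2 := by positivity
  have hσ0 : 0 ≤ σ := (abs_nonneg _).trans (hσ 0)
  have key : ∀ {p q : ℝ}, |p| ≤ L + η → |q| ≤ L + η →
      |(s 0 * p + s 1 * q) / (L ^ 2 + L * η + η ^ 2)| * c.ht ≤ 14 * σ := by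
    intro p q hp hq
    have h1 : |s 0 * p + s 1 * q| ≤ 2 * σ * (L + η) := by
      calc |s 0 * p + s 1 * q| ≤ |s 0| * |p| + |s 1| * |q| := by
            rw [← abs_mul, ← abs_mul]; exact abs_add_le _ _
        _ ≤ σ * (L + η) + σ * (L + η) := by gcongr <;> exact hσ _
        _ = _ := by ring
    rw [abs_div, abs_of_pos hΔ, div_mul_eq_mul_div, div_le_iff₀ hΔ]
    calc |s 0 * p + s 1 * q| * c.ht ≤ 2 * σ * (L + η) * (7 * L) := by gcongr
      _ = 14 * σ * (L ^ 2 + L * η) := by ring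
      _ ≤ _ := mul_le_mul_of_nonneg_left (by nlinarith only [sq_nonneg η]) (by positivity)
  have h0 : s 0 = (s 0 * (L + η) + s 1 * η) / (L ^ 2 + L * η + η ^ 2) * L +
      (s 0 * η + s 1 * -L) / (L ^ 2 + L * η + η ^ 2) * η := by field_simp; ring
  have h1 : s 1 = (s 0 * (L + η) + s 1 * η) / (L ^ 2 + L * η + η ^ 2) * η +
      (s 0 * η + s 1 * -L) / (L ^ 2 + L * η + η ^ 2) * (-L - η) := by field_simp; ring
  refine ⟨(s 0 * (L + η) + s 1 * η) / (L ^ 2 + L * η + η ^ 2),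
    (s 0 * η + s 1 * -L) / (L ^ 2 + L * η + η ^ 2), fun t => ?_, key ?_ ?_, key ?_ ?_⟩
  · generalize (s 0 * (L + η) + s 1 * η) / (L ^ 2 + L * η + η ^ 2) = α at h0 h1 ⊢
    generalize (s 0 * η + s 1 * -L) / (L ^ 2 + L * η + η ^ 2) = β at h0 h1 ⊢
    fin_cases t
    · exact h0
    · exact h1
    · change s 2 = α * (-L - η) + β * L
      linear_combination hs - h0 - h1
  all_goals rw [abs_le]; constructor <;> linarith

/-- Every element of the order is, up to a unit, of size comparable to its norm. -/
lemma exists_unit_decomposition {γ : Fin 3 → ℝ} {S l : ℝ} (hmem : γ ∈ c.order)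
    (hne : ∀ t, γ t ≠ 0) (hk : Real.log |γ 0 * γ 1 * γ 2| ≤ l)
    (hS : ∀ t, |Real.log (γ t)| ≤ S) :
    ∃ (A B : ℤ) (ζ : Fin 3 → ℝ), ζ ∈ c.order ∧ (∀ t, ζ t ≠ 0) ∧
      (∀ t, |ζ t| ≤ Real.exp (l + c.ht)) ∧
      (∀ t, Real.log |γ t| = Real.log |ζ t| + A * c.e t + B * c.e (t + 1)) ∧
      |(A : ℝ)| * c.ht ≤ 28 * S + c.ht ∧ |(B : ℝ)| * c.ht ≤ 28 * S + c.ht := by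
  set k := Real.log |γ 0 * γ 1 * γ 2| with hkdef
  have hk0 : 0 ≤ k := Real.log_nonneg (c.one_le_abs_norm hmem (hne 0))
  have hksum : k = Real.log |γ 0| + Real.log |γ 1| + Real.log |γ 2| := by
    rw [hkdef, abs_mul, abs_mul, Real.log_mul, Real.log_mul] <;>
      simp [hne]
  have hS' : ∀ t, -S ≤ Real.log |γ t| ∧ Real.log |γ t| ≤ S := fun t => by
    rw [Real.log_abs]; exact abs_le.1 (hS t)
  obtain ⟨α, β, hs, hα, hβ⟩ := c.exists_e_coords (fun t => Real.log |γ t| - k / 3)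
    (by linarith) (σ := 2 * S) (fun t => by
      have h0 := hS' 0
      have h1 := hS' 1
      have h2 := hS' 2
      have ht := hS' t
      rw [abs_le]; constructor <;> linarith)
  have hht := c.one_le_ht
  have hround : ∀ x : ℝ, |x| * c.ht ≤ 14 * (2 * S) → |(round x : ℝ)| * c.ht ≤ 28 * S + c.ht := by
    intro x hx
    have h1 := abs_sub_round x
    have h2 : |(round x : ℝ)| ≤ |x| + 1 := by
      have := abs_sub_abs_le_abs_sub (round x : ℝ) x
      rw [abs_sub_comm] at this
      linarith
    calc |(round x : ℝ)| * c.ht ≤ (|x| + 1) * c.ht := by gcongr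
      _ ≤ _ := by linarith
  have hlog : ∀ t, Real.log |γ t * (c.lam (t + 0) ^ (-round α) * c.lam (t + 1) ^ (-round β))| =
      Real.log |γ t| - round α * c.e t - round β * c.e (t + 1) := by
    intro t
    rw [abs_mul, c.abs_lam_zpow_mul, Real.log_mul (abs_ne_zero.2 (hne t)) (Real.exp_ne_zero _),
      Real.log_exp, add_zero]
    push_cast; ring
  have hne' : ∀ t, γ t * (c.lam (t + 0) ^ (-round α) * c.lam (t + 1) ^ (-round β)) ≠ 0 := fun t =>
    mul_ne_zero (hne t) (mul_ne_zero (zpow_ne_zero _ (c.lam_ne_zero _))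
      (zpow_ne_zero _ (c.lam_ne_zero _)))
  refine ⟨round α, round β, _, c.order.mul_mem hmem (c.order.mul_mem
    (c.unit_mem 0 (-round α)) (c.unit_mem 1 (-round β))), hne', fun t => ?_, fun t => ?_,
    hround _ hα, hround _ hβ⟩
  · refine (Real.log_le_iff_le_exp (abs_pos.2 (hne' t))).1 ?_
    refine (hlog t).le.trans ?_
    have h1 : (α - round α) * c.e t ≤ 1 / 2 * c.ht := by
      refine (le_abs_self _).trans ?_
      rw [abs_mul]
      exact mul_le_mul (abs_sub_round α) (c.abs_e_le t) (abs_nonneg _) (by norm_num)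
    have h2 : (β - round β) * c.e (t + 1) ≤ 1 / 2 * c.ht := by
      refine (le_abs_self _).trans ?_
      rw [abs_mul]
      exact mul_le_mul (abs_sub_round β) (c.abs_e_le _) (abs_nonneg _) (by norm_num)
    have h3 := hs t
    linarith
  · have := hlog t
    refine Eq.trans ?_ (congrArg₂ (· + ·) (congrArg₂ (· + ·) this.symm rfl) rfl)
    ring

variable {c}
/-- `X` is an integral combination of `logT` and `eta`, with the coefficient of `eta` bounded
by `Q`. -/
def IsUnitLog (c : SimplestCubic) (X Q : ℝ) : Prop :=
  ∃ D E : ℤ, X = D * c.logT + E * c.eta ∧ |(E : ℝ)| ≤ Q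

lemma isUnitLog_e (c : SimplestCubic) (s : Fin 3) : c.IsUnitLog (c.e s) 1 := by
  fin_cases s
  · exact ⟨1, 0, by simp [e], by simp⟩
  · exact ⟨0, 1, by simp [e], by simp⟩
  · exact ⟨-1, -1, by simp [e]; ring, by simp⟩

lemma IsUnitLog.add {X Q Y R : ℝ} (hX : c.IsUnitLog X Q) (hY : c.IsUnitLog Y R) :
    c.IsUnitLog (X + Y) (Q + R) := by
  obtain ⟨D, E, rfl, h⟩ := hX
  obtain ⟨D', E', rfl, h'⟩ := hY
  refine ⟨D + D', E + E', by push_cast; ring, ?_⟩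
  push_cast
  exact (abs_add_le _ _).trans (add_le_add h h')

lemma IsUnitLog.int_mul {X Q : ℝ} (hX : c.IsUnitLog X Q) (k : ℤ) :
    c.IsUnitLog (k * X) (|(k : ℝ)| * Q) := by
  obtain ⟨D, E, rfl, h⟩ := hX
  refine ⟨k * D, k * E, by push_cast; ring, ?_⟩
  push_cast
  rw [abs_mul]
  gcongr

lemma isUnitLog_int_mul_e_sub (c : SimplestCubic) (k : ℤ) (u v : Fin 3) :
    c.IsUnitLog (k * c.e u - k * c.e v) (2 * |(k : ℝ)|) := by
  have := ((c.isUnitLog_e u).int_mul k).add ((c.isUnitLog_e v).int_mul (-k))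
  convert! this using 1
  · push_cast; ring
  · push_cast; rw [abs_neg]; ring

theorem exists_isUnitLog_bound {ε : ℝ} (hε : 0 < ε) :
    ∃ C : ℝ, 0 < C ∧ ∀ (c : SimplestCubic) (G H : Fin 3 → ℝ) (h X Q T : ℝ),
      G ∈ c.order → H ∈ c.order → c.ht ≤ h → (∀ i, |G i| ≤ Real.exp h) →
      (∀ i, |H i| ≤ Real.exp h) → G 0 ≠ 0 → H 0 ≠ 0 → c.IsUnitLog X Q →
      Real.log (G 0 / H 0) + X ≠ 0 → 0 ≤ T → |Real.log (G 0 / H 0) + X| ≤ Real.exp (-T) →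
      ε * Q ≤ T * c.ht ^ 3 → T ≤ C * c.ht ^ 2 * h := by
  obtain ⟨C, hC, H⟩ := exists_linear_form_bound hε
  refine ⟨C, hC, ?_⟩
  rintro c G H' h X Q T hG hH hh hGh hHh hG0 hH0 ⟨D, E, rfl, hE⟩ hne hT hle hεT
  rw [← add_assoc] at hne hle
  exact H c G H' h D E T hG hH hh hGh hHh hG0 hH0 hne hT hle
    ((mul_le_mul_of_nonneg_left hE hε.le).trans hεT)

lemma exp_mul_e_le {a : ℕ} (t : Fin 3) : Real.exp (a * c.e t) ≤ Real.exp (a * c.ht) := by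
  have := (le_abs_self _).trans (c.abs_e_le t)
  gcongr

lemma abs_lam_pow_sub_le {a : ℕ} (u v : Fin 3) :
    |c.lam u ^ a - c.lam v ^ a| ≤ 2 * Real.exp (a * c.ht) := by
  refine (abs_sub _ _).trans ?_
  rw [c.abs_lam_pow, c.abs_lam_pow]
  linarith [c.exp_mul_e_le (a := a) u, c.exp_mul_e_le (a := a) v]

lemma abs_log_le_of_le_half {a : ℕ} {x y : ℝ} {γ : Fin 3 → ℝ} {i : Fin 3}
    (hγ : ∀ t, γ t = x - c.lam t ^ a * y) (hmem : γ ∈ c.order) (hne : ∀ t, γ t ≠ 0)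
    (hi : |γ i| ≤ |y| / 2) (hU : 200 ≤ a * c.ht) (hy : 0 ≤ Real.log |y|) (t : Fin 3) :
    |Real.log (γ t)| ≤ 4 * (a * c.ht) + 2 * Real.log |y| := by
  have hy0 : 0 < |y| := by
    have := abs_pos.2 (hne i)
    linarith
  have hup : ∀ s, Real.log (γ s) ≤ 2 * (a * c.ht) + Real.log |y| := by
    intro s
    have h1 : |γ s| ≤ 3 * Real.exp (a * c.ht) * |y| := by
      have e1 : γ s = γ i + (c.lam i ^ a - c.lam s ^ a) * y := by rw [hγ, hγ]; ring
      have e2 : 1 ≤ Real.exp (a * c.ht) := Real.one_le_exp (by linarith)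
      calc |γ s| ≤ |γ i| + |c.lam i ^ a - c.lam s ^ a| * |y| := by
            rw [e1, ← abs_mul]; exact abs_add_le _ _
        _ ≤ 1 * |y| + 2 * Real.exp (a * c.ht) * |y| := by
            gcongr
            · linarith
            · exact c.abs_lam_pow_sub_le _ _
        _ ≤ Real.exp (a * c.ht) * |y| + 2 * Real.exp (a * c.ht) * |y| := by gcongr
        _ = _ := by ring
    have h2 := Real.log_le_log (abs_pos.2 (hne s)) h1
    rw [Real.log_abs, Real.log_mul (by positivity) hy0.ne', Real.log_mul (by norm_num)
      (Real.exp_ne_zero _), Real.log_exp] at h2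
    have h3 := Real.log_le_sub_one_of_pos (show (0 : ℝ) < 3 by norm_num)
    linarith
  have hsum : 0 ≤ Real.log (γ 0) + Real.log (γ 1) + Real.log (γ 2) := by
    rw [← Real.log_mul (hne 0) (hne 1), ← Real.log_mul (mul_ne_zero (hne 0) (hne 1)) (hne 2),
      ← Real.log_abs]
    exact Real.log_nonneg (c.one_le_abs_norm hmem (hne 0))
  have h0 := hup 0
  have h1 := hup 1
  have h2 := hup 2
  rw [abs_le]
  fin_cases t <;> constructor <;> simp only [Fin.zero_eta, Fin.mk_one, Fin.reduceFinMk] <;> linarith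

theorem exists_exponent_bound :
    ∃ C : ℝ, 0 < C ∧ ∀ (c : SimplestCubic) (a : ℕ) (x y m : ℝ) (γ : Fin 3 → ℝ),
      γ ∈ c.order → (∀ t, γ t = x - c.lam t ^ a * y) → (∀ t, γ t ≠ 0) →
      |γ 0 * γ 1 * γ 2| ≤ m → 1 ≤ m → 8 * m ≤ |y| ^ 3 →
      a ≤ C * c.ht * (Real.log m + c.ht) := by
  obtain ⟨C₂, hC₂, bound₂⟩ := exists_isUnitLog_bound (ε := 1 / 5000) (by norm_num)
  set K := 500 * (1 + 4 * C₂) with hK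
  have hK0 : 0 < K := by positivity
  obtain ⟨C₁, hC₁, bound₁⟩ := exists_isUnitLog_bound (ε := 1 / (40 * (K + 2))) (by positivity)
  refine ⟨2000 + 40 * C₁, by positivity, ?_⟩
  intro c a x y m γ hmem hγ hne hprod hm hy
  have hht := c.one_le_ht
  have hl : 0 ≤ Real.log m := Real.log_nonneg hm
  by_cases ha : (a : ℝ) ≤ 2000 * (Real.log m + 1)
  · calc (a : ℝ) ≤ 2000 * 1 * (Real.log m + 1) := by linarith
      _ ≤ (2000 + 40 * C₁) * c.ht * (Real.log m + c.ht) := by gcongr; linarith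
  push Not at ha
  set l := Real.log m with hldef
  have haU : (a : ℝ) ≤ a * c.ht := le_mul_of_one_le_right (Nat.cast_nonneg a) hht
  have htU : c.ht ≤ a * c.ht := le_mul_of_one_le_left (by linarith) (by linarith)
  set U := a * c.ht with hUdef
  have hU : 200 ≤ U := by linarith
  have hy0 : 0 < |y| := by
    by_contra! h0
    have : |y| = 0 := le_antisymm h0 (abs_nonneg y)
    rw [this] at hy; norm_num at hy; linarith
  have hY : 0 ≤ Real.log |y| := by
    refine Real.log_nonneg ?_
    by_contra! h1
    have := pow_le_one₀ (n := 3) hy0.le h1.le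
    linarith
  obtain ⟨i, w₁, w₂, hS⟩ := exists_smallFactor hγ hU hprod hne hm hy
  have hne₁ := hS.form_ne_zero' hmem hprod hne hm hy
  have hprodpos : 0 < |γ 0 * γ 1 * γ 2| :=
    abs_pos.2 (mul_ne_zero (mul_ne_zero (hne 0) (hne 1)) (hne 2))
  obtain ⟨A, B, ζ, hζmem, hζne, hζle, hζ, hA, hB⟩ := c.exists_unit_decomposition hmem hne
    (Real.log_le_log hprodpos hprod)
    (abs_log_le_of_le_half hγ hmem hne hS.le_half hU hY)
  rw [← hldef] at hζle
  rw [← hUdef] at hA hB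
  set Y := Real.log |y| with hYdef
  set X := (A * c.e (i + 1) - A * c.e (i + 2)) + (B * c.e (i + 1 + 1) - B * c.e (i + 2 + 1)) with hX
  set Q := 2 * |(A : ℝ)| + 2 * |(B : ℝ)| with hQ
  have hXQ : c.IsUnitLog X Q := (c.isUnitLog_int_mul_e_sub A _ _).add (c.isUnitLog_int_mul_e_sub B _ _)
  have hQle : Q * c.ht ≤ 500 * (U + Y) := by rw [hQ]; linarith
  have hlogγ : Real.log (γ (i + 1) / γ (i + 2)) = Real.log (ζ (i + 1) / ζ (i + 2)) + X := by
    have h1 := hζ (i + 1)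
    have h2 := hζ (i + 2)
    rw [Real.log_abs, Real.log_abs] at h1 h2
    rw [Real.log_div (hne _) (hne _), Real.log_div (hζne _) (hζne _), h1, h2, hX]
    ring
  have hYU : Y ≤ 4 * C₂ * c.ht ^ 2 * U := by
    have hsub : ∀ {u v w : Fin 3}, c.Dominant u v w → c.lam u ^ a - c.lam v ^ a ≠ 0 := fun h =>
      (h.abs_log_sub_le hU).1
    have hpow : ∀ u : Fin 3, (fun t => c.lam (t + u) ^ a) ∈ c.order := fun u => by
      simpa using c.unit_mem u a
    have hmem' : ∀ u v : Fin 3, (fun t => ζ (t + u) * (c.lam (t + i) ^ a - c.lam (t + v) ^ a)) ∈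
        c.order := fun u v =>
      c.order.mul_mem (c.shift_mem hζmem u) (c.order.sub_mem (hpow i) (hpow v))
    have hsize : ∀ (u v t : Fin 3), |ζ (t + u) * (c.lam (t + i) ^ a - c.lam (t + v) ^ a)| ≤
        Real.exp (l + 3 * U) := by
      intro u v t
      have h2 : (2 : ℝ) ≤ Real.exp 1 := by linarith [Real.add_one_le_exp (1 : ℝ)]
      calc |ζ (t + u) * (c.lam (t + i) ^ a - c.lam (t + v) ^ a)|
          ≤ Real.exp (l + c.ht) * (Real.exp 1 * Real.exp U) := by
            rw [abs_mul]
            gcongr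
            · exact hζle _
            · exact (c.abs_lam_pow_sub_le _ _).trans (by rw [← hUdef]; gcongr)
        _ = Real.exp (l + c.ht + (1 + U)) := by rw [Real.exp_add, Real.exp_add]; simp only [Real.exp_add]
        _ ≤ _ := by apply Real.exp_le_exp.2; linarith
    have hform : Real.log ((ζ (0 + (i + 1)) * (c.lam (0 + i) ^ a - c.lam (0 + (i + 2)) ^ a)) /
        (ζ (0 + (i + 2)) * (c.lam (0 + i) ^ a - c.lam (0 + (i + 1)) ^ a))) + X =
        Real.log (γ (i + 1) / γ (i + 2)) + (Real.log (c.lam i ^ a - c.lam (i + 2) ^ a) -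
          Real.log (c.lam i ^ a - c.lam (i + 1) ^ a)) := by
      simp only [zero_add]
      have n1 := hsub hS.dom₁
      have n2 := hsub hS.dom₂
      rw [hlogγ, Real.log_div (mul_ne_zero (hζne _) n2) (mul_ne_zero (hζne _) n1),
        Real.log_mul (hζne _) n2, Real.log_mul (hζne _) n1, Real.log_div (hζne _) (hζne _)]
      ring
    have hT := bound₂ c _ _ (l + 3 * U) X Q (U / 10 + 3 * Y) (hmem' (i + 1) (i + 2))
      (hmem' (i + 2) (i + 1)) (by linarith) (hsize _ _) (hsize _ _)
      (by simpa using! ⟨hζne _, hsub hS.dom₂⟩) (by simpa using! ⟨hζne _, hsub hS.dom₁⟩)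
      hXQ (by rw [hform]; exact hS.form_ne_zero) (by linarith) ?_ ?_
    · have h1 : C₂ * c.ht ^ 2 * (l + 3 * U) ≤ C₂ * c.ht ^ 2 * (4 * U) := by gcongr; linarith
      linarith
    · rw [hform]
      refine hS.form_le.trans ?_
      have h40 : (40 : ℝ) ≤ Real.exp 6 := by
        have h2 : (2 : ℝ) ≤ Real.exp 1 := by linarith [Real.add_one_le_exp (1 : ℝ)]
        have h3 : Real.exp 6 = Real.exp 1 ^ 6 := by rw [← Real.exp_nat_mul]; norm_num
        rw [h3]
        calc (40 : ℝ) ≤ 2 ^ 6 := by norm_num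
          _ ≤ _ := by gcongr
      have hmexp : m = Real.exp l := (Real.exp_log (by linarith)).symm
      have hyexp : |y| = Real.exp Y := (Real.exp_log hy0).symm
      rw [hmexp, hyexp, ← Real.exp_nat_mul, div_le_iff₀ (Real.exp_pos _), ← Real.exp_add]
      calc 40 * Real.exp l * Real.exp (-(a * c.ht / 7))
          ≤ Real.exp 6 * Real.exp l * Real.exp (-(a * c.ht / 7)) := by gcongr
        _ = Real.exp (6 + l - U / 7) := by rw [← Real.exp_add, ← Real.exp_add]; congr 1
        _ ≤ _ := by apply Real.exp_le_exp.2; push_cast; linarith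
    · have h1 : Q ≤ Q * c.ht := le_mul_of_one_le_right (by positivity) hht
      have h2 : U / 10 + 3 * Y ≤ (U / 10 + 3 * Y) * c.ht ^ 3 :=
        le_mul_of_one_le_right (by linarith) (one_le_pow₀ hht)
      linarith
  have hQa : Q ≤ K * c.ht ^ 2 * a := by
    refine le_of_mul_le_mul_right ?_ (show 0 < c.ht by linarith)
    have h1 : 1 * U ≤ c.ht ^ 2 * U := by gcongr; exact one_le_pow₀ hht
    have h2 : K * c.ht ^ 2 * a * c.ht = 500 * (c.ht ^ 2 * U) + 500 * (4 * C₂ * c.ht ^ 2 * U) := by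
      rw [hK, hUdef]; ring
    rw [h2]; linarith
  have hform : Real.log (ζ (0 + (i + 1)) / ζ (0 + (i + 2))) + (X + (a * c.e w₂ - a * c.e w₁)) =
      Real.log (γ (i + 1) / γ (i + 2)) + (a * c.e w₂ - a * c.e w₁) := by
    rw [hlogγ, zero_add, zero_add]; ring
  have hT := bound₁ c _ _ (l + c.ht) (X + (a * c.e w₂ - a * c.e w₁)) (Q + 2 * a) (U / 40)
    (c.shift_mem hζmem (i + 1)) (c.shift_mem hζmem (i + 2)) (by linarith) (fun _ => hζle _)
    (fun _ => hζle _) (hζne _) (hζne _)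
    (hXQ.add (by simpa using c.isUnitLog_int_mul_e_sub a w₂ w₁))
    (by rw [hform]; exact hne₁) (by linarith) ?_ ?_
  · refine le_of_mul_le_mul_right ?_ (show 0 < c.ht by linarith)
    have h1 : 0 ≤ 2000 * c.ht * (l + c.ht) * c.ht := by positivity
    linarith
  · rw [hform]
    refine hS.form_le'.trans ?_
    have h9 : (9 : ℝ) ≤ Real.exp 4 := by
      have h2 : (2 : ℝ) ≤ Real.exp 1 := by linarith [Real.add_one_le_exp (1 : ℝ)]
      have h3 : Real.exp 4 = Real.exp 1 ^ 4 := by rw [← Real.exp_nat_mul]; norm_num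
      rw [h3]
      calc (9 : ℝ) ≤ 2 ^ 4 := by norm_num
        _ ≤ _ := by gcongr
    calc 9 * Real.exp (-(a * c.ht / 20)) ≤ Real.exp 4 * Real.exp (-(a * c.ht / 20)) := by gcongr
      _ = Real.exp (4 - U / 20) := by rw [← Real.exp_add]; congr 1
      _ ≤ _ := by apply Real.exp_le_exp.2; linarith
  · rw [one_div, inv_mul_le_iff₀ (by positivity)]
    have h1 : Q + 2 * a ≤ (K + 2) * c.ht ^ 2 * a := by
      have : (1 : ℝ) * a ≤ c.ht ^ 2 * a := by gcongr; exact one_le_pow₀ hht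
      linarith
    calc Q + 2 * a ≤ (K + 2) * c.ht ^ 2 * a := h1
      _ ≤ (K + 2) * c.ht ^ 4 * a := by gcongr; norm_num
      _ = _ := by rw [hUdef]; ring

end SimplestCubic

/-- The shape of the bound for the exponent, with `l` the logarithm of the bound for the norm. -/
lemma SimplestCubic.exists_ht_mul_le : ∃ C : ℝ, 0 < C ∧ ∀ (c : SimplestCubic) (l : ℝ), 0 ≤ l →
    c.ht * (l + c.ht) ≤ C * (if 3 ≤ c.n then
      (l + Real.log c.n) * Real.log c.n * Real.log (Real.log c.n) else 1 + l) := by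
  have h3 : 1 < Real.log 3 := (Real.lt_log_iff_exp_lt (by norm_num)).2 Real.exp_one_lt_three
  have hκ : 0 < Real.log (Real.log 3) := Real.log_pos h3
  refine ⟨9 / Real.log (Real.log 3) + 16, by positivity, fun c l hl => ?_⟩
  have hht := c.one_le_ht
  have hle := c.ht_le_log
  split_ifs with hn
  · have hn' : (3 : ℝ) ≤ c.n := by exact_mod_cast hn
    have hlog : Real.log 3 ≤ Real.log c.n := Real.log_le_log (by norm_num) hn'
    have hloglog : Real.log (Real.log 3) ≤ Real.log (Real.log c.n) :=
      Real.log_le_log (by linarith) hlog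
    have h2 : Real.log (c.n + 2) ≤ 2 * Real.log c.n := by
      have : Real.log (c.n + 2) ≤ Real.log ((c.n : ℝ) ^ 2) :=
        Real.log_le_log (by linarith) (by nlinarith only [hn'])
      simpa using this
    have hht3 : c.ht ≤ 3 * Real.log c.n := by linarith
    have hM : 0 ≤ (l + Real.log c.n) * Real.log c.n :=
      mul_nonneg (by linarith) (by linarith)
    calc c.ht * (l + c.ht) ≤ 3 * Real.log c.n * (3 * l + 3 * Real.log c.n) := by
          gcongr; linarith
      _ = 9 / Real.log (Real.log 3) * ((l + Real.log c.n) * Real.log c.n * Real.log (Real.log 3)) := by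
          field_simp; ring
      _ ≤ (9 / Real.log (Real.log 3) + 16) *
          ((l + Real.log c.n) * Real.log c.n * Real.log (Real.log c.n)) := by
          gcongr; linarith
  · have hn' : (c.n : ℝ) ≤ 2 := by exact_mod_cast (by omega : c.n ≤ 2)
    have h0 : (0 : ℝ) ≤ c.n := by exact_mod_cast c.n_nonneg
    have h4 : Real.log (c.n + 2) ≤ 3 :=
      (Real.log_le_sub_one_of_pos (by linarith)).trans (by linarith)
    have : c.ht ≤ 4 := by linarith
    calc c.ht * (l + c.ht) ≤ 4 * (4 * l + 4) := by gcongr; linarith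
      _ = 16 * (1 + l) := by ring
      _ ≤ _ := by gcongr; linarith [div_pos (show (0 : ℝ) < 9 by norm_num) hκ]

end

theorem stmt2 :
    ∃ C : ℝ, 0 < C ∧ ∀ (n a m x y : ℤ) (l0 l1 l2 : ℝ), IsRoots n l0 l1 l2 →
      0 ≤ n → 1 ≤ a → 1 ≤ m →
      0 < |Fna a l0 l1 l2 (x : ℝ) (y : ℝ)| →
      |Fna a l0 l1 l2 (x : ℝ) (y : ℝ)| ≤ (m : ℝ) →
      2 * (m : ℝ) ^ ((1 : ℝ) / 3) ≤ |(y : ℝ)| →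
      (a : ℝ) ≤
        C * (if 3 ≤ n then
              (Real.log (m : ℝ) + Real.log (n : ℝ)) * Real.log (n : ℝ) *
                Real.log (Real.log (n : ℝ))
             else 1 + Real.log (m : ℝ)) := by
  obtain ⟨C, hC, bound⟩ := SimplestCubic.exists_exponent_bound
  obtain ⟨C', hC', bound'⟩ := SimplestCubic.exists_ht_mul_le
  refine ⟨C * C', by positivity, ?_⟩
  intro n a m x y l0 l1 l2 hr hn ha hm hpos hle hy
  obtain ⟨c, rfl, hF⟩ := hr.exists_simplestCubic hn
  rw [hF] at hpos hle
  obtain ⟨b, rfl⟩ := Int.eq_ofNat_of_zero_le (by omega : 0 ≤ a)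
  simp only [Fna, zpow_natCast] at hpos hle
  have hm' : (1 : ℝ) ≤ m := by exact_mod_cast hm
  have hy3 : 8 * (m : ℝ) ≤ |(y : ℝ)| ^ 3 := by
    calc 8 * (m : ℝ) = (2 * (m : ℝ) ^ ((1 : ℝ) / 3)) ^ 3 := by
          rw [mul_pow, ← Real.rpow_mul_natCast (by linarith)]; norm_num
      _ ≤ _ := by gcongr
  have hmem : (fun t => (x : ℝ) - c.lam t ^ b * y) ∈ c.order :=
    c.order.sub_mem (intCast_mem c.order x)
      (c.order.mul_mem (c.order.pow_mem c.lam_mem b) (intCast_mem c.order y))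
  have hne : ∀ t, (x : ℝ) - c.lam t ^ b * y ≠ 0 := by
    have h := abs_pos.1 hpos
    intro t
    fin_cases t
    · exact left_ne_zero_of_mul (left_ne_zero_of_mul h)
    · exact right_ne_zero_of_mul (left_ne_zero_of_mul h)
    · exact right_ne_zero_of_mul h
  have h1 := bound c b x y m _ hmem (fun _ => rfl) hne hle hm' hy3
  have h2 := bound' c (Real.log m) (Real.log_nonneg hm')
  calc ((b : ℤ) : ℝ) ≤ C * c.ht * (Real.log m + c.ht) := by exact_mod_cast h1
    _ = C * (c.ht * (Real.log m + c.ht)) := by ring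
    _ ≤ _ := by rw [mul_assoc]; gcongr
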